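/- Consider the two-user state-dependent discrete memoryless generalized multiple-access channel (GMAC) with correlated states in which encoder k knows the state sequences (S_0^n, S_k^n) noncausally and observes the feedback output Y_k with one channel-use delay, for k in {1,2}. For every joint pmf of the form p(s0) p(s1|s0) p(s2|s0) p(u|s0) p(v1|s0,s1,u) p(v2|s0,s2,u) p(v13,x1|u,v1,s0,s1) p(v23,x2|u,v2,s0,s2) p(y1,y2,y3|x1,x2,s0,s1,s2) on finite alphabets, every rate pair (R1,R2) in the closure of the convex hull of the set of pairs with R1 = R12 + R13 and R2 = R21 + R23 satisfying: 0 <= R12 < I(V1;Y2|S0,S2,U,X2) - I(V1;S1|S0,U); 0 <= R21 < I(V2;Y1|S0,S1,U,X1) - I(V2;S2|S0,U); 0 <= R13 < I(V13;Y3|U,V1,V2,V23) - I(V13;S0,S1|U,V1,V2,V23) + delta1^-; 0 <= R23 < I(V23;Y3|U,V1,V2,V13) - I(V23;S0,S2|U,V1,V2,V13) + delta2^-; R13 + R23 < I(V13,V23;Y3|U,V1,V2) - I(V13,V23;S0,S1,S2|U,V1,V2) + Delta^-; and R12 + R13 + R21 + R23 < I(U,V1,V2,V13,V23;Y3) - I(U,V1,V2,V13,V23;S0,S1,S2),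 is achievable, i.e., there exists a sequence of length-n codes for this channel whose average probability of error tends to zero as n tends to infinity. -/

import Mathlib

noncomputable section
open Finset

namespace Stmt0

/-! ### Entropy and mutual information for finite-alphabet pmfs (in bits) -/

open Classical in
/-- The marginal pmf of the "random variable" `f` under the joint pmf `p`. -/
def marg {T A : Type*} [Fintype T] (p : T → ℝ) (f : T → A) : A → ℝ :=
  fun a => ∑ t, if f t = a then p t else 0

/-- Shannon entropy (base 2) of a pmf on a finite alphabet. -/
def ent {A : Type*} [Fintype A] (q : A → ℝ) : ℝ := ∑ a, -(q a * Real.logb 2 (q a))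

/-- Entropy of the random variable `f` under the joint pmf `p`. -/
def entOf {T A : Type*} [Fintype T] [Fintype A] (p : T → ℝ) (f : T → A) : ℝ :=
  ent (marg p f)

/-- Mutual information `I(f; g)` under the joint pmf `p`. -/
def mi {T A B : Type*} [Fintype T] [Fintype A] [Fintype B]
    (p : T → ℝ) (f : T → A) (g : T → B) : ℝ :=
  entOf p f + entOf p g - entOf p (fun t => (f t, g t))

/-- Conditional mutual information `I(f; g | h)` under the joint pmf `p`. -/
def cmi {T A B C : Type*} [Fintype T] [Fintype A] [Fintype B] [Fintype C]
    (p : T → ℝ) (f : T → A) (g : T → B) (h : T → C) : ℝ :=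
  entOf p (fun t => (f t, h t)) + entOf p (fun t => (g t, h t)) -
    entOf p (fun t => (f t, g t, h t)) - entOf p h

/-- A conditional pmf: nonnegative and, for every value of the conditioning argument,
summing to one over the first argument. -/
def IsCondPMF {A B : Type*} [Fintype A] (q : A → B → ℝ) : Prop :=
  (∀ a b, 0 ≤ q a b) ∧ ∀ b, ∑ a, q a b = 1

/-! ### Codes for the state-dependent DM GMAC -/

open Classical in
/-- Truncation of a feedback sequence: at time `t` only the outputs at times `t' < t`
are available (strictly causal feedback). -/
def trunc {Y : Type*} [Nonempty Y] {n : ℕ} (y : Fin n → Y) (t : Fin n) : Fin n → Y :=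
  fun t' => if (t' : ℕ) < (t : ℕ) then y t' else Classical.ofNonempty

variable {𝒮0 𝒮1 𝒮2 𝒳1 𝒳2 𝒴1 𝒴2 𝒴3 : Type*}
  [Fintype 𝒮0] [Fintype 𝒮1] [Fintype 𝒮2] [Fintype 𝒳1] [Fintype 𝒳2]
  [Fintype 𝒴1] [Fintype 𝒴2] [Fintype 𝒴3]
  [Nonempty 𝒮0] [Nonempty 𝒮1] [Nonempty 𝒮2] [Nonempty 𝒳1] [Nonempty 𝒳2]
  [Nonempty 𝒴1] [Nonempty 𝒴2] [Nonempty 𝒴3]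

/-- Probability of the state/output sequences `(s₀ⁿ,s₁ⁿ,s₂ⁿ,y₁ⁿ,y₂ⁿ,y₃ⁿ)` when the
messages are `(m₁,m₂)`: the states are i.i.d. `q₀(s₀)q₁(s₁|s₀)q₂(s₂|s₀)`, the channel
acts memorylessly through `W`, and encoder `k` computes its time-`t` input from its
message, its noncausal state knowledge `(s₀ⁿ, s_kⁿ)` and its strictly causal feedback
`y_k^{t-1}`. -/
def seqProb {n : ℕ} {K1 K2 : ℕ}
    (q0 : 𝒮0 → ℝ) (q1 : 𝒮1 → 𝒮0 → ℝ) (q2 : 𝒮2 → 𝒮0 → ℝ)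
    (W : 𝒴1 × 𝒴2 × 𝒴3 → 𝒳1 × 𝒳2 × 𝒮0 × 𝒮1 × 𝒮2 → ℝ)
    (φ1 : Fin K1 → (Fin n → 𝒮0) → (Fin n → 𝒮1) → (Fin n → 𝒴1) → Fin n → 𝒳1)
    (φ2 : Fin K2 → (Fin n → 𝒮0) → (Fin n → 𝒮2) → (Fin n → 𝒴2) → Fin n → 𝒳2)
    (m1 : Fin K1) (m2 : Fin K2)
    (s0 : Fin n → 𝒮0) (s1 : Fin n → 𝒮1) (s2 : Fin n → 𝒮2)
    (y1 : Fin n → 𝒴1) (y2 : Fin n → 𝒴2) (y3 : Fin n → 𝒴3) : ℝ :=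
  ∏ t : Fin n,
    q0 (s0 t) * q1 (s1 t) (s0 t) * q2 (s2 t) (s0 t) *
      W (y1 t, y2 t, y3 t)
        (φ1 m1 s0 s1 (trunc y1 t) t, φ2 m2 s0 s2 (trunc y2 t) t, s0 t, s1 t, s2 t)

open Classical in
/-- Average (over equiprobable messages) probability of error of a code. -/
def Pe {n : ℕ} {K1 K2 : ℕ}
    (q0 : 𝒮0 → ℝ) (q1 : 𝒮1 → 𝒮0 → ℝ) (q2 : 𝒮2 → 𝒮0 → ℝ)
    (W : 𝒴1 × 𝒴2 × 𝒴3 → 𝒳1 × 𝒳2 × 𝒮0 × 𝒮1 × 𝒮2 → ℝ)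
    (φ1 : Fin K1 → (Fin n → 𝒮0) → (Fin n → 𝒮1) → (Fin n → 𝒴1) → Fin n → 𝒳1)
    (φ2 : Fin K2 → (Fin n → 𝒮0) → (Fin n → 𝒮2) → (Fin n → 𝒴2) → Fin n → 𝒳2)
    (ψ : (Fin n → 𝒴3) → Fin K1 × Fin K2) : ℝ :=
  ((K1 : ℝ) * (K2 : ℝ))⁻¹ *
    ∑ m1 : Fin K1, ∑ m2 : Fin K2,
      ∑ s0 : Fin n → 𝒮0, ∑ s1 : Fin n → 𝒮1, ∑ s2 : Fin n → 𝒮2,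
        ∑ y1 : Fin n → 𝒴1, ∑ y2 : Fin n → 𝒴2, ∑ y3 : Fin n → 𝒴3,
          if ψ y3 ≠ (m1, m2) then
            seqProb q0 q1 q2 W φ1 φ2 m1 m2 s0 s1 s2 y1 y2 y3
          else 0

/-- `(R₁,R₂)` is achievable for the state-dependent DM GMAC: for every `ε > 0` there is
a blocklength-`n` code with rates at least `R_k - ε` and average error probability at
most `ε`. -/
def Achievable
    (q0 : 𝒮0 → ℝ) (q1 : 𝒮1 → 𝒮0 → ℝ) (q2 : 𝒮2 → 𝒮0 → ℝ)
    (W : 𝒴1 × 𝒴2 × 𝒴3 → 𝒳1 × 𝒳2 × 𝒮0 × 𝒮1 × 𝒮2 → ℝ)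
    (R1 R2 : ℝ) : Prop :=
  ∀ ε : ℝ, 0 < ε →
    ∃ (n : ℕ), 0 < n ∧
      ∃ (K1 K2 : ℕ), 0 < K1 ∧ 0 < K2 ∧
        ∃ (φ1 : Fin K1 → (Fin n → 𝒮0) → (Fin n → 𝒮1) → (Fin n → 𝒴1) → Fin n → 𝒳1)
          (φ2 : Fin K2 → (Fin n → 𝒮0) → (Fin n → 𝒮2) → (Fin n → 𝒴2) → Fin n → 𝒳2)
          (ψ : (Fin n → 𝒴3) → Fin K1 × Fin K2),
          R1 - ε ≤ Real.logb 2 K1 / n ∧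
          R2 - ε ≤ Real.logb 2 K2 / n ∧
          Pe q0 q1 q2 W φ1 φ2 ψ ≤ ε

/-! ### Theorem 1 -/

/-- The rate region of Theorem 1 associated with a joint pmf `p` of
`(S₀,S₁,S₂,U,V₁,V₂,V₁₃,V₂₃,X₁,X₂,Y₁,Y₂,Y₃)`. -/
def region {U V1 V2 V13 V23 : Type*}
    [Fintype U] [Fintype V1] [Fintype V2] [Fintype V13] [Fintype V23]
    (p : 𝒮0 × 𝒮1 × 𝒮2 × U × V1 × V2 × V13 × V23 × 𝒳1 × 𝒳2 × 𝒴1 × 𝒴2 × 𝒴3 → ℝ) :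
    Set (ℝ × ℝ) :=
  let pS0 := fun t : 𝒮0 × 𝒮1 × 𝒮2 × U × V1 × V2 × V13 × V23 × 𝒳1 × 𝒳2 × 𝒴1 × 𝒴2 × 𝒴3 =>
    t.1
  let pS1 := fun t : 𝒮0 × 𝒮1 × 𝒮2 × U × V1 × V2 × V13 × V23 × 𝒳1 × 𝒳2 × 𝒴1 × 𝒴2 × 𝒴3 =>
    t.2.1
  let pS2 := fun t : 𝒮0 × 𝒮1 × 𝒮2 × U × V1 × V2 × V13 × V23 × 𝒳1 × 𝒳2 × 𝒴1 × 𝒴2 × 𝒴3 =>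
    t.2.2.1
  let pU := fun t : 𝒮0 × 𝒮1 × 𝒮2 × U × V1 × V2 × V13 × V23 × 𝒳1 × 𝒳2 × 𝒴1 × 𝒴2 × 𝒴3 =>
    t.2.2.2.1
  let pV1 := fun t : 𝒮0 × 𝒮1 × 𝒮2 × U × V1 × V2 × V13 × V23 × 𝒳1 × 𝒳2 × 𝒴1 × 𝒴2 × 𝒴3 =>
    t.2.2.2.2.1
  let pV2 := fun t : 𝒮0 × 𝒮1 × 𝒮2 × U × V1 × V2 × V13 × V23 × 𝒳1 × 𝒳2 × 𝒴1 × 𝒴2 × 𝒴3 =>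
    t.2.2.2.2.2.1
  let pV13 := fun t : 𝒮0 × 𝒮1 × 𝒮2 × U × V1 × V2 × V13 × V23 × 𝒳1 × 𝒳2 × 𝒴1 × 𝒴2 × 𝒴3 =>
    t.2.2.2.2.2.2.1
  let pV23 := fun t : 𝒮0 × 𝒮1 × 𝒮2 × U × V1 × V2 × V13 × V23 × 𝒳1 × 𝒳2 × 𝒴1 × 𝒴2 × 𝒴3 =>
    t.2.2.2.2.2.2.2.1
  let pX1 := fun t : 𝒮0 × 𝒮1 × 𝒮2 × U × V1 × V2 × V13 × V23 × 𝒳1 × 𝒳2 × 𝒴1 × 𝒴2 × 𝒴3 =>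
    t.2.2.2.2.2.2.2.2.1
  let pX2 := fun t : 𝒮0 × 𝒮1 × 𝒮2 × U × V1 × V2 × V13 × V23 × 𝒳1 × 𝒳2 × 𝒴1 × 𝒴2 × 𝒴3 =>
    t.2.2.2.2.2.2.2.2.2.1
  let pY1 := fun t : 𝒮0 × 𝒮1 × 𝒮2 × U × V1 × V2 × V13 × V23 × 𝒳1 × 𝒳2 × 𝒴1 × 𝒴2 × 𝒴3 =>
    t.2.2.2.2.2.2.2.2.2.2.1
  let pY2 := fun t : 𝒮0 × 𝒮1 × 𝒮2 × U × V1 × V2 × V13 × V23 × 𝒳1 × 𝒳2 × 𝒴1 × 𝒴2 × 𝒴3 =>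
    t.2.2.2.2.2.2.2.2.2.2.2.1
  let pY3 := fun t : 𝒮0 × 𝒮1 × 𝒮2 × U × V1 × V2 × V13 × V23 × 𝒳1 × 𝒳2 × 𝒴1 × 𝒴2 × 𝒴3 =>
    t.2.2.2.2.2.2.2.2.2.2.2.2
  -- the correction terms
  let δ1 : ℝ := min 0
    (cmi p pV1 pY3 (fun t => (pU t, pV2 t, pV23 t)) -
      cmi p pV1 (fun t => (pS0 t, pS1 t)) (fun t => (pU t, pV2 t, pV23 t)))
  let δ2 : ℝ := min 0
    (cmi p pV2 pY3 (fun t => (pU t, pV1 t, pV13 t)) -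
      cmi p pV2 (fun t => (pS0 t, pS2 t)) (fun t => (pU t, pV1 t, pV13 t)))
  let Δ1 : ℝ := cmi p pV1 pY3 (fun t => (pU t, pV2 t)) -
    cmi p pV1 (fun t => (pS0 t, pS1 t)) (fun t => (pU t, pV2 t))
  let Δ2 : ℝ := cmi p pV2 pY3 (fun t => (pU t, pV1 t)) -
    cmi p pV2 (fun t => (pS0 t, pS2 t)) (fun t => (pU t, pV1 t))
  let Δ3 : ℝ := cmi p (fun t => (pV1 t, pV2 t)) pY3 pU -
    cmi p (fun t => (pV1 t, pV2 t)) (fun t => (pS0 t, pS1 t, pS2 t)) pU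
  let Δm : ℝ := min 0 (min Δ1 (min Δ2 Δ3))
  {R : ℝ × ℝ | ∃ R12 R13 R21 R23 : ℝ,
    R.1 = R12 + R13 ∧ R.2 = R21 + R23 ∧
    0 ≤ R12 ∧
    R12 < cmi p pV1 pY2 (fun t => (pS0 t, pS2 t, pU t, pX2 t)) -
      cmi p pV1 pS1 (fun t => (pS0 t, pU t)) ∧
    0 ≤ R21 ∧
    R21 < cmi p pV2 pY1 (fun t => (pS0 t, pS1 t, pU t, pX1 t)) -
      cmi p pV2 pS2 (fun t => (pS0 t, pU t)) ∧
    0 ≤ R13 ∧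
    R13 < cmi p pV13 pY3 (fun t => (pU t, pV1 t, pV2 t, pV23 t)) -
      cmi p pV13 (fun t => (pS0 t, pS1 t)) (fun t => (pU t, pV1 t, pV2 t, pV23 t)) +
      δ1 ∧
    0 ≤ R23 ∧
    R23 < cmi p pV23 pY3 (fun t => (pU t, pV1 t, pV2 t, pV13 t)) -
      cmi p pV23 (fun t => (pS0 t, pS2 t)) (fun t => (pU t, pV1 t, pV2 t, pV13 t)) +
      δ2 ∧
    R13 + R23 < cmi p (fun t => (pV13 t, pV23 t)) pY3 (fun t => (pU t, pV1 t, pV2 t)) -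
      cmi p (fun t => (pV13 t, pV23 t)) (fun t => (pS0 t, pS1 t, pS2 t))
        (fun t => (pU t, pV1 t, pV2 t)) + Δm ∧
    R12 + R13 + R21 + R23 <
      mi p (fun t => (pU t, pV1 t, pV2 t, pV13 t, pV23 t)) pY3 -
      mi p (fun t => (pU t, pV1 t, pV2 t, pV13 t, pV23 t))
        (fun t => (pS0 t, pS1 t, pS2 t))}

/-! ### Indicators and sums over function spaces -/

open Classical in
/-- The real-valued indicator of a proposition. -/
def ind (p : Prop) : ℝ := if p then 1 else 0

lemma ind_nonneg (p : Prop) : 0 ≤ ind p := by unfold ind; split_ifs <;> norm_num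

lemma ind_le_one (p : Prop) : ind p ≤ 1 := by unfold ind; split_ifs <;> norm_num

lemma ind_of_true {p : Prop} (h : p) : ind p = 1 := if_pos h

lemma ind_of_false {p : Prop} (h : ¬ p) : ind p = 0 := if_neg h

lemma ind_mono {p q : Prop} (h : p → q) : ind p ≤ ind q := by
  by_cases hp : p
  · rw [ind_of_true hp, ind_of_true (h hp)]
  · rw [ind_of_false hp]; exact ind_nonneg _

lemma sum_prod_pi {ι A : Type*} [Fintype ι] [DecidableEq ι] [Fintype A] (g : ι → A → ℝ) :
    ∑ f : ι → A, ∏ i, g i (f i) = ∏ i, ∑ a, g i a := by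
  rw [Finset.prod_univ_sum, Fintype.piFinset_univ]

/-! ### Random codebooks: independent inclusion of the elements of a finite type -/

section Bernoulli

/-- The probability of the random subset `C` when `v` is included with probability `τ v`,
independently over `v`. -/
def bern {α : Type*} [Fintype α] (τ : α → ℝ) (C : α → Bool) : ℝ := ∏ v, if C v then τ v else 1 - τ v

/-- Membership in the random subset, as a real number. -/
def hit {α : Type*} (C : α → Bool) (v : α) : ℝ := if C v then 1 else 0

lemma hit_nonneg {α : Type*} (C : α → Bool) (v : α) : 0 ≤ hit C v := by
  unfold hit; split_ifs <;> norm_num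

lemma hit_sq {α : Type*} (C : α → Bool) (v : α) : hit C v ^ 2 = hit C v := by
  unfold hit; split_ifs <;> norm_num

lemma bern_nonneg {α : Type*} [Fintype α] {τ : α → ℝ} (h0 : ∀ v, 0 ≤ τ v) (h1 : ∀ v, τ v ≤ 1)
    (C : α → Bool) :
    0 ≤ bern τ C :=
  prod_nonneg fun v _ => by split_ifs; exacts [h0 v, sub_nonneg.2 (h1 v)]

/-- The inclusion probabilities conditioned on the inclusion of `X`. -/
def tilt {α : Type*} [DecidableEq α] (θ : α → ℝ) (X : Finset α) (v : α) : ℝ :=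
  if v ∈ X then 1 else θ v

lemma tilt_nonneg {α : Type*} [DecidableEq α] {θ : α → ℝ} (h0 : ∀ v, 0 ≤ θ v) (X : Finset α)
    (v : α) :
    0 ≤ tilt θ X v := by unfold tilt; split_ifs; exacts [zero_le_one, h0 v]

lemma tilt_le_one {α : Type*} [DecidableEq α] {θ : α → ℝ} (h1 : ∀ v, θ v ≤ 1) (X : Finset α)
    (v : α) :
    tilt θ X v ≤ 1 := by unfold tilt; split_ifs; exacts [le_rfl, h1 v]

variable {α : Type*} [Fintype α] [DecidableEq α]

lemma sum_bern_prod_hit (τ : α → ℝ) (Y : Finset α) :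
    ∑ C, bern τ C * ∏ y ∈ Y, hit C y = ∏ y ∈ Y, τ y := by
  have h : ∀ C : α → Bool, bern τ C * ∏ y ∈ Y, hit C y =
      ∏ v, (if C v then τ v else if v ∈ Y then 0 else 1 - τ v) := by
    intro C
    rw [bern, ← Fintype.prod_ite_mem Y, ← prod_mul_distrib]
    refine prod_congr rfl fun v _ => ?_
    unfold hit
    split_ifs <;> simp
  simp_rw [h]
  rw [sum_prod_pi (fun v (b : Bool) => if b then τ v else if v ∈ Y then 0 else 1 - τ v)]
  simp only [Fintype.sum_bool, if_true, Bool.false_eq_true, if_false]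
  rw [← Fintype.prod_ite_mem Y]
  refine prod_congr rfl fun v _ => ?_
  split_ifs <;> simp

lemma sum_bern (τ : α → ℝ) : ∑ C, bern τ C = 1 := by
  simpa using sum_bern_prod_hit τ ∅

lemma sum_bern_hit (τ : α → ℝ) (v : α) : ∑ C, bern τ C * hit C v = τ v := by
  simpa using sum_bern_prod_hit τ {v}

lemma sum_bern_hit_mul_hit (τ : α → ℝ) {v v' : α} (h : v ≠ v') :
    ∑ C, bern τ C * (hit C v * hit C v') = τ v * τ v' := by
  simpa [Finset.prod_pair h] using sum_bern_prod_hit τ {v, v'}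

lemma bern_mul_prod_hit {θ : α → ℝ} {X : Finset α} (hθ : ∀ x ∈ X, θ x ≠ 0) (C : α → Bool) :
    bern θ C * ∏ x ∈ X, ((θ x)⁻¹ * hit C x) = bern (tilt θ X) C := by
  rw [bern, bern, ← Fintype.prod_ite_mem X, ← prod_mul_distrib]
  refine prod_congr rfl fun v _ => ?_
  unfold hit tilt
  by_cases hv : v ∈ X <;> by_cases hc : C v = true <;> simp [hv, hc]
  exact mul_inv_cancel₀ (hθ v hv)

/-- Second moment of a centred linear combination of memberships. -/
lemma sum_bern_sq_linear {V : Type*} [Fintype V] (τ : α → ℝ) (e : V → α)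
    (he : Function.Injective e) (c : V → ℝ) :
    ∑ C, bern τ C * (∑ v, c v * (hit C (e v) - τ (e v))) ^ 2 =
      ∑ v, c v ^ 2 * (τ (e v) * (1 - τ (e v))) := by
  classical
  have hpair : ∀ v v', ∑ C, bern τ C * ((hit C (e v) - τ (e v)) * (hit C (e v') - τ (e v'))) =
      if v = v' then τ (e v) * (1 - τ (e v)) else 0 := by
    intro v v'
    have hexp : ∀ C, bern τ C * ((hit C (e v) - τ (e v)) * (hit C (e v') - τ (e v'))) =
        bern τ C * (hit C (e v) * hit C (e v')) - τ (e v') * (bern τ C * hit C (e v))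
          - τ (e v) * (bern τ C * hit C (e v')) + τ (e v) * τ (e v') * bern τ C := by
      intro C; ring
    simp_rw [hexp, sum_add_distrib, sum_sub_distrib, ← mul_sum, sum_bern_hit, sum_bern]
    split_ifs with h
    · subst h
      have : ∀ C, bern τ C * (hit C (e v) * hit C (e v)) = bern τ C * hit C (e v) := by
        intro C; rw [← sq, hit_sq]
      simp_rw [this, sum_bern_hit]; ring
    · rw [sum_bern_hit_mul_hit τ (he.ne h)]; ring
  have hsq : ∀ C, bern τ C * (∑ v, c v * (hit C (e v) - τ (e v))) ^ 2 =
      ∑ v, ∑ v', c v * c v' *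
        (bern τ C * ((hit C (e v) - τ (e v)) * (hit C (e v') - τ (e v')))) := by
    intro C
    rw [sq, sum_mul_sum, mul_sum]
    refine sum_congr rfl fun v _ => ?_
    rw [mul_sum]
    exact sum_congr rfl fun v' _ => by ring
  simp_rw [hsq]
  rw [sum_comm]
  refine sum_congr rfl fun v _ => ?_
  rw [sum_comm]
  simp_rw [← mul_sum, hpair]
  simp [sq]

lemma sum_mul_abs_le_sqrt {β : Type*} [Fintype β] {w D : β → ℝ} (hw : ∀ b, 0 ≤ w b)
    (hw1 : ∑ b, w b = 1) {η : ℝ} (h : ∑ b, w b * D b ^ 2 ≤ η) :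
    ∑ b, w b * |D b| ≤ √η := by
  apply Real.le_sqrt_of_sq_le
  have := Finset.sum_mul_sq_le_sq_mul_sq univ (fun b => √(w b)) (fun b => √(w b) * |D b|)
  have e1 : ∀ b, √(w b) * (√(w b) * |D b|) = w b * |D b| := fun b => by
    rw [← mul_assoc, Real.mul_self_sqrt (hw b)]
  simp only [e1, mul_pow, Real.sq_sqrt (hw _), sq_abs, hw1, one_mul] at this
  exact this.trans h

/-- The expected excess over one of the total weight of the codewords that are present,
given that the codeword `v₀` is present. -/
lemma sum_bern_tilt_excess_le {V : Type*} [Fintype V] {θ : α → ℝ} (h0 : ∀ v, 0 ≤ θ v)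
    (h1 : ∀ v, θ v ≤ 1) (X : Finset α) (e : V → α) (he : Function.Injective e) {v₀ : V}
    (hX : ∀ v, e v ∈ X → v = v₀) {ϑ μ η : ℝ} (hϑ : 0 < ϑ) (hϑ1 : ϑ ≤ 1)
    (hθ : ∀ v, θ (e v) = ϑ) {k : V → ℝ}
    (hk : ∀ v, 0 ≤ k v) (hkμ : ∀ v, k v ≤ μ) (hk1 : ∑ v, k v ≤ 1) (hη : (ϑ⁻¹ - 1) * μ ≤ η) :
    ∑ C, bern (tilt θ X) C * max 0 (∑ v, hit C (e v) * ϑ⁻¹ * k v - 1) ≤ η + √η := by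
  classical
  set τ := tilt θ X with hτ
  have hinv : 1 ≤ ϑ⁻¹ := (one_le_inv₀ hϑ).2 hϑ1
  have hb : ∀ C, 0 ≤ bern τ C := bern_nonneg (tilt_nonneg h0 X) (tilt_le_one h1 X)
  have hτe : ∀ v, τ (e v) = if e v ∈ X then 1 else ϑ := fun v => by
    rw [hτ, tilt]; split_ifs; exacts [rfl, hθ v]
  have hmean : ∑ v, τ (e v) * ϑ⁻¹ * k v ≤ 1 + η := by
    have : ∀ v, τ (e v) * ϑ⁻¹ * k v ≤ k v + if v = v₀ then (ϑ⁻¹ - 1) * μ else 0 := by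
      intro v
      rw [hτe]
      by_cases hv : e v ∈ X
      · rw [if_pos hv, if_pos (hX v hv)]
        nlinarith [hkμ v, hk v]
      · rw [if_neg hv, mul_inv_cancel₀ hϑ.ne']
        split_ifs
        · nlinarith [hkμ v, hk v]
        · linarith
    calc _ ≤ ∑ v, (k v + if v = v₀ then (ϑ⁻¹ - 1) * μ else 0) := sum_le_sum fun v _ => this v
      _ = ∑ v, k v + (ϑ⁻¹ - 1) * μ := by rw [sum_add_distrib]; simp
      _ ≤ 1 + η := by linarith
  have hη0 : 0 ≤ η := le_trans (mul_nonneg (by linarith) ((hk v₀).trans (hkμ v₀))) hη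
  have hvar : ∑ C, bern τ C * (∑ v, (ϑ⁻¹ * k v) * (hit C (e v) - τ (e v))) ^ 2 ≤ η := by
    rw [sum_bern_sq_linear τ e he]
    have : ∀ v, (ϑ⁻¹ * k v) ^ 2 * (τ (e v) * (1 - τ (e v))) ≤ k v * η := by
      intro v
      rw [hτe]
      split_ifs
      · simpa using mul_nonneg (hk v) hη0
      · have e1 : (ϑ⁻¹ * k v) ^ 2 * (ϑ * (1 - ϑ)) = k v * ((ϑ⁻¹ - 1) * k v) := by
          field_simp
        rw [e1]
        refine mul_le_mul_of_nonneg_left (le_trans ?_ hη) (hk v)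
        exact mul_le_mul_of_nonneg_left (hkμ v) (by linarith)
    calc _ ≤ ∑ v, k v * η := sum_le_sum fun v _ => this v
      _ = (∑ v, k v) * η := by rw [sum_mul]
      _ ≤ η := by nlinarith
  have habs := sum_mul_abs_le_sqrt hb (sum_bern τ) hvar
  calc _ ≤ ∑ C, (bern τ C * η +
        bern τ C * |∑ v, (ϑ⁻¹ * k v) * (hit C (e v) - τ (e v))|) := by
        refine sum_le_sum fun C _ => ?_
        rw [← mul_add]
        refine mul_le_mul_of_nonneg_left ?_ (hb C)
        have e2 : ∑ v, hit C (e v) * ϑ⁻¹ * k v =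
            ∑ v, (ϑ⁻¹ * k v) * (hit C (e v) - τ (e v)) + ∑ v, τ (e v) * ϑ⁻¹ * k v := by
          rw [← sum_add_distrib]; exact sum_congr rfl fun v _ => by ring
        rw [e2]
        apply max_le
        · positivity
        · linarith [le_abs_self (∑ v, (ϑ⁻¹ * k v) * (hit C (e v) - τ (e v)))]
    _ = η + ∑ C, bern τ C * |∑ v, (ϑ⁻¹ * k v) * (hit C (e v) - τ (e v))| := by
        rw [sum_add_distrib, ← sum_mul, sum_bern, one_mul]
    _ ≤ η + √η := by linarith

end Bernoulli

/-! ### Stochastic selection of a codeword and its derandomization -/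

/-- Selection of an element with probability proportional to the weights `c`, which are
left unchanged if their total does not exceed one. -/
def sel {V : Type*} [Fintype V] (c : V → ℝ) (v : V) : ℝ := c v / max 1 (∑ v', c v')

lemma sel_nonneg {V : Type*} [Fintype V] {c : V → ℝ} (hc : ∀ v, 0 ≤ c v) (v : V) :
    0 ≤ sel c v := div_nonneg (hc v) (le_trans zero_le_one (le_max_left _ _))

lemma sum_sel_le_one {V : Type*} [Fintype V] (c : V → ℝ) : ∑ v, sel c v ≤ 1 := by
  unfold sel
  rw [← sum_div]
  exact div_le_one_of_le₀ (le_max_right _ _) (le_trans zero_le_one (le_max_left _ _))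

lemma inv_max_one_mem (S : ℝ) :
    0 ≤ (max 1 S)⁻¹ ∧ (max 1 S)⁻¹ ≤ 1 ∧ 1 - max 0 (S - 1) ≤ (max 1 S)⁻¹ := by
  have h1 : 1 ≤ max 1 S := le_max_left _ _
  refine ⟨by positivity, inv_le_one_of_one_le₀ h1, ?_⟩
  rcases le_total S 1 with h | h
  · rw [max_eq_left h, max_eq_left (by linarith)]; norm_num
  · rw [max_eq_right h, max_eq_right (by linarith)]
    have hS : 0 < S := by linarith
    rw [← sub_nonneg, show S⁻¹ - (1 - (S - 1)) = (S - 1) ^ 2 / S by field_simp; ring]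
    positivity

/-- Sub-stochastic choices can be replaced by deterministic ones. -/
lemma exists_deterministic {ι A : Type*} [Fintype ι] [Fintype A] [Nonempty A]
    {κ F : ι → A → ℝ} (hκ : ∀ i a, 0 ≤ κ i a) (hκ1 : ∀ i, ∑ a, κ i a ≤ 1)
    (hF : ∀ i a, 0 ≤ F i a) {c : ℝ} (hc : c ≤ ∑ i, ∑ a, κ i a * F i a) :
    ∃ f : ι → A, c ≤ ∑ i, F i (f i) := by
  have hmax : ∀ i, ∃ a, ∀ a', F i a' ≤ F i a := fun i => Finite.exists_max (F i)
  choose f hf using hmax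
  refine ⟨f, hc.trans (sum_le_sum fun i _ => ?_)⟩
  calc ∑ a, κ i a * F i a ≤ ∑ a, κ i a * F i (f i) :=
        sum_le_sum fun a _ => mul_le_mul_of_nonneg_left (hf i a) (hκ i a)
    _ = (∑ a, κ i a) * F i (f i) := by rw [sum_mul]
    _ ≤ F i (f i) := mul_le_of_le_one_left (hF i _) (hκ1 i)

/-! ### One-shot coding for a single block -/

/-- The kernels whose product is the joint pmf of
`(S₀,S₁,S₂,U,V₁,V₂,V₁₃,V₂₃,X₁,X₂,Y₁,Y₂,Y₃)`. -/
structure Sys (S0 S1 S2 U V1 V2 V13 V23 X1 X2 Y1 Y2 Y3 : Type*)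
    [Fintype S0] [Fintype S1] [Fintype S2] [Fintype U] [Fintype V1] [Fintype V2]
    [Fintype V13] [Fintype V23] [Fintype X1] [Fintype X2]
    [Fintype Y1] [Fintype Y2] [Fintype Y3] where
  /-- pmf of the common state -/
  q0 : S0 → ℝ
  /-- conditional pmf of the state of user 1 -/
  q1 : S1 → S0 → ℝ
  /-- conditional pmf of the state of user 2 -/
  q2 : S2 → S0 → ℝ
  /-- conditional pmf of `U` -/
  k0 : U → S0 → ℝ
  /-- conditional pmf of `V₁` -/
  k1 : V1 → S0 × S1 × U → ℝ
  /-- conditional pmf of `V₂` -/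
  k2 : V2 → S0 × S2 × U → ℝ
  /-- conditional pmf of `V₁₃` -/
  k13 : V13 → U × V1 × S0 × S1 → ℝ
  /-- conditional pmf of `V₂₃` -/
  k23 : V23 → U × V2 × S0 × S2 → ℝ
  /-- conditional pmf of `X₁` -/
  kx1 : X1 → V13 × U × V1 × S0 × S1 → ℝ
  /-- conditional pmf of `X₂` -/
  kx2 : X2 → V23 × U × V2 × S0 × S2 → ℝ
  /-- the channel -/
  W : Y1 × Y2 × Y3 → X1 × X2 × S0 × S1 × S2 → ℝ
  hq0 : (∀ s, 0 ≤ q0 s) ∧ ∑ s, q0 s = 1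
  hq1 : IsCondPMF q1
  hq2 : IsCondPMF q2
  hk0 : IsCondPMF k0
  hk1 : IsCondPMF k1
  hk2 : IsCondPMF k2
  hk13 : IsCondPMF k13
  hk23 : IsCondPMF k23
  hkx1 : IsCondPMF kx1
  hkx2 : IsCondPMF kx2
  hW : IsCondPMF W

section OneShot

variable {S0 S1 S2 U V1 V2 V13 V23 X1 X2 Y1 Y2 Y3 : Type*}
  [Fintype S0] [Fintype S1] [Fintype S2] [Fintype U] [Fintype V1] [Fintype V2]
  [Fintype V13] [Fintype V23] [Fintype X1] [Fintype X2]
  [Fintype Y1] [Fintype Y2] [Fintype Y3]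

/-- The joint pmf. -/
def Sys.P (σ : Sys S0 S1 S2 U V1 V2 V13 V23 X1 X2 Y1 Y2 Y3) :
    S0 × S1 × S2 × U × V1 × V2 × V13 × V23 × X1 × X2 × Y1 × Y2 × Y3 → ℝ
  | (s0, s1, s2, u, v1, v2, v13, v23, x1, x2, y1, y2, y3) =>
    σ.q0 s0 * σ.q1 s1 s0 * σ.q2 s2 s0 * σ.k0 u s0 * σ.k1 v1 (s0, s1, u) *
      σ.k2 v2 (s0, s2, u) * (σ.k13 v13 (u, v1, s0, s1) * σ.kx1 x1 (v13, u, v1, s0, s1)) *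
      (σ.k23 v23 (u, v2, s0, s2) * σ.kx2 x2 (v23, u, v2, s0, s2)) *
      σ.W (y1, y2, y3) (x1, x2, s0, s1, s2)

lemma Sys.P_nonneg (σ : Sys S0 S1 S2 U V1 V2 V13 V23 X1 X2 Y1 Y2 Y3)
    (z : S0 × S1 × S2 × U × V1 × V2 × V13 × V23 × X1 × X2 × Y1 × Y2 × Y3) : 0 ≤ σ.P z := by
  obtain ⟨s0, s1, s2, u, v1, v2, v13, v23, x1, x2, y1, y2, y3⟩ := z
  have h1 := σ.hq0.1 s0
  have h2 := σ.hq1.1 s1 s0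
  have h3 := σ.hq2.1 s2 s0
  have h4 := σ.hk0.1 u s0
  have h5 := σ.hk1.1 v1 (s0, s1, u)
  have h6 := σ.hk2.1 v2 (s0, s2, u)
  have h7 := σ.hk13.1 v13 (u, v1, s0, s1)
  have h8 := σ.hk23.1 v23 (u, v2, s0, s2)
  have h9 := σ.hkx1.1 x1 (v13, u, v1, s0, s1)
  have h10 := σ.hkx2.1 x2 (v23, u, v2, s0, s2)
  have h11 := σ.hW.1 (y1, y2, y3) (x1, x2, s0, s1, s2)
  simp only [Sys.P]
  positivity

lemma one_sub_add_le_mul {a b x y : ℝ} (ha : a ≤ 1) (hb : b ≤ 1) (hx : 1 - x ≤ a)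
    (hy : 1 - y ≤ b) : 1 - (x + y) ≤ a * b := by nlinarith

lemma exists_decoder {O K : Type*} [Nonempty K] (Q : O → K → Prop) :
    ∃ dec : O → K, ∀ o k, (Q o k ∧ ∀ k', Q o k' → k' = k) → dec o = k := by
  classical
  refine ⟨fun o => if h : ∃ k, Q o k then h.choose else Classical.arbitrary K, ?_⟩
  rintro o k ⟨hk, huniq⟩
  have h : ∃ k, Q o k := ⟨k, hk⟩
  simp only [dif_pos h]
  exact huniq _ h.choose_spec

lemma one_sub_sum_ind_le {K : Type*} [Fintype K] {Q : K → Prop} {k : K} (hk : Q k) :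
    1 - ∑ k', ind (k' ≠ k) * ind (Q k') ≤ ind (Q k ∧ ∀ k', Q k' → k' = k) := by
  by_cases h : ∀ k', Q k' → k' = k
  · rw [ind_of_true ⟨hk, h⟩]
    have : 0 ≤ ∑ k', ind (k' ≠ k) * ind (Q k') :=
      sum_nonneg fun k' _ => mul_nonneg (ind_nonneg _) (ind_nonneg _)
    linarith
  · push Not at h
    obtain ⟨k', hQ, hne⟩ := h
    have h1 : ind (k' ≠ k) * ind (Q k') ≤ ∑ k', ind (k' ≠ k) * ind (Q k') :=
      single_le_sum (f := fun k' => ind (k' ≠ k) * ind (Q k'))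
        (fun k' _ => mul_nonneg (ind_nonneg _) (ind_nonneg _)) (mem_univ k')
    rw [ind_of_true hne, ind_of_true hQ] at h1
    have := ind_nonneg (Q k ∧ ∀ k', Q k' → k' = k)
    linarith

lemma ind_and (p q : Prop) : ind (p ∧ q) = ind p * ind q := by
  unfold ind; by_cases p <;> by_cases q <;> simp [*]

lemma ind_hit {α : Type*} (C : α → Bool) (v : α) : ind (C v = true) = hit C v := by
  unfold ind hit; by_cases h : C v = true <;> simp [h]

/-- The excess weight in the stochastic selection of a codeword. -/
def excess {α V : Type*} [Fintype V] (C : α → Bool) (e : V → α) (ϑ μ : ℝ) (k : V → ℝ) : ℝ :=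
  max 0 (∑ v, hit C (e v) * ϑ⁻¹ * (if k v ≤ μ then k v else 0) - 1)

/-- The stochastic encoder: selection among the codewords present in the codebook `C`,
with probabilities proportional to `k`, truncated at `μ`. -/
def pick {α V : Type*} [Fintype V] (C : α → Bool) (e : V → α) (ϑ μ : ℝ) (k : V → ℝ) :
    V → ℝ :=
  sel fun v => hit C (e v) * ϑ⁻¹ * (if k v ≤ μ then k v else 0)

lemma pick_nonneg {α V : Type*} [Fintype V] (C : α → Bool) (e : V → α) {ϑ : ℝ} (hϑ : 0 < ϑ)
    (μ : ℝ) {k : V → ℝ} (hk : ∀ v, 0 ≤ k v) (v : V) : 0 ≤ pick C e ϑ μ k v :=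
  sel_nonneg (fun v => mul_nonneg (mul_nonneg (hit_nonneg _ _) (inv_nonneg.2 hϑ.le))
    (by split_ifs; exacts [hk v, le_rfl])) v

lemma pick_eq {α V : Type*} [Fintype V] (C : α → Bool) (e : V → α) (ϑ μ : ℝ)
    (k : V → ℝ) {v : V} (hv : k v ≤ μ) :
    ∃ r, 0 ≤ r ∧ r ≤ 1 ∧ 1 - excess C e ϑ μ k ≤ r ∧
      pick C e ϑ μ k v = ϑ⁻¹ * hit C (e v) * k v * r := by
  obtain ⟨h0, h1, h2⟩ := inv_max_one_mem
    (∑ v, hit C (e v) * ϑ⁻¹ * (if k v ≤ μ then k v else 0))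
  refine ⟨_, h0, h1, h2, ?_⟩
  rw [pick, sel, if_pos hv, div_eq_mul_inv]
  ring

/-- The weight of a candidate pair of one user with respect to the true one. -/
lemma sum_candidates_le {R1 R2 : Type*} [Fintype R1] [Fintype R2] {r1 : R1} {r2 : R2}
    {t : R1 → R2 → ℝ} (ht : ∀ a b, 0 ≤ t a b) {ω1 β1 : R1 → ℝ} {ω2 β2 : R2 → ℝ}
    {γ1 γ2 : ℝ} (hβ1 : ∀ a, 0 ≤ β1 a) (hβ2 : ∀ a, 0 ≤ β2 a) (hγ1 : 0 ≤ γ1) (hγ2 : 0 ≤ γ2)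
    (hω2 : ∀ a, 0 ≤ ω2 a)
    (h1 : ω1 r1 = 1) (h2 : ω2 r2 = 1) (h1' : ∀ a, a ≠ r1 → ω1 a ≤ β1 a + γ1)
    (h2' : ∀ a, a ≠ r2 → ω2 a ≤ β2 a + γ2) :
    ∑ a, ∑ b, ind ((a, b) ≠ (r1, r2)) * (t a b * (ω1 a * ω2 b)) ≤
      ∑ b, β2 b * t r1 b + γ2 * ∑ b, t r1 b + ∑ a, β1 a * t a r2 + γ1 * ∑ a, t a r2 +
      ∑ a, ∑ b, β1 a * β2 b * t a b + γ2 * ∑ a, ∑ b, β1 a * t a b +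
      γ1 * ∑ a, ∑ b, β2 b * t a b + γ1 * γ2 * ∑ a, ∑ b, t a b := by
  classical
  have hpt : ∀ a b, ind ((a, b) ≠ (r1, r2)) * (t a b * (ω1 a * ω2 b)) ≤
      (if a = r1 then β2 b * t a b else 0) + (if a = r1 then γ2 * t a b else 0) +
      (if b = r2 then β1 a * t a b else 0) + (if b = r2 then γ1 * t a b else 0) +
      β1 a * β2 b * t a b + γ2 * (β1 a * t a b) + γ1 * (β2 b * t a b) +
      γ1 * γ2 * t a b := by
    intro a b
    have p1 : 0 ≤ β1 a * β2 b * t a b := mul_nonneg (mul_nonneg (hβ1 a) (hβ2 b)) (ht a b)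
    have p2 : 0 ≤ γ2 * (β1 a * t a b) := mul_nonneg hγ2 (mul_nonneg (hβ1 a) (ht a b))
    have p3 : 0 ≤ γ1 * (β2 b * t a b) := mul_nonneg hγ1 (mul_nonneg (hβ2 b) (ht a b))
    have p4 : 0 ≤ γ1 * γ2 * t a b := mul_nonneg (mul_nonneg hγ1 hγ2) (ht a b)
    by_cases ha : a = r1 <;> by_cases hb : b = r2
    · rw [ind_of_false (by simp [ha, hb])]
      simp only [if_pos ha, if_pos hb]
      have := mul_nonneg (hβ1 a) (ht a b)
      have := mul_nonneg (hβ2 b) (ht a b)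
      have := mul_nonneg hγ1 (ht a b)
      have := mul_nonneg hγ2 (ht a b)
      linarith
    · rw [ind_of_true (by simp [hb]), if_pos ha, if_pos ha, if_neg hb, if_neg hb, ha, h1]
      rw [ha] at p1 p2 p3 p4
      have := mul_le_mul_of_nonneg_left (h2' b hb) (ht r1 b)
      linarith
    · rw [ind_of_true (by simp [ha]), if_neg ha, if_neg ha, if_pos hb, if_pos hb, hb, h2]
      rw [hb] at p1 p2 p3 p4
      have := mul_le_mul_of_nonneg_left (h1' a ha) (ht a r2)
      linarith
    · rw [ind_of_true (by simp [ha]), if_neg ha, if_neg ha, if_neg hb, if_neg hb]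
      have h := mul_le_mul (h1' a ha) (h2' b hb) (hω2 b) (add_nonneg (hβ1 a) hγ1)
      have := mul_le_mul_of_nonneg_left h (ht a b)
      linarith
  refine (sum_le_sum fun a _ => sum_le_sum fun b _ => hpt a b).trans (le_of_eq ?_)
  simp only [sum_add_distrib, mul_sum]
  congr 7
  · rw [sum_comm]; exact sum_congr rfl fun b _ => by simp
  · rw [sum_comm]; exact sum_congr rfl fun b _ => by simp
  · funext b; simp
  · funext b; simp

end OneShot

/-- Sub-stochastic choices that depend on partial information `π` can be replaced by
deterministic ones. -/
lemma exists_deterministic_comp {I J A : Type*} [Fintype I] [Fintype J] [Fintype A]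
    [Nonempty A] (π : I → J) {κ : J → A → ℝ} {F : I → A → ℝ} (hκ : ∀ i a, 0 ≤ κ i a)
    (hκ1 : ∀ i, ∑ a, κ i a ≤ 1) (hF : ∀ i a, 0 ≤ F i a) {c : ℝ}
    (hc : c ≤ ∑ i, ∑ a, κ (π i) a * F i a) :
    ∃ f : J → A, c ≤ ∑ i, F i (f (π i)) := by
  classical
  have h := exists_deterministic (F := fun j a => ∑ i with π i = j, F i a) hκ hκ1
    (fun j a => sum_nonneg fun i _ => hF i a) (c := c) (hc.trans (le_of_eq ?_))
  · obtain ⟨f, hf⟩ := h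
    refine ⟨f, hf.trans (le_of_eq ?_)⟩
    rw [← sum_fiberwise univ π]
    refine sum_congr rfl fun j _ => sum_congr rfl fun i hi => ?_
    rw [(mem_filter.1 hi).2]
  · rw [← sum_fiberwise univ π]
    refine sum_congr rfl fun j _ => ?_
    simp_rw [mul_sum]
    rw [sum_comm]
    refine sum_congr rfl fun a _ => sum_congr rfl fun i hi => ?_
    rw [(mem_filter.1 hi).2]

lemma le_sum_bern_mul {α : Type*} [Fintype α] [DecidableEq α] {θ : α → ℝ}
    (h0 : ∀ v, 0 < θ v) (h1 : ∀ v, θ v ≤ 1) (X : Finset α) {F D : (α → Bool) → ℝ}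
    {K err : ℝ} (hK : 0 ≤ K)
    (hF : ∀ C, K * (∏ x ∈ X, ((θ x)⁻¹ * hit C x)) * (1 - D C) ≤ F C)
    (hD : ∑ C, bern (tilt θ X) C * D C ≤ err) :
    K * (1 - err) ≤ ∑ C, bern θ C * F C := by
  calc K * (1 - err) ≤ K * ∑ C, bern (tilt θ X) C * (1 - D C) := by
        refine mul_le_mul_of_nonneg_left ?_ hK
        simp_rw [mul_sub, mul_one]
        rw [sum_sub_distrib, sum_bern]
        linarith
    _ = ∑ C, bern θ C * (K * (∏ x ∈ X, ((θ x)⁻¹ * hit C x)) * (1 - D C)) := by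
        rw [mul_sum]
        refine sum_congr rfl fun C _ => ?_
        rw [← bern_mul_prod_hit (fun x _ => (h0 x).ne')]
        ring
    _ ≤ _ := sum_le_sum fun C _ =>
        mul_le_mul_of_nonneg_left (hF C) (bern_nonneg (fun v => (h0 v).le) h1 C)

/-- Index set of the superposition codebook. -/
abbrev Cb (M A1 A2 D1 D2 U V1 V2 V13 V23 : Type*) :=
  (M × U) ⊕ (M × U × A1 × V1) ⊕ (M × U × A2 × V2) ⊕
    (M × U × A1 × V1 × D1 × V13) ⊕ (M × U × A2 × V2 × D2 × V23)

/-- Inclusion probabilities that are constant on the layers of the codebook. -/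
def layer {M A1 A2 D1 D2 U V1 V2 V13 V23 : Type*} (θ : Fin 5 → ℝ) :
    Cb M A1 A2 D1 D2 U V1 V2 V13 V23 → ℝ
  | .inl _ => θ 0
  | .inr (.inl _) => θ 1
  | .inr (.inr (.inl _)) => θ 2
  | .inr (.inr (.inr (.inl _))) => θ 3
  | .inr (.inr (.inr (.inr _))) => θ 4

lemma sum_bern_hit_five {α : Type*} [Fintype α] [DecidableEq α] (τ : α → ℝ)
    {a b c d e : α} (h : [a, b, c, d, e].Nodup) :
    ∑ C, bern τ C * (hit C a * hit C b * hit C c * hit C d * hit C e) =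
      τ a * τ b * τ c * τ d * τ e := by
  have := sum_bern_prod_hit τ [a, b, c, d, e].toFinset
  rw [List.prod_toFinset _ h] at this
  simp_rw [List.prod_toFinset _ h] at this
  simpa [mul_assoc] using this

section OneShot

variable {S0 S1 S2 U V1 V2 V13 V23 X1 X2 Y1 Y2 Y3 M A1 A2 D1 D2 : Type*}
  [Fintype S0] [Fintype S1] [Fintype S2] [Fintype U] [Fintype V1] [Fintype V2]
  [Fintype V13] [Fintype V23] [Fintype X1] [Fintype X2]
  [Fintype Y1] [Fintype Y2] [Fintype Y3]
  [Fintype M] [Fintype A1] [Fintype A2] [Fintype D1] [Fintype D2]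

/-- The candidate test of the receiver. -/
def Q3 (C : Cb M A1 A2 D1 D2 U V1 V2 V13 V23 → Bool)
    (t3 : U → V1 → V2 → V13 → V23 → Y3 → Prop) (a1 : A1) (a2 : A2) (y3 : Y3) :
    (M × U) × (V1 × D1 × V13) × (V2 × D2 × V23) → Prop
  | ((w, u), (v1, d1, v13), (v2, d2, v23)) =>
    t3 u v1 v2 v13 v23 y3 ∧ C (.inl (w, u)) ∧ C (.inr (.inl (w, u, a1, v1))) ∧
      C (.inr (.inr (.inl (w, u, a2, v2)))) ∧
      C (.inr (.inr (.inr (.inl (w, u, a1, v1, d1, v13))))) ∧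
      C (.inr (.inr (.inr (.inr (w, u, a2, v2, d2, v23)))))

/-- The counting conditions on the candidate test of the receiver. -/
structure Sparse3 (θ : Fin 5 → ℝ) (cM cD1 cD2 ε : ℝ)
    (t3 : U → V1 → V2 → V13 → V23 → Y3 → Prop) : Prop where
  all : ∀ y3, cM * cD1 * cD2 * (θ 0 * θ 1 * θ 2 * θ 3 * θ 4) *
    ∑ u, ∑ v1, ∑ v2, ∑ v13, ∑ v23, ind (t3 u v1 v2 v13 v23 y3) ≤ ε
  nc : ∀ u v1 v2 v13 y3, cD2 * θ 4 * ∑ v23, ind (t3 u v1 v2 v13 v23 y3) ≤ ε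
  nb : ∀ u v1 v13 y3, cD2 * (θ 2 * θ 4) * ∑ v2, ∑ v23, ind (t3 u v1 v2 v13 v23 y3) ≤ ε
  cn : ∀ u v1 v2 v23 y3, cD1 * θ 3 * ∑ v13, ind (t3 u v1 v2 v13 v23 y3) ≤ ε
  bn : ∀ u v2 v23 y3, cD1 * (θ 1 * θ 3) * ∑ v1, ∑ v13, ind (t3 u v1 v2 v13 v23 y3) ≤ ε
  cc : ∀ u v1 v2 y3, cD1 * cD2 * (θ 3 * θ 4) *
    ∑ v13, ∑ v23, ind (t3 u v1 v2 v13 v23 y3) ≤ ε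
  cb : ∀ u v1 y3, cD1 * cD2 * (θ 3 * (θ 2 * θ 4)) *
    ∑ v13, ∑ v2, ∑ v23, ind (t3 u v1 v2 v13 v23 y3) ≤ ε
  bc : ∀ u v2 y3, cD1 * cD2 * (θ 1 * θ 3 * θ 4) *
    ∑ v1, ∑ v13, ∑ v23, ind (t3 u v1 v2 v13 v23 y3) ≤ ε
  bb : ∀ u y3, cD1 * cD2 * (θ 1 * θ 3 * (θ 2 * θ 4)) *
    ∑ v1, ∑ v13, ∑ v2, ∑ v23, ind (t3 u v1 v2 v13 v23 y3) ≤ ε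

/-- The five true codewords. -/
def truth [DecidableEq (Cb M A1 A2 D1 D2 U V1 V2 V13 V23)]
    (w : M) (a1 : A1) (a2 : A2) (d1 : D1) (d2 : D2) (u : U) (v1 : V1) (v2 : V2)
    (v13 : V13) (v23 : V23) : Finset (Cb M A1 A2 D1 D2 U V1 V2 V13 V23) :=
  {.inl (w, u), .inr (.inl (w, u, a1, v1)), .inr (.inr (.inl (w, u, a2, v2))),
    .inr (.inr (.inr (.inl (w, u, a1, v1, d1, v13)))),
    .inr (.inr (.inr (.inr (w, u, a2, v2, d2, v23))))}

/-- The expected number of wrong candidates at the receiver. -/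
lemma sum_bern_wrong3_le [DecidableEq (Cb M A1 A2 D1 D2 U V1 V2 V13 V23)]
    {θ : Fin 5 → ℝ} (hθ : ∀ i, 0 < θ i) (hθ1 : ∀ i, θ i ≤ 1)
    {t3 : U → V1 → V2 → V13 → V23 → Y3 → Prop} {ε : ℝ}
    (h : Sparse3 θ (Fintype.card M) (Fintype.card D1) (Fintype.card D2) ε t3)
    (w : M) (a1 : A1) (a2 : A2) (d1 : D1) (d2 : D2) (u : U) (v1 : V1) (v2 : V2)
    (v13 : V13) (v23 : V23) (y3 : Y3) :
    ∑ C : Cb M A1 A2 D1 D2 U V1 V2 V13 V23 → Bool,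
      bern (tilt (layer θ) (truth w a1 a2 d1 d2 u v1 v2 v13 v23)) C *
        ∑ k', ind (k' ≠ ((w, u), (v1, d1, v13), (v2, d2, v23))) *
          ind (Q3 C t3 a1 a2 y3 k') ≤ 9 * ε := by
  classical
  set τ := tilt (layer θ) (truth w a1 a2 d1 d2 u v1 v2 v13 v23) with hτ
  have hτ0 : ∀ v, 0 ≤ τ v := tilt_nonneg (fun v => by
    rcases v with v | v | v | v | v <;> exact (hθ _).le) _
  -- weights of the candidates of the two users
  let ω1 : V1 × D1 × V13 → ℝ := fun r => τ (.inr (.inl (w, u, a1, r.1))) *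
    τ (.inr (.inr (.inr (.inl (w, u, a1, r.1, r.2.1, r.2.2)))))
  let ω2 : V2 × D2 × V23 → ℝ := fun r => τ (.inr (.inr (.inl (w, u, a2, r.1)))) *
    τ (.inr (.inr (.inr (.inr (w, u, a2, r.1, r.2.1, r.2.2)))))
  let t : U → V1 × D1 × V13 → V2 × D2 × V23 → ℝ := fun u r1 r2 =>
    ind (t3 u r1.1 r2.1 r1.2.2 r2.2.2 y3)
  have hE : ∀ k' : (M × U) × (V1 × D1 × V13) × (V2 × D2 × V23),
      ∑ C, bern τ C * ind (Q3 C t3 a1 a2 y3 k') =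
      t k'.1.2 k'.2.1 k'.2.2 * (τ (.inl (k'.1.1, k'.1.2)) *
        τ (.inr (.inl (k'.1.1, k'.1.2, a1, k'.2.1.1))) *
        τ (.inr (.inr (.inl (k'.1.1, k'.1.2, a2, k'.2.2.1)))) *
        τ (.inr (.inr (.inr (.inl (k'.1.1, k'.1.2, a1, k'.2.1.1, k'.2.1.2.1, k'.2.1.2.2))))) *
        τ (.inr (.inr (.inr (.inr (k'.1.1, k'.1.2, a2, k'.2.2.1, k'.2.2.2.1, k'.2.2.2.2)))))) := by
    rintro ⟨⟨w', u'⟩, ⟨v1', d1', v13'⟩, ⟨v2', d2', v23'⟩⟩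
    rw [← sum_bern_hit_five τ (by simp), mul_sum]
    refine sum_congr rfl fun C _ => ?_
    simp only [Q3, ind_and, ind_hit, t]
    ring
  have hpt : ∀ k' : (M × U) × (V1 × D1 × V13) × (V2 × D2 × V23),
      ∑ C, bern τ C * (ind (k' ≠ ((w, u), (v1, d1, v13), (v2, d2, v23))) *
          ind (Q3 C t3 a1 a2 y3 k')) ≤
      (θ 0 * θ 1 * θ 2 * θ 3 * θ 4) * t k'.1.2 k'.2.1 k'.2.2 +
      if k'.1 = (w, u) then ind ((k'.2.1, k'.2.2) ≠ ((v1, d1, v13), (v2, d2, v23))) *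
        (t u k'.2.1 k'.2.2 * (ω1 k'.2.1 * ω2 k'.2.2)) else 0 := by
    intro k'
    have hfac : ∑ C, bern τ C * (ind (k' ≠ ((w, u), (v1, d1, v13), (v2, d2, v23))) *
          ind (Q3 C t3 a1 a2 y3 k')) = ind (k' ≠ ((w, u), (v1, d1, v13), (v2, d2, v23))) *
          ∑ C, bern τ C * ind (Q3 C t3 a1 a2 y3 k') := by
      rw [mul_sum]; exact sum_congr rfl fun C _ => by ring
    rw [hfac, hE]
    obtain ⟨⟨w', u'⟩, r1', r2'⟩ := k'
    have ht0 : ∀ u, 0 ≤ t u r1' r2' := fun u => ind_nonneg _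
    have hΘ : 0 ≤ θ 0 * θ 1 * θ 2 * θ 3 * θ 4 := by
      exact mul_nonneg (mul_nonneg (mul_nonneg (mul_nonneg (hθ 0).le (hθ 1).le) (hθ 2).le)
        (hθ 3).le) (hθ 4).le
    by_cases hwu : ((w', u') : M × U) = (w, u)
    · obtain ⟨rfl, rfl⟩ := Prod.mk.inj hwu
      rw [if_pos rfl]
      have h1 : τ (.inl (w', u')) = 1 := by simp [hτ, tilt, truth]
      simp only [h1, ne_eq, Prod.mk.injEq, true_and, ω1, ω2]
      have := mul_nonneg hΘ (ht0 u')
      refine le_trans (le_of_eq ?_) (le_add_of_nonneg_left this)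
      ring
    · rw [if_neg hwu, add_zero]
      have h0 : τ (.inl (w', u')) = θ 0 := by
        have : ¬ (w' = w ∧ u' = u) := fun h => hwu (by rw [h.1, h.2])
        simp [hτ, tilt, truth, layer, this]
      have h1 : ∀ v, τ (.inr (.inl (w', u', a1, v))) = θ 1 := by
        intro v
        have : w' = w → u' = u → ¬ v = v1 := fun h h' => absurd (by rw [h, h']) hwu
        simp [hτ, tilt, truth, layer]; exact fun h h' h'' => absurd h'' (this h h')
      have h2 : ∀ v, τ (.inr (.inr (.inl (w', u', a2, v)))) = θ 2 := by
        intro v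
        have : w' = w → u' = u → ¬ v = v2 := fun h h' => absurd (by rw [h, h']) hwu
        simp [hτ, tilt, truth, layer]; exact fun h h' h'' => absurd h'' (this h h')
      have h3 : ∀ v d v', τ (.inr (.inr (.inr (.inl (w', u', a1, v, d, v'))))) = θ 3 := by
        intro v d v'
        have : w' = w → u' = u → ¬ v = v1 := fun h h' => absurd (by rw [h, h']) hwu
        simp [hτ, tilt, truth, layer]; exact fun h h' h'' => absurd h'' (this h h')
      have h4 : ∀ v d v', τ (.inr (.inr (.inr (.inr (w', u', a2, v, d, v'))))) = θ 4 := by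
        intro v d v'
        have : w' = w → u' = u → ¬ v = v2 := fun h h' => absurd (by rw [h, h']) hwu
        simp [hτ, tilt, truth, layer]; exact fun h h' h'' => absurd h'' (this h h')
      simp only [h0, h1, h2, h3, h4]
      rw [mul_comm (θ 0 * θ 1 * θ 2 * θ 3 * θ 4)]
      exact mul_le_of_le_one_left (mul_nonneg (ht0 _) hΘ) (ind_le_one _)
  have hcand := sum_candidates_le (r1 := (v1, d1, v13)) (r2 := (v2, d2, v23)) (t := t u)
    (ω1 := ω1) (ω2 := ω2) (β1 := fun r => if r.1 = v1 then θ 3 else 0)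
    (β2 := fun r => if r.1 = v2 then θ 4 else 0) (γ1 := θ 1 * θ 3) (γ2 := θ 2 * θ 4)
    (fun a b => ind_nonneg _) (fun a => by split_ifs; exacts [(hθ 3).le, le_rfl])
    (fun a => by split_ifs; exacts [(hθ 4).le, le_rfl])
    (mul_pos (hθ 1) (hθ 3)).le (mul_pos (hθ 2) (hθ 4)).le
    (fun a => mul_nonneg (hτ0 _) (hτ0 _))
    (by simp [ω1, hτ, tilt, truth]) (by simp [ω2, hτ, tilt, truth])
    (by
      rintro ⟨v, d, v'⟩ hne
      by_cases hv : v = v1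
      · subst hv
        have : ¬ (d = d1 ∧ v' = v13) := fun h => hne (by rw [h.1, h.2])
        have hω : ω1 (v, d, v') = θ 3 := by simp [ω1, hτ, tilt, truth, layer, this]
        rw [hω, if_pos rfl]
        exact le_add_of_nonneg_right (mul_pos (hθ 1) (hθ 3)).le
      · simp [ω1, hτ, tilt, truth, layer, hv])
    (by
      rintro ⟨v, d, v'⟩ hne
      by_cases hv : v = v2
      · subst hv
        have : ¬ (d = d2 ∧ v' = v23) := fun h => hne (by rw [h.1, h.2])
        have hω : ω2 (v, d, v') = θ 4 := by simp [ω2, hτ, tilt, truth, layer, this]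
        rw [hω, if_pos rfl]
        exact le_add_of_nonneg_right (mul_pos (hθ 2) (hθ 4)).le
      · simp [ω2, hτ, tilt, truth, layer, hv])
  have hswap : ∑ C, bern τ C * ∑ k', ind (k' ≠ ((w, u), (v1, d1, v13), (v2, d2, v23))) *
      ind (Q3 C t3 a1 a2 y3 k') = ∑ k', ∑ C, bern τ C *
        (ind (k' ≠ ((w, u), (v1, d1, v13), (v2, d2, v23))) * ind (Q3 C t3 a1 a2 y3 k')) := by
    simp_rw [mul_sum]; rw [sum_comm]
  rw [hswap]
  refine (sum_le_sum fun k' _ => hpt k').trans ?_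
  rw [sum_add_distrib, ← mul_sum]
  have hdiag : (∑ k' : (M × U) × (V1 × D1 × V13) × (V2 × D2 × V23), if k'.1 = (w, u) then
      ind ((k'.2.1, k'.2.2) ≠ ((v1, d1, v13), (v2, d2, v23))) *
        (t u k'.2.1 k'.2.2 * (ω1 k'.2.1 * ω2 k'.2.2)) else 0) =
      ∑ a, ∑ b, ind ((a, b) ≠ ((v1, d1, v13), (v2, d2, v23))) * (t u a b * (ω1 a * ω2 b)) := by
    rw [Fintype.sum_prod_type, sum_comm, Fintype.sum_prod_type]
    simp
  have eall : ∑ k' : (M × U) × (V1 × D1 × V13) × (V2 × D2 × V23), t k'.1.2 k'.2.1 k'.2.2 =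
      Fintype.card M * Fintype.card D1 * Fintype.card D2 *
        ∑ u, ∑ v1, ∑ v2, ∑ v13, ∑ v23, ind (t3 u v1 v2 v13 v23 y3) := by
    simp only [Fintype.sum_prod_type, t, sum_const, card_univ, nsmul_eq_mul, ← mul_sum]
    have hcomm : ∀ u, ∑ v1, ∑ v13, ∑ v2, ∑ v23, ind (t3 u v1 v2 v13 v23 y3) =
        ∑ v1, ∑ v2, ∑ v13, ∑ v23, ind (t3 u v1 v2 v13 v23 y3) :=
      fun u => sum_congr rfl fun v1 _ => sum_comm
    simp_rw [hcomm]
    ring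
  have e1 : ∑ b, (if b.1 = v2 then θ 4 else 0) * t u (v1, d1, v13) b =
      Fintype.card D2 * θ 4 * ∑ v23, ind (t3 u v1 v2 v13 v23 y3) := by
    simp [Fintype.sum_prod_type, t, ← mul_sum]
    ring
  have e2 : θ 2 * θ 4 * ∑ b, t u (v1, d1, v13) b =
      Fintype.card D2 * (θ 2 * θ 4) * ∑ v2, ∑ v23, ind (t3 u v1 v2 v13 v23 y3) := by
    simp only [Fintype.sum_prod_type, t, sum_const, card_univ, nsmul_eq_mul, ← mul_sum]
    ring
  have e3 : ∑ a, (if a.1 = v1 then θ 3 else 0) * t u a (v2, d2, v23) =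
      Fintype.card D1 * θ 3 * ∑ v13, ind (t3 u v1 v2 v13 v23 y3) := by
    simp [Fintype.sum_prod_type, t, ← mul_sum]
    ring
  have e4 : θ 1 * θ 3 * ∑ a, t u a (v2, d2, v23) =
      Fintype.card D1 * (θ 1 * θ 3) * ∑ v1, ∑ v13, ind (t3 u v1 v2 v13 v23 y3) := by
    simp only [Fintype.sum_prod_type, t, sum_const, card_univ, nsmul_eq_mul, ← mul_sum]
    ring
  have e5 : ∑ a, ∑ b, (if a.1 = v1 then θ 3 else 0) * (if b.1 = v2 then θ 4 else 0) * t u a b =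
      Fintype.card D1 * Fintype.card D2 * (θ 3 * θ 4) *
        ∑ v13, ∑ v23, ind (t3 u v1 v2 v13 v23 y3) := by
    simp [Fintype.sum_prod_type, t, ← mul_sum]
    ring
  have e6 : θ 2 * θ 4 * ∑ a, ∑ b, (if a.1 = v1 then θ 3 else 0) * t u a b =
      Fintype.card D1 * Fintype.card D2 * (θ 3 * (θ 2 * θ 4)) *
        ∑ v13, ∑ v2, ∑ v23, ind (t3 u v1 v2 v13 v23 y3) := by
    simp [Fintype.sum_prod_type, t, ← mul_sum]
    ring
  have e7 : θ 1 * θ 3 * ∑ a, ∑ b, (if b.1 = v2 then θ 4 else 0) * t u a b =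
      Fintype.card D1 * Fintype.card D2 * (θ 1 * θ 3 * θ 4) *
        ∑ v1, ∑ v13, ∑ v23, ind (t3 u v1 v2 v13 v23 y3) := by
    simp [Fintype.sum_prod_type, t, ← mul_sum]
    ring
  have e8 : θ 1 * θ 3 * (θ 2 * θ 4) * ∑ a, ∑ b, t u a b =
      Fintype.card D1 * Fintype.card D2 * (θ 1 * θ 3 * (θ 2 * θ 4)) *
        ∑ v1, ∑ v13, ∑ v2, ∑ v23, ind (t3 u v1 v2 v13 v23 y3) := by
    simp [Fintype.sum_prod_type, t, ← mul_sum]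
    ring
  rw [e1, e2, e3, e4, e5, e6, e7, e8] at hcand
  rw [hdiag, eall]
  have := h.all y3
  have := h.nc u v1 v2 v13 y3
  have := h.nb u v1 v13 y3
  have := h.cn u v1 v2 v23 y3
  have := h.bn u v2 v23 y3
  have := h.cc u v1 v2 y3
  have := h.cb u v1 y3
  have := h.bc u v2 y3
  have := h.bb u y3
  linarith

end OneShot

/-- `k` is the only solution of `Q`. -/
def IsOnly {K : Type*} (Q : K → Prop) (k : K) : Prop := Q k ∧ ∀ k', Q k' → k' = k

lemma sum_bern_wrong_le {α A V : Type*} [Fintype α] [DecidableEq α] [Fintype A] [Fintype V]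
    (τ : α → ℝ) (e : A × V → α) (k : A × V) {ϑ : ℝ} (hϑ : 0 ≤ ϑ)
    (hτ : ∀ k', k' ≠ k → τ (e k') = ϑ) (t : V → Prop) :
    ∑ C, bern τ C * ∑ k', ind (k' ≠ k) * ind (t k'.2 ∧ C (e k') = true) ≤
      Fintype.card A * ϑ * ∑ v, ind (t v) := by
  have hswap : ∑ C, bern τ C * ∑ k', ind (k' ≠ k) * ind (t k'.2 ∧ C (e k') = true) =
      ∑ k', ind (k' ≠ k) * (ind (t k'.2) * τ (e k')) := by
    simp_rw [mul_sum]
    rw [sum_comm]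
    refine sum_congr rfl fun k' _ => ?_
    rw [← sum_bern_hit τ, mul_sum, mul_sum]
    refine sum_congr rfl fun C _ => ?_
    rw [ind_and, ind_hit]
    ring
  rw [hswap]
  calc _ ≤ ∑ k' : A × V, ϑ * ind (t k'.2) := by
        refine sum_le_sum fun k' _ => ?_
        by_cases h : k' = k
        · rw [ind_of_false (by simpa using h), zero_mul]
          exact mul_nonneg hϑ (ind_nonneg _)
        · rw [ind_of_true h, one_mul, hτ k' h, mul_comm]
    _ = _ := by
        simp only [Fintype.sum_prod_type, ← mul_sum, sum_const, card_univ, nsmul_eq_mul]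
        ring

lemma sum_bern_excess_le {α V : Type*} [Fintype α] [DecidableEq α] [Fintype V] {θ : α → ℝ}
    (h0 : ∀ v, 0 ≤ θ v) (h1 : ∀ v, θ v ≤ 1) (X : Finset α) (e : V → α)
    (he : Function.Injective e) {v₀ : V} (hX : ∀ v, e v ∈ X → v = v₀) {ϑ μ η : ℝ}
    (hϑ : 0 < ϑ) (hϑ1 : ϑ ≤ 1) (hμ : 0 ≤ μ) (hθ : ∀ v, θ (e v) = ϑ) {k : V → ℝ}
    (hk : ∀ v, 0 ≤ k v) (hk1 : ∑ v, k v = 1) (hη : (ϑ⁻¹ - 1) * μ ≤ η) :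
    ∑ C, bern (tilt θ X) C * excess C e ϑ μ k ≤ η + √η := by
  refine sum_bern_tilt_excess_le h0 h1 X e he hX hϑ hϑ1 hθ ?_ ?_ ?_ hη
  · intro v; split_ifs; exacts [hk v, le_rfl]
  · intro v; split_ifs with h; exacts [h, hμ]
  · rw [← hk1]
    refine sum_le_sum fun v _ => ?_
    split_ifs; exacts [le_rfl, hk v]

lemma sum_pick_le_one {α V : Type*} [Fintype V] (C : α → Bool) (e : V → α) (ϑ μ : ℝ)
    (k : V → ℝ) : ∑ v, pick C e ϑ μ k v ≤ 1 := sum_sel_le_one _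

section OneShot

variable {S0 S1 S2 U V1 V2 V13 V23 X1 X2 Y1 Y2 Y3 M A1 A2 D1 D2 : Type*}
  [Fintype S0] [Fintype S1] [Fintype S2] [Fintype U] [Fintype V1] [Fintype V2]
  [Fintype V13] [Fintype V23] [Fintype X1] [Fintype X2]
  [Fintype Y1] [Fintype Y2] [Fintype Y3]
  [Fintype M] [Fintype A1] [Fintype A2] [Fintype D1] [Fintype D2]

/-- The candidate test of encoder 1. -/
def Q1 (C : Cb M A1 A2 D1 D2 U V1 V2 V13 V23 → Bool)
    (t1 : V2 → U → S0 → S1 → X1 → Y1 → Prop)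
    (o : M × U × S0 × S1 × X1 × Y1) (k : A2 × V2) : Prop :=
  t1 k.2 o.2.1 o.2.2.1 o.2.2.2.1 o.2.2.2.2.1 o.2.2.2.2.2 ∧
    C (.inr (.inr (.inl (o.1, o.2.1, k.1, k.2)))) = true

/-- The candidate test of encoder 2. -/
def Q2 (C : Cb M A1 A2 D1 D2 U V1 V2 V13 V23 → Bool)
    (t2 : V1 → U → S0 → S2 → X2 → Y2 → Prop)
    (o : M × U × S0 × S2 × X2 × Y2) (k : A1 × V1) : Prop :=
  t2 k.2 o.2.1 o.2.2.1 o.2.2.2.1 o.2.2.2.2.1 o.2.2.2.2.2 ∧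
    C (.inr (.inl (o.1, o.2.1, k.1, k.2))) = true

/-- The stochastic encoder of the common auxiliary codeword. -/
def enc0 (σ : Sys S0 S1 S2 U V1 V2 V13 V23 X1 X2 Y1 Y2 Y3) (θ μ : Fin 5 → ℝ)
    (C : Cb M A1 A2 D1 D2 U V1 V2 V13 V23 → Bool) (w : M) (s0 : S0) : U → ℝ :=
  pick C (fun u => .inl (w, u)) (θ 0) (μ 0) (fun u => σ.k0 u s0)

/-- The stochastic encoder of user 1. -/
def enc1 (σ : Sys S0 S1 S2 U V1 V2 V13 V23 X1 X2 Y1 Y2 Y3) (θ μ : Fin 5 → ℝ)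
    (C : Cb M A1 A2 D1 D2 U V1 V2 V13 V23 → Bool) (w : M) (u : U) (a1 : A1) (d1 : D1)
    (s0 : S0) (s1 : S1) (v1 : V1) (v13 : V13) (x1 : X1) : ℝ :=
  pick C (fun v => .inr (.inl (w, u, a1, v))) (θ 1) (μ 1) (fun v => σ.k1 v (s0, s1, u)) v1 *
    (pick C (fun v => .inr (.inr (.inr (.inl (w, u, a1, v1, d1, v))))) (θ 3) (μ 3)
      (fun v => σ.k13 v (u, v1, s0, s1)) v13 * σ.kx1 x1 (v13, u, v1, s0, s1))

/-- The stochastic encoder of user 2. -/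
def enc2 (σ : Sys S0 S1 S2 U V1 V2 V13 V23 X1 X2 Y1 Y2 Y3) (θ μ : Fin 5 → ℝ)
    (C : Cb M A1 A2 D1 D2 U V1 V2 V13 V23 → Bool) (w : M) (u : U) (a2 : A2) (d2 : D2)
    (s0 : S0) (s2 : S2) (v2 : V2) (v23 : V23) (x2 : X2) : ℝ :=
  pick C (fun v => .inr (.inr (.inl (w, u, a2, v)))) (θ 2) (μ 2) (fun v => σ.k2 v (s0, s2, u)) v2 *
    (pick C (fun v => .inr (.inr (.inr (.inr (w, u, a2, v2, d2, v))))) (θ 4) (μ 4)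
      (fun v => σ.k23 v (u, v2, s0, s2)) v23 * σ.kx2 x2 (v23, u, v2, s0, s2))

/-- The event that all three decoding steps have the true codewords as unique candidates. -/
def AllOnly (C : Cb M A1 A2 D1 D2 U V1 V2 V13 V23 → Bool)
    (t1 : V2 → U → S0 → S1 → X1 → Y1 → Prop) (t2 : V1 → U → S0 → S2 → X2 → Y2 → Prop)
    (t3 : U → V1 → V2 → V13 → V23 → Y3 → Prop) (w : M) (a1 : A1) (a2 : A2) (d1 : D1) (d2 : D2) :
    S0 × S1 × S2 × U × V1 × V2 × V13 × V23 × X1 × X2 × Y1 × Y2 × Y3 → Prop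
  | (s0, s1, s2, u, v1, v2, v13, v23, x1, x2, y1, y2, y3) =>
    IsOnly (Q1 C t1 (w, u, s0, s1, x1, y1)) (a2, v2) ∧
    IsOnly (Q2 C t2 (w, u, s0, s2, x2, y2)) (a1, v1) ∧
    IsOnly (Q3 C t3 a1 a2 y3) ((w, u), (v1, d1, v13), (v2, d2, v23))

/-- Typical tuples: the kernels do not exceed `μ` and the true codewords pass the tests. -/
def Good (σ : Sys S0 S1 S2 U V1 V2 V13 V23 X1 X2 Y1 Y2 Y3) (μ : Fin 5 → ℝ)
    (t1 : V2 → U → S0 → S1 → X1 → Y1 → Prop) (t2 : V1 → U → S0 → S2 → X2 → Y2 → Prop)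
    (t3 : U → V1 → V2 → V13 → V23 → Y3 → Prop) :
    S0 × S1 × S2 × U × V1 × V2 × V13 × V23 × X1 × X2 × Y1 × Y2 × Y3 → Prop
  | (s0, s1, s2, u, v1, v2, v13, v23, x1, x2, y1, y2, y3) =>
    (σ.k0 u s0 ≤ μ 0 ∧ σ.k1 v1 (s0, s1, u) ≤ μ 1 ∧ σ.k2 v2 (s0, s2, u) ≤ μ 2 ∧
      σ.k13 v13 (u, v1, s0, s1) ≤ μ 3 ∧ σ.k23 v23 (u, v2, s0, s2) ≤ μ 4) ∧
    t1 v2 u s0 s1 x1 y1 ∧ t2 v1 u s0 s2 x2 y2 ∧ t3 u v1 v2 v13 v23 y3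

lemma mul_prod_mul_one_sub_le {r0 r1 r2 r3 r4 i1 i2 i3 x0 x1 x2 x3 x4 y1 y2 y3 : ℝ}
    (h0 : 0 ≤ r0 ∧ r0 ≤ 1 ∧ 1 - x0 ≤ r0) (h1 : 0 ≤ r1 ∧ r1 ≤ 1 ∧ 1 - x1 ≤ r1)
    (h2 : 0 ≤ r2 ∧ r2 ≤ 1 ∧ 1 - x2 ≤ r2) (h3 : 0 ≤ r3 ∧ r3 ≤ 1 ∧ 1 - x3 ≤ r3)
    (h4 : 0 ≤ r4 ∧ r4 ≤ 1 ∧ 1 - x4 ≤ r4) (g1 : 0 ≤ i1 ∧ i1 ≤ 1 ∧ 1 - y1 ≤ i1)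
    (g2 : 0 ≤ i2 ∧ i2 ≤ 1 ∧ 1 - y2 ≤ i2) (g3 : 0 ≤ i3 ∧ i3 ≤ 1 ∧ 1 - y3 ≤ i3) :
    1 - (x0 + x1 + x2 + x3 + x4 + y1 + y2 + y3) ≤ r0 * r1 * r2 * r3 * r4 * i1 * i2 * i3 := by
  have step : ∀ {a b x y : ℝ}, (0 ≤ a ∧ a ≤ 1 ∧ 1 - x ≤ a) → (0 ≤ b ∧ b ≤ 1 ∧ 1 - y ≤ b) →
      (0 ≤ a * b ∧ a * b ≤ 1 ∧ 1 - (x + y) ≤ a * b) := fun ha hb =>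
    ⟨mul_nonneg ha.1 hb.1, mul_le_one₀ ha.2.1 hb.1 hb.2.1,
      one_sub_add_le_mul ha.2.1 hb.2.1 ha.2.2 hb.2.2⟩
  exact (step (step (step (step (step (step (step h0 h1) h2) h3) h4) g1) g2) g3).2.2

/-- The expected probability of correct decoding of a typical tuple. -/
lemma le_sum_bern_enc [DecidableEq (Cb M A1 A2 D1 D2 U V1 V2 V13 V23)]
    (σ : Sys S0 S1 S2 U V1 V2 V13 V23 X1 X2 Y1 Y2 Y3) {θ μ : Fin 5 → ℝ}
    (hθ : ∀ i, 0 < θ i) (hθ1 : ∀ i, θ i ≤ 1) (hμ : ∀ i, 0 ≤ μ i) {η ε : ℝ}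
    (hη : ∀ i, ((θ i)⁻¹ - 1) * μ i ≤ η)
    {t1 : V2 → U → S0 → S1 → X1 → Y1 → Prop} {t2 : V1 → U → S0 → S2 → X2 → Y2 → Prop}
    {t3 : U → V1 → V2 → V13 → V23 → Y3 → Prop}
    (hs1 : ∀ u s0 s1 x1 y1, Fintype.card A2 * θ 2 * ∑ v, ind (t1 v u s0 s1 x1 y1) ≤ ε)
    (hs2 : ∀ u s0 s2 x2 y2, Fintype.card A1 * θ 1 * ∑ v, ind (t2 v u s0 s2 x2 y2) ≤ ε)
    (hs3 : Sparse3 θ (Fintype.card M) (Fintype.card D1) (Fintype.card D2) ε t3)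
    (w : M) (a1 : A1) (a2 : A2) (d1 : D1) (d2 : D2)
    (s0 : S0) (s1 : S1) (s2 : S2) (u : U) (v1 : V1) (v2 : V2) (v13 : V13) (v23 : V23)
    (x1 : X1) (x2 : X2) (y1 : Y1) (y2 : Y2) (y3 : Y3)
    (hz : Good σ μ t1 t2 t3 (s0, s1, s2, u, v1, v2, v13, v23, x1, x2, y1, y2, y3)) :
    σ.P (s0, s1, s2, u, v1, v2, v13, v23, x1, x2, y1, y2, y3) *
        (1 - (5 * (η + √η) + 11 * ε)) ≤
      ∑ C : Cb M A1 A2 D1 D2 U V1 V2 V13 V23 → Bool, bern (layer θ) C *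
        (σ.q0 s0 * σ.q1 s1 s0 * σ.q2 s2 s0 * enc0 σ θ μ C w s0 u *
          enc1 σ θ μ C w u a1 d1 s0 s1 v1 v13 x1 * enc2 σ θ μ C w u a2 d2 s0 s2 v2 v23 x2 *
          σ.W (y1, y2, y3) (x1, x2, s0, s1, s2) *
          ind (AllOnly C t1 t2 t3 w a1 a2 d1 d2
            (s0, s1, s2, u, v1, v2, v13, v23, x1, x2, y1, y2, y3))) := by
  obtain ⟨⟨m0, m1, m2, m3, m4⟩, ht1, ht2, ht3⟩ := hz
  set X := truth w a1 a2 d1 d2 u v1 v2 v13 v23 with hX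
  have hl0 : ∀ v : Cb M A1 A2 D1 D2 U V1 V2 V13 V23, 0 < layer θ v := fun v => by
    rcases v with v | v | v | v | v <;> exact hθ _
  have hl1 : ∀ v : Cb M A1 A2 D1 D2 U V1 V2 V13 V23, layer θ v ≤ 1 := fun v => by
    rcases v with v | v | v | v | v <;> exact hθ1 _
  let e0 : U → Cb M A1 A2 D1 D2 U V1 V2 V13 V23 := fun v => .inl (w, v)
  let e1 : V1 → Cb M A1 A2 D1 D2 U V1 V2 V13 V23 := fun v => .inr (.inl (w, u, a1, v))
  let e2 : V2 → Cb M A1 A2 D1 D2 U V1 V2 V13 V23 := fun v => .inr (.inr (.inl (w, u, a2, v)))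
  let e3 : V13 → Cb M A1 A2 D1 D2 U V1 V2 V13 V23 :=
    fun v => .inr (.inr (.inr (.inl (w, u, a1, v1, d1, v))))
  let e4 : V23 → Cb M A1 A2 D1 D2 U V1 V2 V13 V23 :=
    fun v => .inr (.inr (.inr (.inr (w, u, a2, v2, d2, v))))
  have E0 := sum_bern_excess_le (fun v => (hl0 v).le) hl1 X e0 (fun a b h => by simpa [e0] using h)
    (v₀ := u) (fun v h => by simpa [e0, hX, truth] using h) (hθ 0) (hθ1 0) (hμ 0) (fun v => rfl)
    (fun v => σ.hk0.1 v s0) (σ.hk0.2 s0) (hη 0)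
  have E1 := sum_bern_excess_le (fun v => (hl0 v).le) hl1 X e1 (fun a b h => by simpa [e1] using h)
    (v₀ := v1) (fun v h => by simpa [e1, hX, truth] using h) (hθ 1) (hθ1 1) (hμ 1) (fun v => rfl)
    (fun v => σ.hk1.1 v (s0, s1, u)) (σ.hk1.2 _) (hη 1)
  have E2 := sum_bern_excess_le (fun v => (hl0 v).le) hl1 X e2 (fun a b h => by simpa [e2] using h)
    (v₀ := v2) (fun v h => by simpa [e2, hX, truth] using h) (hθ 2) (hθ1 2) (hμ 2) (fun v => rfl)
    (fun v => σ.hk2.1 v (s0, s2, u)) (σ.hk2.2 _) (hη 2)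
  have E3 := sum_bern_excess_le (fun v => (hl0 v).le) hl1 X e3 (fun a b h => by simpa [e3] using h)
    (v₀ := v13) (fun v h => by simpa [e3, hX, truth] using h) (hθ 3) (hθ1 3) (hμ 3) (fun v => rfl)
    (fun v => σ.hk13.1 v (u, v1, s0, s1)) (σ.hk13.2 _) (hη 3)
  have E4 := sum_bern_excess_le (fun v => (hl0 v).le) hl1 X e4 (fun a b h => by simpa [e4] using h)
    (v₀ := v23) (fun v h => by simpa [e4, hX, truth] using h) (hθ 4) (hθ1 4) (hμ 4) (fun v => rfl)
    (fun v => σ.hk23.1 v (u, v2, s0, s2)) (σ.hk23.2 _) (hη 4)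
  have F1 := (sum_bern_wrong_le (tilt (layer θ) X)
    (fun k : A2 × V2 => .inr (.inr (.inl (w, u, k.1, k.2)))) (a2, v2) (hθ 2).le
    (fun k' hk' => by
      have : ¬ (k'.1 = a2 ∧ k'.2 = v2) := fun h => hk' (Prod.ext h.1 h.2)
      simp [tilt, hX, truth, layer]; tauto) (fun v => t1 v u s0 s1 x1 y1)).trans
    (hs1 u s0 s1 x1 y1)
  have F2 := (sum_bern_wrong_le (tilt (layer θ) X)
    (fun k : A1 × V1 => .inr (.inl (w, u, k.1, k.2))) (a1, v1) (hθ 1).le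
    (fun k' hk' => by
      have : ¬ (k'.1 = a1 ∧ k'.2 = v1) := fun h => hk' (Prod.ext h.1 h.2)
      simp [tilt, hX, truth, layer]; tauto) (fun v => t2 v u s0 s2 x2 y2)).trans
    (hs2 u s0 s2 x2 y2)
  have F3 := sum_bern_wrong3_le hθ hθ1 hs3 w a1 a2 d1 d2 u v1 v2 v13 v23 y3
  refine le_sum_bern_mul hl0 hl1 X (σ.P_nonneg _) (D := fun C =>
    excess C e0 (θ 0) (μ 0) (fun v => σ.k0 v s0) +
    excess C e1 (θ 1) (μ 1) (fun v => σ.k1 v (s0, s1, u)) +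
    excess C e2 (θ 2) (μ 2) (fun v => σ.k2 v (s0, s2, u)) +
    excess C e3 (θ 3) (μ 3) (fun v => σ.k13 v (u, v1, s0, s1)) +
    excess C e4 (θ 4) (μ 4) (fun v => σ.k23 v (u, v2, s0, s2)) +
    (∑ k', ind (k' ≠ (a2, v2)) * ind (Q1 C t1 (w, u, s0, s1, x1, y1) k')) +
    (∑ k', ind (k' ≠ (a1, v1)) * ind (Q2 C t2 (w, u, s0, s2, x2, y2) k')) +
    (∑ k', ind (k' ≠ ((w, u), (v1, d1, v13), (v2, d2, v23))) *
      ind (Q3 C t3 a1 a2 y3 k'))) ?_ ?_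
  · intro C
    obtain ⟨r0, p0, p0', p0'', q0⟩ := pick_eq C e0 (θ 0) (μ 0) (fun v => σ.k0 v s0) m0
    obtain ⟨r1, p1, p1', p1'', q1⟩ := pick_eq C e1 (θ 1) (μ 1) (fun v => σ.k1 v (s0, s1, u)) m1
    obtain ⟨r2, p2, p2', p2'', q2⟩ := pick_eq C e2 (θ 2) (μ 2) (fun v => σ.k2 v (s0, s2, u)) m2
    obtain ⟨r3, p3, p3', p3'', q3⟩ :=
      pick_eq C e3 (θ 3) (μ 3) (fun v => σ.k13 v (u, v1, s0, s1)) m3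
    obtain ⟨r4, p4, p4', p4'', q4⟩ :=
      pick_eq C e4 (θ 4) (μ 4) (fun v => σ.k23 v (u, v2, s0, s2)) m4
    set π := ∏ x ∈ X, ((layer θ x)⁻¹ * hit C x) with hπ
    have hprod : π = ((θ 0)⁻¹ * hit C (e0 u)) * (((θ 1)⁻¹ * hit C (e1 v1)) *
        (((θ 2)⁻¹ * hit C (e2 v2)) * (((θ 3)⁻¹ * hit C (e3 v13)) *
          ((θ 4)⁻¹ * hit C (e4 v23))))) := by
      simp [hπ, hX, truth, layer, e0, e1, e2, e3, e4]
    have hπ0 : 0 ≤ π := prod_nonneg fun x _ => mul_nonneg (inv_nonneg.2 (hl0 x).le) (hit_nonneg _ _)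
    have hrhs : σ.q0 s0 * σ.q1 s1 s0 * σ.q2 s2 s0 * enc0 σ θ μ C w s0 u *
          enc1 σ θ μ C w u a1 d1 s0 s1 v1 v13 x1 * enc2 σ θ μ C w u a2 d2 s0 s2 v2 v23 x2 *
          σ.W (y1, y2, y3) (x1, x2, s0, s1, s2) *
          ind (AllOnly C t1 t2 t3 w a1 a2 d1 d2
            (s0, s1, s2, u, v1, v2, v13, v23, x1, x2, y1, y2, y3)) =
        σ.P (s0, s1, s2, u, v1, v2, v13, v23, x1, x2, y1, y2, y3) * π *
          (r0 * r1 * r2 * r3 * r4 *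
            ind (IsOnly (Q1 C t1 (w, u, s0, s1, x1, y1)) (a2, v2)) *
            ind (IsOnly (Q2 C t2 (w, u, s0, s2, x2, y2)) (a1, v1)) *
            ind (IsOnly (Q3 C t3 a1 a2 y3) ((w, u), (v1, d1, v13), (v2, d2, v23)))) := by
      have q0' : enc0 σ θ μ C w s0 u = _ := q0
      have q1' : pick C (fun v => .inr (.inl (w, u, a1, v))) (θ 1) (μ 1)
        (fun v => σ.k1 v (s0, s1, u)) v1 = _ := q1
      have q2' : pick C (fun v => .inr (.inr (.inl (w, u, a2, v)))) (θ 2) (μ 2)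
        (fun v => σ.k2 v (s0, s2, u)) v2 = _ := q2
      have q3' : pick C (fun v => .inr (.inr (.inr (.inl (w, u, a1, v1, d1, v))))) (θ 3) (μ 3)
        (fun v => σ.k13 v (u, v1, s0, s1)) v13 = _ := q3
      have q4' : pick C (fun v => .inr (.inr (.inr (.inr (w, u, a2, v2, d2, v))))) (θ 4) (μ 4)
        (fun v => σ.k23 v (u, v2, s0, s2)) v23 = _ := q4
      rw [enc1, enc2, q0', q1', q2', q3', q4', hprod, AllOnly, ind_and, ind_and, Sys.P]
      ring
    rw [hrhs]
    by_cases hz : π = 0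
    · rw [hz]; simp
    have hall : C (e0 u) = true ∧ C (e1 v1) = true ∧ C (e2 v2) = true ∧ C (e3 v13) = true ∧
        C (e4 v23) = true := by
      rw [hprod] at hz
      simp only [mul_ne_zero_iff, ne_eq, hit, ite_eq_right_iff, one_ne_zero, imp_false,
        not_not] at hz
      exact ⟨hz.1.2, hz.2.1.2, hz.2.2.1.2, hz.2.2.2.1.2, hz.2.2.2.2.2⟩
    refine mul_le_mul_of_nonneg_left ?_ (mul_nonneg (σ.P_nonneg _) hπ0)
    exact mul_prod_mul_one_sub_le ⟨p0, p0', p0''⟩ ⟨p1, p1', p1''⟩ ⟨p2, p2', p2''⟩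
      ⟨p3, p3', p3''⟩ ⟨p4, p4', p4''⟩
      ⟨ind_nonneg _, ind_le_one _, one_sub_sum_ind_le (k := (a2, v2)) ⟨ht1, hall.2.2.1⟩⟩
      ⟨ind_nonneg _, ind_le_one _, one_sub_sum_ind_le (k := (a1, v1)) ⟨ht2, hall.2.1⟩⟩
      ⟨ind_nonneg _, ind_le_one _, one_sub_sum_ind_le
        (k := ((w, u), (v1, d1, v13), (v2, d2, v23))) ⟨ht3, hall⟩⟩
  · simp only [mul_add, sum_add_distrib]
    simp only [Q1, Q2]
    linarith

end OneShot

lemma exists_le_of_le_sum_mul {β : Type*} [Fintype β] {w F : β → ℝ} (hw : ∀ b, 0 ≤ w b)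
    (hw1 : ∑ b, w b = 1) {c : ℝ} (h : c ≤ ∑ b, w b * F b) : ∃ b, c ≤ F b := by
  by_contra! hlt
  have hle : ∑ b, w b * F b ≤ ∑ b, w b * c :=
    sum_le_sum fun b _ => mul_le_mul_of_nonneg_left (hlt b).le (hw b)
  rw [← sum_mul, hw1, one_mul] at hle
  have heq : ∑ b, w b * (c - F b) = 0 := by
    simp_rw [mul_sub]
    rw [sum_sub_distrib, ← sum_mul, hw1]
    linarith
  have hz := (sum_eq_zero_iff_of_nonneg fun b _ =>
    mul_nonneg (hw b) (sub_nonneg.2 (hlt b).le)).1 heq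
  have : ∑ b, w b = 0 := sum_eq_zero fun b hb =>
    (mul_eq_zero.1 (hz b hb)).resolve_right (sub_pos.2 (hlt b)).ne'
  rw [hw1] at this
  exact one_ne_zero this

section OneShot

variable {S0 S1 S2 U V1 V2 V13 V23 X1 X2 Y1 Y2 Y3 M A1 A2 D1 D2 : Type*}
  [Fintype S0] [Fintype S1] [Fintype S2] [Fintype U] [Fintype V1] [Fintype V2]
  [Fintype V13] [Fintype V23] [Fintype X1] [Fintype X2]
  [Fintype Y1] [Fintype Y2] [Fintype Y3]
  [Fintype M] [Fintype A1] [Fintype A2] [Fintype D1] [Fintype D2]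

lemma enc0_nonneg (σ : Sys S0 S1 S2 U V1 V2 V13 V23 X1 X2 Y1 Y2 Y3) {θ : Fin 5 → ℝ}
    (μ : Fin 5 → ℝ) (hθ : ∀ i, 0 < θ i) (C : Cb M A1 A2 D1 D2 U V1 V2 V13 V23 → Bool)
    (w : M) (s0 : S0) (u : U) : 0 ≤ enc0 σ θ μ C w s0 u :=
  pick_nonneg _ _ (hθ 0) _ (fun v => σ.hk0.1 v s0) _

lemma enc1_nonneg (σ : Sys S0 S1 S2 U V1 V2 V13 V23 X1 X2 Y1 Y2 Y3) {θ : Fin 5 → ℝ}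
    (μ : Fin 5 → ℝ) (hθ : ∀ i, 0 < θ i) (C : Cb M A1 A2 D1 D2 U V1 V2 V13 V23 → Bool)
    (w : M) (u : U) (a1 : A1) (d1 : D1) (s0 : S0) (s1 : S1) (v1 : V1) (v13 : V13) (x1 : X1) :
    0 ≤ enc1 σ θ μ C w u a1 d1 s0 s1 v1 v13 x1 :=
  mul_nonneg (pick_nonneg _ _ (hθ 1) _ (fun v => σ.hk1.1 v _) _)
    (mul_nonneg (pick_nonneg _ _ (hθ 3) _ (fun v => σ.hk13.1 v _) _) (σ.hkx1.1 _ _))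

lemma enc2_nonneg (σ : Sys S0 S1 S2 U V1 V2 V13 V23 X1 X2 Y1 Y2 Y3) {θ : Fin 5 → ℝ}
    (μ : Fin 5 → ℝ) (hθ : ∀ i, 0 < θ i) (C : Cb M A1 A2 D1 D2 U V1 V2 V13 V23 → Bool)
    (w : M) (u : U) (a2 : A2) (d2 : D2) (s0 : S0) (s2 : S2) (v2 : V2) (v23 : V23) (x2 : X2) :
    0 ≤ enc2 σ θ μ C w u a2 d2 s0 s2 v2 v23 x2 :=
  mul_nonneg (pick_nonneg _ _ (hθ 2) _ (fun v => σ.hk2.1 v _) _)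
    (mul_nonneg (pick_nonneg _ _ (hθ 4) _ (fun v => σ.hk23.1 v _) _) (σ.hkx2.1 _ _))

lemma sum_three_le_one {A B X : Type*} [Fintype A] [Fintype B] [Fintype X] {a : A → ℝ}
    {b : A → B → ℝ} {c : A → B → X → ℝ} (ha : ∀ i, 0 ≤ a i) (hb : ∀ i j, 0 ≤ b i j)
    (ha1 : ∑ i, a i ≤ 1) (hb1 : ∀ i, ∑ j, b i j ≤ 1) (hc1 : ∀ i j, ∑ x, c i j x = 1) :
    ∑ x, ∑ i, ∑ j, a i * (b i j * c i j x) ≤ 1 := by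
  rw [sum_comm]
  refine le_trans (sum_le_sum fun i _ => ?_) ha1
  rw [sum_comm]
  simp_rw [← mul_sum, hc1, mul_one]
  exact mul_le_of_le_one_right (ha i) (hb1 i)

/-- Existence of a deterministic code for one block: given the pair of cooperative messages
of the previous block (`M`), the encoders send new cooperative messages (`A1`, `A2`) and
private messages (`D1`, `D2`); each encoder decodes the cooperative message of the other
one, and the receiver, given the new cooperative messages, decodes all the rest. -/
lemma exists_blockCode [Nonempty U] [Nonempty V1] [Nonempty V2] [Nonempty V13] [Nonempty V23]
    [Nonempty X1] [Nonempty X2] [Nonempty M] [Nonempty A1] [Nonempty A2] [Nonempty D1]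
    [Nonempty D2]
    (σ : Sys S0 S1 S2 U V1 V2 V13 V23 X1 X2 Y1 Y2 Y3) {θ μ : Fin 5 → ℝ}
    (hθ : ∀ i, 0 < θ i) (hθ1 : ∀ i, θ i ≤ 1) (hμ : ∀ i, 0 ≤ μ i) {η ε : ℝ}
    (hη : ∀ i, ((θ i)⁻¹ - 1) * μ i ≤ η)
    {t1 : V2 → U → S0 → S1 → X1 → Y1 → Prop} {t2 : V1 → U → S0 → S2 → X2 → Y2 → Prop}
    {t3 : U → V1 → V2 → V13 → V23 → Y3 → Prop}
    (hs1 : ∀ u s0 s1 x1 y1, Fintype.card A2 * θ 2 * ∑ v, ind (t1 v u s0 s1 x1 y1) ≤ ε)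
    (hs2 : ∀ u s0 s2 x2 y2, Fintype.card A1 * θ 1 * ∑ v, ind (t2 v u s0 s2 x2 y2) ≤ ε)
    (hs3 : Sparse3 θ (Fintype.card M) (Fintype.card D1) (Fintype.card D2) ε t3) :
    ∃ (f1 : M → A1 → D1 → S0 → S1 → X1) (f2 : M → A2 → D2 → S0 → S2 → X2)
      (g1 : M → A1 → D1 → S0 → S1 → Y1 → A2) (g2 : M → A2 → D2 → S0 → S2 → Y2 → A1)
      (h : A1 → A2 → Y3 → M × D1 × D2),
      Fintype.card (M × A1 × A2 × D1 × D2) * ((1 - (5 * (η + √η) + 11 * ε)) *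
          ∑ z, σ.P z * ind (Good σ μ t1 t2 t3 z)) ≤
        ∑ c : M × A1 × A2 × D1 × D2, ∑ s : S0 × S1 × S2, ∑ y : Y1 × Y2 × Y3,
          σ.q0 s.1 * σ.q1 s.2.1 s.1 * σ.q2 s.2.2 s.1 *
          σ.W y (f1 c.1 c.2.1 c.2.2.2.1 s.1 s.2.1, f2 c.1 c.2.2.1 c.2.2.2.2 s.1 s.2.2, s) *
          ind (g1 c.1 c.2.1 c.2.2.2.1 s.1 s.2.1 y.1 = c.2.2.1 ∧
            g2 c.1 c.2.2.1 c.2.2.2.2 s.1 s.2.2 y.2.1 = c.2.1 ∧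
            h c.2.1 c.2.2.1 y.2.2 = (c.1, c.2.2.2)) := by
  classical
  set err := 5 * (η + √η) + 11 * ε
  let G : (Cb M A1 A2 D1 D2 U V1 V2 V13 V23 → Bool) → (M × A1 × A2 × D1 × D2) →
      S0 × S1 × S2 × U × V1 × V2 × V13 × V23 × X1 × X2 × Y1 × Y2 × Y3 → ℝ :=
    fun C (w, a1, a2, d1, d2) (s0, s1, s2, u, v1, v2, v13, v23, x1, x2, y1, y2, y3) =>
      σ.q0 s0 * σ.q1 s1 s0 * σ.q2 s2 s0 * enc0 σ θ μ C w s0 u *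
          enc1 σ θ μ C w u a1 d1 s0 s1 v1 v13 x1 * enc2 σ θ μ C w u a2 d2 s0 s2 v2 v23 x2 *
          σ.W (y1, y2, y3) (x1, x2, s0, s1, s2) *
          ind (AllOnly C t1 t2 t3 w a1 a2 d1 d2
            (s0, s1, s2, u, v1, v2, v13, v23, x1, x2, y1, y2, y3))
  have hl0 : ∀ v : Cb M A1 A2 D1 D2 U V1 V2 V13 V23, 0 ≤ layer θ v := fun v => by
    rcases v with v | v | v | v | v <;> exact (hθ _).le
  have hl1 : ∀ v : Cb M A1 A2 D1 D2 U V1 V2 V13 V23, layer θ v ≤ 1 := fun v => by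
    rcases v with v | v | v | v | v <;> exact hθ1 _
  have hq : ∀ s0 s1 s2, 0 ≤ σ.q0 s0 * σ.q1 s1 s0 * σ.q2 s2 s0 := fun s0 s1 s2 =>
    mul_nonneg (mul_nonneg (σ.hq0.1 _) (σ.hq1.1 _ _)) (σ.hq2.1 _ _)
  have hG0 : ∀ C c z, 0 ≤ G C c z := by
    rintro C ⟨w, a1, a2, d1, d2⟩ ⟨s0, s1, s2, u, v1, v2, v13, v23, x1, x2, y1, y2, y3⟩
    exact mul_nonneg (mul_nonneg (mul_nonneg (mul_nonneg (mul_nonneg (hq _ _ _)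
      (enc0_nonneg σ μ hθ _ _ _ _)) (enc1_nonneg σ μ hθ _ _ _ _ _ _ _ _ _ _))
      (enc2_nonneg σ μ hθ _ _ _ _ _ _ _ _ _ _)) (σ.hW.1 _ _)) (ind_nonneg _)
  have hGz : ∀ c z, (1 - err) * (σ.P z * ind (Good σ μ t1 t2 t3 z)) ≤
      ∑ C, bern (layer θ) C * G C c z := by
    intro c z
    by_cases hz : Good σ μ t1 t2 t3 z
    · rw [ind_of_true hz, mul_one, mul_comm]
      obtain ⟨w, a1, a2, d1, d2⟩ := c
      obtain ⟨s0, s1, s2, u, v1, v2, v13, v23, x1, x2, y1, y2, y3⟩ := z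
      exact le_sum_bern_enc σ hθ hθ1 hμ hη hs1 hs2 hs3 w a1 a2 d1 d2 s0 s1 s2 u v1 v2 v13 v23
        x1 x2 y1 y2 y3 hz
    · rw [ind_of_false hz, mul_zero, mul_zero]
      exact sum_nonneg fun C _ => mul_nonneg (bern_nonneg hl0 hl1 C) (hG0 C c z)
  obtain ⟨C, hC⟩ := exists_le_of_le_sum_mul (bern_nonneg hl0 hl1) (sum_bern _)
    (F := fun C => ∑ c, ∑ z, G C c z)
    (c := Fintype.card (M × A1 × A2 × D1 × D2) * ((1 - err) *
          ∑ z, σ.P z * ind (Good σ μ t1 t2 t3 z))) (by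
      calc _ = ∑ c : M × A1 × A2 × D1 × D2, ∑ z,
            (1 - err) * (σ.P z * ind (Good σ μ t1 t2 t3 z)) := by
            rw [sum_const, card_univ, nsmul_eq_mul, ← mul_sum]
        _ ≤ ∑ c, ∑ z, ∑ C, bern (layer θ) C * G C c z :=
            sum_le_sum fun c _ => sum_le_sum fun z _ => hGz c z
        _ = _ := by
            symm
            simp_rw [mul_sum]
            rw [sum_comm]
            exact sum_congr rfl fun c _ => sum_comm)
  obtain ⟨dec1, hdec1⟩ := exists_decoder (Q1 C t1)
  obtain ⟨dec2, hdec2⟩ := exists_decoder (Q2 C t2)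
  obtain ⟨dec3, hdec3⟩ := exists_decoder (fun o : A1 × A2 × Y3 => Q3 C t3 o.1 o.2.1 o.2.2)
  let F : (M × A1 × A2 × D1 × D2) × (S0 × S1 × S2) × (Y1 × Y2 × Y3) → U → X1 → X2 → ℝ :=
    fun i u x1 x2 => σ.q0 i.2.1.1 * σ.q1 i.2.1.2.1 i.2.1.1 * σ.q2 i.2.1.2.2 i.2.1.1 *
      σ.W i.2.2 (x1, x2, i.2.1) *
      ind ((dec1 (i.1.1, u, i.2.1.1, i.2.1.2.1, x1, i.2.2.1)).1 = i.1.2.2.1 ∧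
        (dec2 (i.1.1, u, i.2.1.1, i.2.1.2.2, x2, i.2.2.2.1)).1 = i.1.2.1 ∧
        ((dec3 (i.1.2.1, i.1.2.2.1, i.2.2.2.2)).1.1,
          (dec3 (i.1.2.1, i.1.2.2.1, i.2.2.2.2)).2.1.2.1,
          (dec3 (i.1.2.1, i.1.2.2.1, i.2.2.2.2)).2.2.2.1) = (i.1.1, i.1.2.2.2))
  have hF0 : ∀ i u x1 x2, 0 ≤ F i u x1 x2 := fun i u x1 x2 =>
    mul_nonneg (mul_nonneg (hq _ _ _) (σ.hW.1 _ _)) (ind_nonneg _)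
  let K1 : M → U → A1 → D1 → S0 → S1 → X1 → ℝ := fun w u a1 d1 s0 s1 x1 =>
    ∑ v1, ∑ v13, enc1 σ θ μ C w u a1 d1 s0 s1 v1 v13 x1
  let K2 : M → U → A2 → D2 → S0 → S2 → X2 → ℝ := fun w u a2 d2 s0 s2 x2 =>
    ∑ v2, ∑ v23, enc2 σ θ μ C w u a2 d2 s0 s2 v2 v23 x2
  have hK1 : ∀ w u a1 d1 s0 s1 x1, 0 ≤ K1 w u a1 d1 s0 s1 x1 := fun w u a1 d1 s0 s1 x1 =>
    sum_nonneg fun _ _ => sum_nonneg fun _ _ => enc1_nonneg σ μ hθ _ _ _ _ _ _ _ _ _ _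
  have hK2 : ∀ w u a2 d2 s0 s2 x2, 0 ≤ K2 w u a2 d2 s0 s2 x2 := fun w u a2 d2 s0 s2 x2 =>
    sum_nonneg fun _ _ => sum_nonneg fun _ _ => enc2_nonneg σ μ hθ _ _ _ _ _ _ _ _ _ _
  have hK1' : ∀ w u a1 d1 s0 s1, ∑ x1, K1 w u a1 d1 s0 s1 x1 ≤ 1 := fun w u a1 d1 s0 s1 =>
    sum_three_le_one (fun i => pick_nonneg _ _ (hθ 1) _ (fun v => σ.hk1.1 v _) _)
      (fun i j => pick_nonneg _ _ (hθ 3) _ (fun v => σ.hk13.1 v _) _)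
      (sum_pick_le_one _ _ _ _ _) (fun i => sum_pick_le_one _ _ _ _ _)
      (fun i j => σ.hkx1.2 _)
  have hK2' : ∀ w u a2 d2 s0 s2, ∑ x2, K2 w u a2 d2 s0 s2 x2 ≤ 1 := fun w u a2 d2 s0 s2 =>
    sum_three_le_one (fun i => pick_nonneg _ _ (hθ 2) _ (fun v => σ.hk2.1 v _) _)
      (fun i j => pick_nonneg _ _ (hθ 4) _ (fun v => σ.hk23.1 v _) _)
      (sum_pick_le_one _ _ _ _ _) (fun i => sum_pick_le_one _ _ _ _ _)
      (fun i j => σ.hkx2.2 _)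
  have hre : ∑ c, ∑ z, G C c z ≤ ∑ i, ∑ u, enc0 σ θ μ C i.1.1 i.2.1.1 u *
      ∑ x1, K1 i.1.1 u i.1.2.1 i.1.2.2.2.1 i.2.1.1 i.2.1.2.1 x1 *
        ∑ x2, K2 i.1.1 u i.1.2.2.1 i.1.2.2.2.2 i.2.1.1 i.2.1.2.2 x2 * F i u x1 x2 := by
    let H : (((((((M × A1 × A2 × D1 × D2) × (S0 × S1 × S2) × (Y1 × Y2 × Y3)) × U) × X1) × X2) ×
        (V1 × V13)) × (V2 × V23)) → ℝ := fun r =>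
      enc0 σ θ μ C r.1.1.1.1.1.1.1 r.1.1.1.1.1.2.1.1 r.1.1.1.1.2 *
      (enc1 σ θ μ C r.1.1.1.1.1.1.1 r.1.1.1.1.2 r.1.1.1.1.1.1.2.1 r.1.1.1.1.1.1.2.2.2.1
        r.1.1.1.1.1.2.1.1 r.1.1.1.1.1.2.1.2.1 r.1.2.1 r.1.2.2 r.1.1.1.2 *
      (enc2 σ θ μ C r.1.1.1.1.1.1.1 r.1.1.1.1.2 r.1.1.1.1.1.1.2.2.1 r.1.1.1.1.1.1.2.2.2.2
        r.1.1.1.1.1.2.1.1 r.1.1.1.1.1.2.1.2.2 r.2.1 r.2.2 r.1.1.2 *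
      F r.1.1.1.1.1 r.1.1.1.1.2 r.1.1.1.2 r.1.1.2))
    let E : (M × A1 × A2 × D1 × D2) ×
        (S0 × S1 × S2 × U × V1 × V2 × V13 × V23 × X1 × X2 × Y1 × Y2 × Y3) ≃
        (((((((M × A1 × A2 × D1 × D2) × (S0 × S1 × S2) × (Y1 × Y2 × Y3)) × U) × X1) × X2) ×
        (V1 × V13)) × (V2 × V23)) :=
      { toFun := fun (c, s0, s1, s2, u, v1, v2, v13, v23, x1, x2, y) =>
          ((((((c, (s0, s1, s2), y), u), x1), x2), (v1, v13)), (v2, v23))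
        invFun := fun ((((((c, (s0, s1, s2), y), u), x1), x2), (v1, v13)), (v2, v23)) =>
          (c, s0, s1, s2, u, v1, v2, v13, v23, x1, x2, y)
        left_inv := fun _ => rfl
        right_inv := fun _ => rfl }
    have hle : ∑ c, ∑ z, G C c z ≤ ∑ r, H r := by
      rw [← Fintype.sum_prod_type', ← E.sum_comp]
      refine sum_le_sum ?_
      rintro ⟨⟨w, a1, a2, d1, d2⟩, s0, s1, s2, u, v1, v2, v13, v23, x1, x2, y1, y2, y3⟩ -
      simp only [G, H, E, F, Equiv.coe_fn_mk]
      have hind : ind (AllOnly C t1 t2 t3 w a1 a2 d1 d2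
            (s0, s1, s2, u, v1, v2, v13, v23, x1, x2, y1, y2, y3)) ≤
          ind ((dec1 (w, u, s0, s1, x1, y1)).1 = a2 ∧ (dec2 (w, u, s0, s2, x2, y2)).1 = a1 ∧
            ((dec3 (a1, a2, y3)).1.1, (dec3 (a1, a2, y3)).2.1.2.1,
              (dec3 (a1, a2, y3)).2.2.2.1) = (w, d1, d2)) := by
        refine ind_mono fun ⟨h1, h2, h3⟩ => ?_
        rw [hdec1 _ _ h1, hdec2 _ _ h2, hdec3 (a1, a2, y3) _ h3]
        exact ⟨rfl, rfl, rfl⟩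
      refine (mul_le_mul_of_nonneg_left hind ?_).trans (le_of_eq (by ring))
      exact mul_nonneg (mul_nonneg (mul_nonneg (mul_nonneg (hq _ _ _)
        (enc0_nonneg σ μ hθ _ _ _ _)) (enc1_nonneg σ μ hθ _ _ _ _ _ _ _ _ _ _))
        (enc2_nonneg σ μ hθ _ _ _ _ _ _ _ _ _ _)) (σ.hW.1 _ _)
    refine hle.trans (le_of_eq ?_)
    rw [Fintype.sum_prod_type, Fintype.sum_prod_type, Fintype.sum_prod_type,
      Fintype.sum_prod_type, Fintype.sum_prod_type]
    refine sum_congr rfl fun i _ => sum_congr rfl fun u _ => ?_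
    rw [mul_sum]
    refine sum_congr rfl fun x1 _ => ?_
    rw [mul_sum, mul_sum]
    refine sum_congr rfl fun x2 _ => ?_
    simp only [H, ← mul_sum, ← sum_mul, K1, K2, Fintype.sum_prod_type]
  obtain ⟨fu, hfu⟩ := exists_deterministic_comp (A := U)
    (π := fun i : (M × A1 × A2 × D1 × D2) × (S0 × S1 × S2) × (Y1 × Y2 × Y3) => (i.1.1, i.2.1.1))
    (κ := fun j u => enc0 σ θ μ C j.1 j.2 u) (fun j u => enc0_nonneg σ μ hθ _ _ _ _)
    (fun j => sum_pick_le_one _ _ _ _ _)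
    (fun i u => sum_nonneg fun x1 _ => mul_nonneg (hK1 _ _ _ _ _ _ _)
      (sum_nonneg fun x2 _ => mul_nonneg (hK2 _ _ _ _ _ _ _) (hF0 i u x1 x2))) (hC.trans hre)
  obtain ⟨fx1, hfx1⟩ := exists_deterministic_comp (A := X1)
    (π := fun i : (M × A1 × A2 × D1 × D2) × (S0 × S1 × S2) × (Y1 × Y2 × Y3) =>
      (i.1.1, i.1.2.1, i.1.2.2.2.1, i.2.1.1, i.2.1.2.1))
    (κ := fun j x1 => K1 j.1 (fu (j.1, j.2.2.2.1)) j.2.1 j.2.2.1 j.2.2.2.1 j.2.2.2.2 x1)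
    (fun j x => hK1 _ _ _ _ _ _ _) (fun j => hK1' _ _ _ _ _ _)
    (fun i x1 => sum_nonneg fun x2 _ => mul_nonneg (hK2 _ _ _ _ _ _ _) (hF0 i _ x1 x2)) hfu
  obtain ⟨fx2, hfx2⟩ := exists_deterministic_comp (A := X2)
    (π := fun i : (M × A1 × A2 × D1 × D2) × (S0 × S1 × S2) × (Y1 × Y2 × Y3) =>
      (i.1.1, i.1.2.2.1, i.1.2.2.2.2, i.2.1.1, i.2.1.2.2))
    (κ := fun j x2 => K2 j.1 (fu (j.1, j.2.2.2.1)) j.2.1 j.2.2.1 j.2.2.2.1 j.2.2.2.2 x2)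
    (fun j x => hK2 _ _ _ _ _ _ _) (fun j => hK2' _ _ _ _ _ _)
    (fun i x2 => hF0 i _ _ x2) hfx1
  refine ⟨fun w a1 d1 s0 s1 => fx1 (w, a1, d1, s0, s1),
    fun w a2 d2 s0 s2 => fx2 (w, a2, d2, s0, s2),
    fun w a1 d1 s0 s1 y1 => (dec1 (w, fu (w, s0), s0, s1, fx1 (w, a1, d1, s0, s1), y1)).1,
    fun w a2 d2 s0 s2 y2 => (dec2 (w, fu (w, s0), s0, s2, fx2 (w, a2, d2, s0, s2), y2)).1,
    fun a1 a2 y3 => ((dec3 (a1, a2, y3)).1.1, (dec3 (a1, a2, y3)).2.1.2.1,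
      (dec3 (a1, a2, y3)).2.2.2.1), hfx2.trans (le_of_eq ?_)⟩
  rw [Fintype.sum_prod_type]
  refine sum_congr rfl fun c _ => ?_
  rw [Fintype.sum_prod_type]

end OneShot

/-! ### Entropies and empirical averages -/

section Entropy

variable {T A B : Type*} [Fintype T]

lemma marg_nonneg {p : T → ℝ} (hp : ∀ t, 0 ≤ p t) (f : T → A) (a : A) : 0 ≤ marg p f a :=
  sum_nonneg fun t _ => by split_ifs <;> simp [hp t]

lemma le_marg {p : T → ℝ} (hp : ∀ t, 0 ≤ p t) (f : T → A) (t : T) : p t ≤ marg p f (f t) := by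
  classical
  refine le_trans (by simp) (single_le_sum (f := fun t' => if f t' = f t then p t' else 0)
    (fun t' _ => ?_) (mem_univ t))
  split_ifs <;> simp [hp t']

lemma marg_congr (p : T → ℝ) {f : T → A} {g : T → B} (h : ∀ t t', f t = f t' ↔ g t = g t')
    (t : T) : marg p f (f t) = marg p g (g t) := by
  classical
  unfold marg
  exact sum_congr rfl fun t' _ => if_congr (h t' t) rfl rfl

lemma sum_marg_pair [Fintype A] (p : T → ℝ) (f : T → A) (g : T → B) (b : B) :
    ∑ a, marg p (fun t => (f t, g t)) (a, b) = marg p g b := by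
  classical
  simp_rw [marg, Prod.mk.injEq]
  rw [sum_comm]
  refine sum_congr rfl fun t _ => ?_
  by_cases h : g t = b <;> simp [h]

variable [Fintype A] [Fintype B]

lemma sum_marg_mul (p : T → ℝ) (f : T → A) (φ : A → ℝ) :
    ∑ a, marg p f a * φ a = ∑ t, p t * φ (f t) := by
  classical
  simp_rw [marg, sum_mul]
  rw [sum_comm]
  refine sum_congr rfl fun t _ => ?_
  simp [ite_mul]

lemma entOf_eq (p : T → ℝ) (f : T → A) :
    entOf p f = -∑ t, p t * Real.logb 2 (marg p f (f t)) := by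
  rw [entOf, ent, ← sum_marg_mul p f fun a => Real.logb 2 (marg p f a), ← sum_neg_distrib]

lemma entOf_congr (p : T → ℝ) {f : T → A} {g : T → B} (h : ∀ t t', f t = f t' ↔ g t = g t') :
    entOf p f = entOf p g := by
  rw [entOf_eq, entOf_eq]
  simp_rw [marg_congr p h]

/-- Conditional entropy. -/
def condEnt (p : T → ℝ) (f : T → A) (g : T → B) : ℝ :=
  entOf p (fun t => (f t, g t)) - entOf p g

/-- The log-likelihood whose mean is minus the conditional entropy. -/
def condLog (p : T → ℝ) (f : T → A) (g : T → B) (t : T) : ℝ :=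
  Real.logb 2 (marg p (fun t => (f t, g t)) (f t, g t)) - Real.logb 2 (marg p g (g t))

lemma sum_mul_condLog (p : T → ℝ) (f : T → A) (g : T → B) :
    ∑ t, p t * condLog p f g t = -condEnt p f g := by
  simp only [condEnt, condLog, entOf_eq, mul_sub, sum_sub_distrib]
  ring

/-- Gibbs' inequality. -/
lemma condEnt_le {p : T → ℝ} (hp : ∀ t, 0 ≤ p t) (hp1 : ∑ t, p t = 1) (f : T → A) (g : T → B)
    {k : A → B → ℝ} (hk : ∀ a b, 0 ≤ k a b) (hk1 : ∀ b, ∑ a, k a b ≤ 1)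
    (hpos : ∀ t, 0 < p t → 0 < k (f t) (g t)) :
    condEnt p f g ≤ -∑ t, p t * Real.logb 2 (k (f t) (g t)) := by
  have hl2 : 0 < Real.log 2 := Real.log_pos one_lt_two
  set F := marg p fun t => (f t, g t) with hF
  have key : ∑ t, p t * (Real.logb 2 (k (f t) (g t)) - condLog p f g t) ≤
      ∑ t, p t * ((k (f t) (g t) * marg p g (g t) / F (f t, g t) - 1) / Real.log 2) := by
    refine sum_le_sum fun t _ => ?_
    rcases (hp t).eq_or_lt with h0 | h0
    · simp [← h0]
    refine mul_le_mul_of_nonneg_left ?_ (hp t)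
    have h1 : 0 < F (f t, g t) := h0.trans_le (le_marg hp (fun t => (f t, g t)) t)
    have h2 : 0 < marg p g (g t) := h0.trans_le (le_marg hp g t)
    have h3 := hpos t h0
    rw [condLog, ← hF, Real.logb, Real.logb, Real.logb, ← sub_div, ← sub_div]
    refine div_le_div_of_nonneg_right ?_ hl2.le
    have := Real.log_le_sub_one_of_pos (div_pos (mul_pos h3 h2) h1)
    rw [Real.log_div (mul_pos h3 h2).ne' h1.ne', Real.log_mul h3.ne' h2.ne'] at this
    linarith
  have h2 : ∑ t, p t * (k (f t) (g t) * marg p g (g t) / F (f t, g t)) ≤ 1 := by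
    rw [← sum_marg_mul p (fun t => (f t, g t))
      (fun c => k c.1 c.2 * marg p g c.2 / F c)]
    calc _ ≤ ∑ c : A × B, k c.1 c.2 * marg p g c.2 := by
          refine sum_le_sum fun c _ => ?_
          have := marg_nonneg hp g c.2
          by_cases hc : F c = 0
          · rw [← hF, hc, zero_mul]; exact mul_nonneg (hk _ _) this
          · rw [← hF]; exact (mul_div_cancel₀ _ hc).le
      _ ≤ 1 := by
          rw [Fintype.sum_prod_type_right]
          simp_rw [← sum_mul]
          calc _ ≤ ∑ b, 1 * marg p g b := sum_le_sum fun b _ =>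
                mul_le_mul_of_nonneg_right (hk1 b) (marg_nonneg hp g b)
            _ = 1 := by
                have := sum_marg_mul p g fun _ => (1 : ℝ)
                simp only [mul_one] at this
                simp only [one_mul, this, hp1]
  have h3 : ∑ t, p t * ((k (f t) (g t) * marg p g (g t) / F (f t, g t) - 1) / Real.log 2) =
      (∑ t, p t * (k (f t) (g t) * marg p g (g t) / F (f t, g t)) - 1) / Real.log 2 := by
    nth_rw 2 [← hp1]
    rw [← sum_sub_distrib, sum_div]
    exact sum_congr rfl fun t _ => by ring
  have h4 : (∑ t, p t * (k (f t) (g t) * marg p g (g t) / F (f t, g t)) - 1) / Real.log 2 ≤ 0 :=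
    div_nonpos_of_nonpos_of_nonneg (by linarith) hl2.le
  simp only [mul_sub, sum_sub_distrib, sum_mul_condLog] at key
  linarith

end Entropy

section Typical

variable {T A B : Type*} [Fintype T] [Fintype A] [Fintype B]

lemma sum_pmf_pow {p : T → ℝ} (hp1 : ∑ t, p t = 1) (n : ℕ) :
    ∑ z : Fin n → T, ∏ i, p (z i) = 1 := by
  rw [sum_prod_pi fun _ : Fin n => p]; simp [hp1]

lemma sum_pow_sq {p ψ : T → ℝ} (hp1 : ∑ t, p t = 1) (hψ : ∑ t, p t * ψ t = 0) (n : ℕ) :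
    ∑ z : Fin n → T, (∏ i, p (z i)) * (∑ i, ψ (z i)) ^ 2 = n * ∑ t, p t * ψ t ^ 2 := by
  induction n with
  | zero => simp
  | succ n ih =>
    rw [← (Fin.consEquiv fun _ : Fin (n + 1) => T).sum_comp, Fintype.sum_prod_type]
    simp only [Fin.consEquiv_apply, Fin.prod_univ_succ, Fin.sum_univ_succ, Fin.cons_zero,
      Fin.cons_succ]
    have h : ∀ a : T, ∑ z : Fin n → T, p a * (∏ i, p (z i)) * (ψ a + ∑ i, ψ (z i)) ^ 2 =
        p a * ψ a ^ 2 + 2 * (p a * ψ a) * (∑ z : Fin n → T, (∏ i, p (z i)) * ∑ i, ψ (z i)) +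
        p a * (n * ∑ t, p t * ψ t ^ 2) := by
      intro a
      have h1 : p a * ψ a ^ 2 = ∑ z : Fin n → T, (∏ i, p (z i)) * (p a * ψ a ^ 2) := by
        rw [← sum_mul, sum_pmf_pow hp1, one_mul]
      rw [← ih, mul_sum, mul_sum, h1, ← sum_add_distrib, ← sum_add_distrib]
      exact sum_congr rfl fun z _ => by ring
    simp_rw [h, sum_add_distrib, ← sum_mul, hp1, ← mul_sum, hψ]
    push_cast
    ring

/-- Chebyshev's inequality for empirical means. -/
lemma sum_pow_ind_lt_le {p : T → ℝ} (hp : ∀ t, 0 ≤ p t) (hp1 : ∑ t, p t = 1) (φ : T → ℝ)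
    {δ : ℝ} (hδ : 0 < δ) {n : ℕ} (hn : 0 < n) :
    ∑ z : Fin n → T, (∏ i, p (z i)) *
      ind (∑ i, φ (z i) < n * (∑ t, p t * φ t - δ)) ≤
      (∑ t, p t * (φ t - ∑ t, p t * φ t) ^ 2) / (n * δ ^ 2) := by
  set e := ∑ t, p t * φ t with he
  have hn' : (0 : ℝ) < n := by exact_mod_cast hn
  have h0 : ∑ t, p t * (φ t - e) = 0 := by
    simp_rw [mul_sub, sum_sub_distrib, ← sum_mul, hp1, ← he]; ring
  have h := sum_pow_sq hp1 h0 n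
  rw [le_div_iff₀ (by positivity)]
  have h2 : (∑ z : Fin n → T, (∏ i, p (z i)) * ind (∑ i, φ (z i) < n * (e - δ))) *
      (n * δ) ^ 2 ≤ ∑ z : Fin n → T, (∏ i, p (z i)) * (∑ i, (φ (z i) - e)) ^ 2 := by
    rw [sum_mul]
    refine sum_le_sum fun z _ => ?_
    rw [mul_assoc]
    refine mul_le_mul_of_nonneg_left ?_ (prod_nonneg fun i _ => hp _)
    by_cases hz : ∑ i, φ (z i) < n * (e - δ)
    · rw [ind_of_true hz, one_mul, sum_sub_distrib]
      simp only [sum_const, card_univ, Fintype.card_fin, nsmul_eq_mul]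
      have : 0 < n * δ := by positivity
      nlinarith
    · rw [ind_of_false hz, zero_mul]; positivity
  rw [h] at h2
  have h3 : (∑ z : Fin n → T, (∏ i, p (z i)) * ind (∑ i, φ (z i) < n * (e - δ))) *
      (n * δ ^ 2) * n ≤ (∑ t, p t * (φ t - e) ^ 2) * n := by
    calc _ = _ := by ring
      _ ≤ _ := h2
      _ = _ := by ring
  exact le_of_mul_le_mul_right h3 hn'

/-- Sequences without letters of probability zero, along which the empirical means of the
functions `φ j` are not much smaller than the means. -/
def Typ {ι : Type*} (p : T → ℝ) (φ : ι → T → ℝ) (δ : ℝ) {n : ℕ} (z : Fin n → T) : Prop :=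
  (∀ i, 0 < p (z i)) ∧ ∀ j, n * (∑ t, p t * φ j t - δ) ≤ ∑ i, φ j (z i)

lemma exists_forall_le_sum_typ {ι : Type*} [Fintype ι] {p : T → ℝ} (hp : ∀ t, 0 ≤ p t)
    (hp1 : ∑ t, p t = 1) (φ : ι → T → ℝ) {δ : ℝ} (hδ : 0 < δ) {ε : ℝ} (hε : 0 < ε) :
    ∃ N : ℕ, ∀ n, N ≤ n →
      1 - ε ≤ ∑ z : Fin n → T, (∏ i, p (z i)) * ind (Typ p φ δ z) := by
  set c := ∑ j, (∑ t, p t * (φ j t - ∑ t, p t * φ j t) ^ 2) / δ ^ 2 with hc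
  obtain ⟨N, hN⟩ := exists_nat_gt (c / ε)
  refine ⟨N + 1, fun n hn => ?_⟩
  have hn0 : 0 < n := by omega
  have hn' : (0 : ℝ) < n := by exact_mod_cast hn0
  have hcn : c / n ≤ ε := by
    rw [div_le_iff₀ hn']
    rw [div_lt_iff₀ hε] at hN
    have : (N : ℝ) ≤ n := by exact_mod_cast (by omega : N ≤ n)
    nlinarith
  have h1 : ∑ z : Fin n → T, (∏ i, p (z i)) * (1 - ∑ j, ind (∑ i, φ j (z i) <
      n * (∑ t, p t * φ j t - δ))) ≤
      ∑ z : Fin n → T, (∏ i, p (z i)) * ind (Typ p φ δ z) := by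
    refine sum_le_sum fun z _ => ?_
    by_cases h0 : ∃ i, p (z i) = 0
    · obtain ⟨i, hi⟩ := h0
      rw [prod_eq_zero (mem_univ i) hi]; simp
    have h0 : ∀ i, 0 < p (z i) := fun i => (hp _).lt_of_ne fun h => h0 ⟨i, h.symm⟩
    refine mul_le_mul_of_nonneg_left ?_ (prod_nonneg fun i _ => hp _)
    by_cases hz : Typ p φ δ z
    · rw [ind_of_true hz]
      linarith [sum_nonneg fun j (_ : j ∈ univ) =>
        ind_nonneg (∑ i, φ j (z i) < n * (∑ t, p t * φ j t - δ))]
    · rw [ind_of_false hz]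
      have : ∃ j, ∑ i, φ j (z i) < n * (∑ t, p t * φ j t - δ) := by
        by_contra hh
        push Not at hh
        exact hz ⟨h0, hh⟩
      obtain ⟨j, hj⟩ := this
      have := single_le_sum (f := fun j => ind (∑ i, φ j (z i) <
        n * (∑ t, p t * φ j t - δ))) (fun j _ => ind_nonneg _) (mem_univ j)
      simp only [ind_of_true hj] at this
      linarith
  refine le_trans ?_ h1
  simp_rw [mul_sub (∏ i, p _), mul_one, sum_sub_distrib]
  rw [sum_pmf_pow hp1]
  simp_rw [mul_sum (univ : Finset ι)]
  rw [sum_comm (t := (univ : Finset ι))]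
  have h2 : ∑ j, ∑ z : Fin n → T, (∏ i, p (z i)) *
      ind (∑ i, φ j (z i) < n * (∑ t, p t * φ j t - δ)) ≤ c / n := by
    rw [hc, sum_div]
    refine sum_le_sum fun j _ => (sum_pow_ind_lt_le hp hp1 (φ j) hδ hn0).trans (le_of_eq ?_)
    rw [div_div, mul_comm (n : ℝ)]
  linarith

/-- The typicality test for `f` given `g`. -/
def Test (p : T → ℝ) (f : T → A) (g : T → B) (δ : ℝ) {n : ℕ} (a : Fin n → A) (b : Fin n → B) :
    Prop :=
  (∀ i, 0 < marg p g (b i)) ∧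
    2 ^ (-(n * (condEnt p f g + δ))) * ∏ i, marg p g (b i) ≤
      ∏ i, marg p (fun t => (f t, g t)) (a i, b i)

lemma sum_ind_test_le {p : T → ℝ} (hp : ∀ t, 0 ≤ p t) (f : T → A) (g : T → B) (δ : ℝ) {n : ℕ}
    (b : Fin n → B) :
    ∑ a : Fin n → A, ind (Test p f g δ a b) ≤ 2 ^ (n * (condEnt p f g + δ)) := by
  by_cases hb : ∀ i, 0 < marg p g (b i)
  · have hQ : 0 < ∏ i, marg p g (b i) := prod_pos fun i _ => hb i
    have hc : (0 : ℝ) < 2 ^ (-(n * (condEnt p f g + δ))) := by positivity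
    have h1 : ∀ a : Fin n → A, ind (Test p f g δ a b) *
        (2 ^ (-(n * (condEnt p f g + δ))) * ∏ i, marg p g (b i)) ≤
        ∏ i, marg p (fun t => (f t, g t)) (a i, b i) := by
      intro a
      by_cases ha : Test p f g δ a b
      · rw [ind_of_true ha, one_mul]; exact ha.2
      · rw [ind_of_false ha, zero_mul]; exact prod_nonneg fun i _ => marg_nonneg hp _ _
    have h2 := sum_le_sum fun a (_ : a ∈ univ) => h1 a
    rw [← sum_mul, sum_prod_pi fun i a => marg p (fun t => (f t, g t)) (a, b i)] at h2
    simp_rw [sum_marg_pair] at h2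
    rw [← mul_assoc] at h2
    have h3 := le_of_mul_le_mul_right (h2.trans_eq (one_mul _).symm) hQ
    rw [Real.rpow_neg zero_le_two] at h3
    have hc' : (0 : ℝ) < 2 ^ (n * (condEnt p f g + δ)) := by positivity
    rwa [← div_eq_mul_inv, div_le_one hc'] at h3
  · rw [sum_eq_zero fun a _ => ind_of_false fun h => hb h.1]; positivity

lemma prod_eq_two_rpow {n : ℕ} {x : Fin n → ℝ} (hx : ∀ i, 0 < x i) :
    ∏ i, x i = 2 ^ (∑ i, Real.logb 2 (x i)) := by
  rw [Real.rpow_sum_of_pos two_pos]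
  exact prod_congr rfl fun i _ => (Real.rpow_logb two_pos (by norm_num) (hx i)).symm

lemma test_of_le {p : T → ℝ} (hp : ∀ t, 0 ≤ p t) (f : T → A) (g : T → B) {δ : ℝ} {n : ℕ}
    {z : Fin n → T} (hz : ∀ i, 0 < p (z i))
    (h : n * (∑ t, p t * condLog p f g t - δ) ≤ ∑ i, condLog p f g (z i)) :
    Test p f g δ (fun i => f (z i)) (fun i => g (z i)) := by
  have h1 : ∀ i, 0 < marg p g (g (z i)) := fun i => (hz i).trans_le (le_marg hp g _)
  have h2 : ∀ i, 0 < marg p (fun t => (f t, g t)) (f (z i), g (z i)) := fun i =>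
    (hz i).trans_le (le_marg hp (fun t => (f t, g t)) _)
  refine ⟨h1, ?_⟩
  rw [prod_eq_two_rpow h1, prod_eq_two_rpow h2, ← Real.rpow_add two_pos]
  refine Real.rpow_le_rpow_of_exponent_le one_le_two ?_
  rw [sum_mul_condLog] at h
  simp only [condLog, sum_sub_distrib] at h
  linarith

lemma prod_le_of_le {p : T → ℝ} {k : T → ℝ} {δ : ℝ} {n : ℕ} {z : Fin n → T}
    (hz : ∀ i, 0 < k (z i))
    (h : n * (∑ t, p t * -Real.logb 2 (k t) - δ) ≤ ∑ i, -Real.logb 2 (k (z i))) :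
    ∏ i, k (z i) ≤ 2 ^ (-(n * (∑ t, p t * -Real.logb 2 (k t) - δ))) := by
  rw [prod_eq_two_rpow hz]
  refine Real.rpow_le_rpow_of_exponent_le one_le_two ?_
  rw [sum_neg_distrib] at h
  linarith

end Typical

/-! ### Coding for a long block -/

section LongBlock

variable {S0 S1 S2 U V1 V2 V13 V23 X1 X2 Y1 Y2 Y3 : Type*}
  [Fintype S0] [Fintype S1] [Fintype S2] [Fintype U] [Fintype V1] [Fintype V2]
  [Fintype V13] [Fintype V23] [Fintype X1] [Fintype X2]
  [Fintype Y1] [Fintype Y2] [Fintype Y3]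

lemma IsCondPMF.pow {A B : Type*} [Fintype A] {k : A → B → ℝ} (hk : IsCondPMF k) {C : Type*}
    {n : ℕ} (c : C → Fin n → B) :
    IsCondPMF fun (a : Fin n → A) (b : C) => ∏ i, k (a i) (c b i) :=
  ⟨fun _ _ => prod_nonneg fun _ _ => hk.1 _ _, fun b => by
    rw [sum_prod_pi fun i a => k a (c b i)]; simp [hk.2]⟩

lemma sum_zip {A B : Type*} [Fintype A] [Fintype B] {n : ℕ}
    (F : (Fin n → A) → (Fin n → B) → ℝ) :
    ∑ a, ∑ b, F a b = ∑ c : Fin n → A × B, F (fun i => (c i).1) (fun i => (c i).2) := by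
  rw [← Fintype.sum_prod_type fun ab : (Fin n → A) × (Fin n → B) => F ab.1 ab.2,
    ← (Equiv.arrowProdEquivProdArrow (Fin n) (fun _ => A) (fun _ => B)).sum_comp]
  rfl

/-- The memoryless extension of a system. -/
def Sys.pow (σ : Sys S0 S1 S2 U V1 V2 V13 V23 X1 X2 Y1 Y2 Y3) (n : ℕ) :
    Sys (Fin n → S0) (Fin n → S1) (Fin n → S2) (Fin n → U) (Fin n → V1) (Fin n → V2)
      (Fin n → V13) (Fin n → V23) (Fin n → X1) (Fin n → X2)
      (Fin n → Y1) (Fin n → Y2) (Fin n → Y3) where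
  q0 s := ∏ i, σ.q0 (s i)
  q1 s c := ∏ i, σ.q1 (s i) (c i)
  q2 s c := ∏ i, σ.q2 (s i) (c i)
  k0 u c := ∏ i, σ.k0 (u i) (c i)
  k1 v c := ∏ i, σ.k1 (v i) (c.1 i, c.2.1 i, c.2.2 i)
  k2 v c := ∏ i, σ.k2 (v i) (c.1 i, c.2.1 i, c.2.2 i)
  k13 v c := ∏ i, σ.k13 (v i) (c.1 i, c.2.1 i, c.2.2.1 i, c.2.2.2 i)
  k23 v c := ∏ i, σ.k23 (v i) (c.1 i, c.2.1 i, c.2.2.1 i, c.2.2.2 i)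
  kx1 x c := ∏ i, σ.kx1 (x i) (c.1 i, c.2.1 i, c.2.2.1 i, c.2.2.2.1 i, c.2.2.2.2 i)
  kx2 x c := ∏ i, σ.kx2 (x i) (c.1 i, c.2.1 i, c.2.2.1 i, c.2.2.2.1 i, c.2.2.2.2 i)
  W y c := ∏ i, σ.W (y.1 i, y.2.1 i, y.2.2 i)
    (c.1 i, c.2.1 i, c.2.2.1 i, c.2.2.2.1 i, c.2.2.2.2 i)
  hq0 := ⟨fun _ => prod_nonneg fun _ _ => σ.hq0.1 _, sum_pmf_pow σ.hq0.2 n⟩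
  hq1 := σ.hq1.pow _
  hq2 := σ.hq2.pow _
  hk0 := σ.hk0.pow _
  hk1 := σ.hk1.pow _
  hk2 := σ.hk2.pow _
  hk13 := σ.hk13.pow _
  hk23 := σ.hk23.pow _
  hkx1 := σ.hkx1.pow _
  hkx2 := σ.hkx2.pow _
  hW := by
    refine ⟨fun _ _ => prod_nonneg fun _ _ => σ.hW.1 _ _, fun c => ?_⟩
    rw [Fintype.sum_prod_type]
    simp_rw [Fintype.sum_prod_type, sum_zip]
    exact (σ.hW.pow fun c i =>
      (c.1 i, c.2.1 i, c.2.2.1 i, c.2.2.2.1 i, c.2.2.2.2 i)).2 c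

/-- Sequences of tuples as tuples of sequences. -/
def unzip (S0 S1 S2 U V1 V2 V13 V23 X1 X2 Y1 Y2 Y3 : Type*) (n : ℕ) :
    (Fin n → S0 × S1 × S2 × U × V1 × V2 × V13 × V23 × X1 × X2 × Y1 × Y2 × Y3) ≃
    (Fin n → S0) × (Fin n → S1) × (Fin n → S2) × (Fin n → U) × (Fin n → V1) × (Fin n → V2) ×
      (Fin n → V13) × (Fin n → V23) × (Fin n → X1) × (Fin n → X2) ×
      (Fin n → Y1) × (Fin n → Y2) × (Fin n → Y3) where
  toFun z := (fun i => (z i).1, fun i => (z i).2.1, fun i => (z i).2.2.1,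
    fun i => (z i).2.2.2.1, fun i => (z i).2.2.2.2.1, fun i => (z i).2.2.2.2.2.1,
    fun i => (z i).2.2.2.2.2.2.1, fun i => (z i).2.2.2.2.2.2.2.1,
    fun i => (z i).2.2.2.2.2.2.2.2.1, fun i => (z i).2.2.2.2.2.2.2.2.2.1,
    fun i => (z i).2.2.2.2.2.2.2.2.2.2.1, fun i => (z i).2.2.2.2.2.2.2.2.2.2.2.1,
    fun i => (z i).2.2.2.2.2.2.2.2.2.2.2.2)
  invFun z i := (z.1 i, z.2.1 i, z.2.2.1 i, z.2.2.2.1 i, z.2.2.2.2.1 i, z.2.2.2.2.2.1 i,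
    z.2.2.2.2.2.2.1 i, z.2.2.2.2.2.2.2.1 i, z.2.2.2.2.2.2.2.2.1 i, z.2.2.2.2.2.2.2.2.2.1 i,
    z.2.2.2.2.2.2.2.2.2.2.1 i, z.2.2.2.2.2.2.2.2.2.2.2.1 i, z.2.2.2.2.2.2.2.2.2.2.2.2 i)
  left_inv _ := rfl
  right_inv _ := rfl

lemma Sys.pow_P (σ : Sys S0 S1 S2 U V1 V2 V13 V23 X1 X2 Y1 Y2 Y3) (n : ℕ)
    (z : Fin n → S0 × S1 × S2 × U × V1 × V2 × V13 × V23 × X1 × X2 × Y1 × Y2 × Y3) :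
    (σ.pow n).P (unzip S0 S1 S2 U V1 V2 V13 V23 X1 X2 Y1 Y2 Y3 n z) = ∏ i, σ.P (z i) := by
  simp only [Sys.P, prod_mul_distrib]
  rfl

lemma Sys.sum_P (σ : Sys S0 S1 S2 U V1 V2 V13 V23 X1 X2 Y1 Y2 Y3) : ∑ z, σ.P z = 1 := by
  have hx2 : ∀ s0 s1 s2 u v1 v2 v13 v23 x1 x2,
      ∑ r, σ.P (s0, s1, s2, u, v1, v2, v13, v23, x1, x2, r) =
      σ.q0 s0 * σ.q1 s1 s0 * σ.q2 s2 s0 *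
      σ.k0 u s0 * σ.k1 v1 (s0, s1, u) * σ.k2 v2 (s0, s2, u) *
      (σ.k13 v13 (u, v1, s0, s1) * σ.kx1 x1 (v13, u, v1, s0, s1)) *
      (σ.k23 v23 (u, v2, s0, s2) * σ.kx2 x2 (v23, u, v2, s0, s2)) := by
    intro s0 s1 s2 u v1 v2 v13 v23 x1 x2
    exact (mul_sum _ _ _).symm.trans (by rw [σ.hW.2, mul_one])
  have hx1 : ∀ s0 s1 s2 u v1 v2 v13 v23 x1,
      ∑ r, σ.P (s0, s1, s2, u, v1, v2, v13, v23, x1, r) =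
      σ.q0 s0 * σ.q1 s1 s0 * σ.q2 s2 s0 *
      σ.k0 u s0 * σ.k1 v1 (s0, s1, u) * σ.k2 v2 (s0, s2, u) *
      (σ.k13 v13 (u, v1, s0, s1) * σ.kx1 x1 (v13, u, v1, s0, s1)) *
      σ.k23 v23 (u, v2, s0, s2) := by
    intro s0 s1 s2 u v1 v2 v13 v23 x1
    rw [Fintype.sum_prod_type]
    simp only [hx2, ← mul_sum, σ.hkx2.2, mul_one]
  have hv23 : ∀ s0 s1 s2 u v1 v2 v13 v23,
      ∑ r, σ.P (s0, s1, s2, u, v1, v2, v13, v23, r) =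
      σ.q0 s0 * σ.q1 s1 s0 * σ.q2 s2 s0 *
      σ.k0 u s0 * σ.k1 v1 (s0, s1, u) * σ.k2 v2 (s0, s2, u) *
      σ.k13 v13 (u, v1, s0, s1) * σ.k23 v23 (u, v2, s0, s2) := by
    intro s0 s1 s2 u v1 v2 v13 v23
    rw [Fintype.sum_prod_type]
    simp only [hx1, ← mul_sum, ← sum_mul, σ.hkx1.2, mul_one]
  have hv13 : ∀ s0 s1 s2 u v1 v2 v13, ∑ r, σ.P (s0, s1, s2, u, v1, v2, v13, r) =
      σ.q0 s0 * σ.q1 s1 s0 * σ.q2 s2 s0 *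
      σ.k0 u s0 * σ.k1 v1 (s0, s1, u) * σ.k2 v2 (s0, s2, u) *
      σ.k13 v13 (u, v1, s0, s1) := by
    intro s0 s1 s2 u v1 v2 v13
    rw [Fintype.sum_prod_type]
    simp only [hv23, ← mul_sum, σ.hk23.2, mul_one]
  have hv2 : ∀ s0 s1 s2 u v1 v2, ∑ r, σ.P (s0, s1, s2, u, v1, v2, r) =
      σ.q0 s0 * σ.q1 s1 s0 * σ.q2 s2 s0 *
      σ.k0 u s0 * σ.k1 v1 (s0, s1, u) * σ.k2 v2 (s0, s2, u) := by
    intro s0 s1 s2 u v1 v2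
    rw [Fintype.sum_prod_type]
    simp only [hv13, ← mul_sum, σ.hk13.2, mul_one]
  have hv1 : ∀ s0 s1 s2 u v1, ∑ r, σ.P (s0, s1, s2, u, v1, r) =
      σ.q0 s0 * σ.q1 s1 s0 * σ.q2 s2 s0 *
      σ.k0 u s0 * σ.k1 v1 (s0, s1, u) := by
    intro s0 s1 s2 u v1
    rw [Fintype.sum_prod_type]
    simp only [hv2, ← mul_sum, σ.hk2.2, mul_one]
  have hu : ∀ s0 s1 s2 u, ∑ r, σ.P (s0, s1, s2, u, r) =
      σ.q0 s0 * σ.q1 s1 s0 * σ.q2 s2 s0 *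
      σ.k0 u s0 := by
    intro s0 s1 s2 u
    rw [Fintype.sum_prod_type]
    simp only [hv1, ← mul_sum, σ.hk1.2, mul_one]
  have hs2 : ∀ s0 s1 s2, ∑ r, σ.P (s0, s1, s2, r) =
      σ.q0 s0 * σ.q1 s1 s0 * σ.q2 s2 s0 := by
    intro s0 s1 s2
    rw [Fintype.sum_prod_type]
    simp only [hu, ← mul_sum, σ.hk0.2, mul_one]
  have hs0 : ∀ s0, ∑ r, σ.P (s0, r) = σ.q0 s0 := by
    intro s0
    rw [Fintype.sum_prod_type]
    simp_rw [Fintype.sum_prod_type (f := fun r => σ.P (s0, _, r)), hs2, ← mul_sum, σ.hq2.2,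
      mul_one, ← mul_sum, σ.hq1.2, mul_one]
  rw [Fintype.sum_prod_type]
  simp_rw [hs0, σ.hq0.2]

/-- The kernels of the auxiliary letters, as functions of the tuple. -/
def Sys.kern (σ : Sys S0 S1 S2 U V1 V2 V13 V23 X1 X2 Y1 Y2 Y3) (j : Fin 5)
    (z : S0 × S1 × S2 × U × V1 × V2 × V13 × V23 × X1 × X2 × Y1 × Y2 × Y3) : ℝ :=
  match z with
  | (s0, s1, s2, u, v1, v2, v13, v23, _) =>
    match j with
    | 0 => σ.k0 u s0
    | 1 => σ.k1 v1 (s0, s1, u)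
    | 2 => σ.k2 v2 (s0, s2, u)
    | 3 => σ.k13 v13 (u, v1, s0, s1)
    | 4 => σ.k23 v23 (u, v2, s0, s2)

lemma Sys.kern_pos (σ : Sys S0 S1 S2 U V1 V2 V13 V23 X1 X2 Y1 Y2 Y3) (j : Fin 5)
    {z : S0 × S1 × S2 × U × V1 × V2 × V13 × V23 × X1 × X2 × Y1 × Y2 × Y3} (hz : 0 < σ.P z) :
    0 < σ.kern j z := by
  obtain ⟨s0, s1, s2, u, v1, v2, v13, v23, x1, x2, y1, y2, y3⟩ := z
  have hne : σ.kern j (s0, s1, s2, u, v1, v2, v13, v23, x1, x2, y1, y2, y3) ≠ 0 := by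
    intro h
    refine hz.ne' ?_
    fin_cases j <;> simp only [Sys.kern] at h <;> simp [Sys.P, h]
  refine lt_of_le_of_ne ?_ hne.symm
  fin_cases j
  exacts [σ.hk0.1 _ _, σ.hk1.1 _ _, σ.hk2.1 _ _, σ.hk13.1 _ _, σ.hk23.1 _ _]

/-- The mean log-likelihood of the kernels. -/
def Sys.kent (σ : Sys S0 S1 S2 U V1 V2 V13 V23 X1 X2 Y1 Y2 Y3) (j : Fin 5) : ℝ :=
  ∑ z, σ.P z * -Real.logb 2 (σ.kern j z)

/-- The conditions on the rates under which a single long block can be decoded. -/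
structure Rates (σ : Sys S0 S1 S2 U V1 V2 V13 V23 X1 X2 Y1 Y2 Y3) (R12 R13 R21 R23 : ℝ) :
    Prop where
  enc1 : R21 + condEnt σ.P (fun (_, _, _, _, _, v2, _, _, _, _, _, _, _) => v2)
    (fun (s0, s1, _, u, _, _, _, _, x1, _, y1, _, _) => (u, s0, s1, x1, y1)) < σ.kent 2
  enc2 : R12 + condEnt σ.P (fun (_, _, _, _, v1, _, _, _, _, _, _, _, _) => v1)
    (fun (s0, _, s2, u, _, _, _, _, _, x2, _, y2, _) => (u, s0, s2, x2, y2)) < σ.kent 1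
  nc : R23 + condEnt σ.P (fun (_, _, _, _, _, _, _, v23, _, _, _, _, _) => v23)
    (fun (_, _, _, u, v1, v2, v13, _, _, _, _, _, y3) => (u, v1, v2, v13, y3)) < σ.kent 4
  nb : R23 + condEnt σ.P (fun (_, _, _, _, _, v2, _, v23, _, _, _, _, _) => (v2, v23))
    (fun (_, _, _, u, v1, _, v13, _, _, _, _, _, y3) => (u, v1, v13, y3)) <
    σ.kent 2 + σ.kent 4
  cn : R13 + condEnt σ.P (fun (_, _, _, _, _, _, v13, _, _, _, _, _, _) => v13)
    (fun (_, _, _, u, v1, v2, _, v23, _, _, _, _, y3) => (u, v1, v2, v23, y3)) < σ.kent 3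
  bn : R13 + condEnt σ.P (fun (_, _, _, _, v1, _, v13, _, _, _, _, _, _) => (v1, v13))
    (fun (_, _, _, u, _, v2, _, v23, _, _, _, _, y3) => (u, v2, v23, y3)) <
    σ.kent 1 + σ.kent 3
  cc : R13 + R23 + condEnt σ.P (fun (_, _, _, _, _, _, v13, v23, _, _, _, _, _) => (v13, v23))
    (fun (_, _, _, u, v1, v2, _, _, _, _, _, _, y3) => (u, v1, v2, y3)) <
    σ.kent 3 + σ.kent 4
  cb : R13 + R23 + condEnt σ.P
    (fun (_, _, _, _, _, v2, v13, v23, _, _, _, _, _) => ((v13, v2), v23))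
    (fun (_, _, _, u, v1, _, _, _, _, _, _, _, y3) => (u, v1, y3)) <
    σ.kent 3 + (σ.kent 2 + σ.kent 4)
  bc : R13 + R23 + condEnt σ.P
    (fun (_, _, _, _, v1, _, v13, v23, _, _, _, _, _) => ((v1, v13), v23))
    (fun (_, _, _, u, _, v2, _, _, _, _, _, _, y3) => (u, v2, y3)) <
    σ.kent 1 + σ.kent 3 + σ.kent 4
  bb : R13 + R23 + condEnt σ.P
    (fun (_, _, _, _, v1, v2, v13, v23, _, _, _, _, _) => (((v1, v13), v2), v23))
    (fun (_, _, _, u, _, _, _, _, _, _, _, _, y3) => (u, y3)) <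
    σ.kent 1 + σ.kent 3 + (σ.kent 2 + σ.kent 4)
  all : R12 + R13 + R21 + R23 + condEnt σ.P
    (fun (_, _, _, u, v1, v2, v13, v23, _, _, _, _, _) => ((((u, v1), v2), v13), v23))
    (fun (_, _, _, _, _, _, _, _, _, _, _, _, y3) => y3) <
    σ.kent 0 + σ.kent 1 + σ.kent 2 + σ.kent 3 + σ.kent 4

end LongBlock

section LongBlock

variable {S0 S1 S2 U V1 V2 V13 V23 X1 X2 Y1 Y2 Y3 : Type*}
  [Fintype S0] [Fintype S1] [Fintype S2] [Fintype U] [Fintype V1] [Fintype V2]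
  [Fintype V13] [Fintype V23] [Fintype X1] [Fintype X2]
  [Fintype Y1] [Fintype Y2] [Fintype Y3]

/-- The log-likelihoods that have to be close to their means. -/
def Sys.logs (σ : Sys S0 S1 S2 U V1 V2 V13 V23 X1 X2 Y1 Y2 Y3) :
    Fin 5 ⊕ Fin 11 → S0 × S1 × S2 × U × V1 × V2 × V13 × V23 × X1 × X2 × Y1 × Y2 × Y3 → ℝ :=
  Sum.elim (fun j z => -Real.logb 2 (σ.kern j z)) ![
    condLog σ.P (fun (_, _, _, _, _, v2, _, _, _, _, _, _, _) => v2)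
      (fun (s0, s1, _, u, _, _, _, _, x1, _, y1, _, _) => (u, s0, s1, x1, y1)),
    condLog σ.P (fun (_, _, _, _, v1, _, _, _, _, _, _, _, _) => v1)
      (fun (s0, _, s2, u, _, _, _, _, _, x2, _, y2, _) => (u, s0, s2, x2, y2)),
    condLog σ.P (fun (_, _, _, _, _, _, _, v23, _, _, _, _, _) => v23)
      (fun (_, _, _, u, v1, v2, v13, _, _, _, _, _, y3) => (u, v1, v2, v13, y3)),
    condLog σ.P (fun (_, _, _, _, _, v2, _, v23, _, _, _, _, _) => (v2, v23))
      (fun (_, _, _, u, v1, _, v13, _, _, _, _, _, y3) => (u, v1, v13, y3)),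
    condLog σ.P (fun (_, _, _, _, _, _, v13, _, _, _, _, _, _) => v13)
      (fun (_, _, _, u, v1, v2, _, v23, _, _, _, _, y3) => (u, v1, v2, v23, y3)),
    condLog σ.P (fun (_, _, _, _, v1, _, v13, _, _, _, _, _, _) => (v1, v13))
      (fun (_, _, _, u, _, v2, _, v23, _, _, _, _, y3) => (u, v2, v23, y3)),
    condLog σ.P (fun (_, _, _, _, _, _, v13, v23, _, _, _, _, _) => (v13, v23))
      (fun (_, _, _, u, v1, v2, _, _, _, _, _, _, y3) => (u, v1, v2, y3)),
    condLog σ.P (fun (_, _, _, _, _, v2, v13, v23, _, _, _, _, _) => ((v13, v2), v23))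
      (fun (_, _, _, u, v1, _, _, _, _, _, _, _, y3) => (u, v1, y3)),
    condLog σ.P (fun (_, _, _, _, v1, _, v13, v23, _, _, _, _, _) => ((v1, v13), v23))
      (fun (_, _, _, u, _, v2, _, _, _, _, _, _, y3) => (u, v2, y3)),
    condLog σ.P (fun (_, _, _, _, v1, v2, v13, v23, _, _, _, _, _) => (((v1, v13), v2), v23))
      (fun (_, _, _, u, _, _, _, _, _, _, _, _, y3) => (u, y3)),
    condLog σ.P
      (fun (_, _, _, u, v1, v2, v13, v23, _, _, _, _, _) => ((((u, v1), v2), v13), v23))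
      (fun (_, _, _, _, _, _, _, _, _, _, _, _, y3) => y3)]

/-- The test of encoder 1. -/
def Sys.test1 (σ : Sys S0 S1 S2 U V1 V2 V13 V23 X1 X2 Y1 Y2 Y3) (δ : ℝ) {n : ℕ}
    (v2 : Fin n → V2) (u : Fin n → U) (s0 : Fin n → S0) (s1 : Fin n → S1) (x1 : Fin n → X1)
    (y1 : Fin n → Y1) : Prop :=
  Test σ.P (fun (_, _, _, _, _, v2, _, _, _, _, _, _, _) => v2)
    (fun (s0, s1, _, u, _, _, _, _, x1, _, y1, _, _) => (u, s0, s1, x1, y1)) δ v2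
    (fun i => (u i, s0 i, s1 i, x1 i, y1 i))

/-- The test of encoder 2. -/
def Sys.test2 (σ : Sys S0 S1 S2 U V1 V2 V13 V23 X1 X2 Y1 Y2 Y3) (δ : ℝ) {n : ℕ}
    (v1 : Fin n → V1) (u : Fin n → U) (s0 : Fin n → S0) (s2 : Fin n → S2) (x2 : Fin n → X2)
    (y2 : Fin n → Y2) : Prop :=
  Test σ.P (fun (_, _, _, _, v1, _, _, _, _, _, _, _, _) => v1)
    (fun (s0, _, s2, u, _, _, _, _, _, x2, _, y2, _) => (u, s0, s2, x2, y2)) δ v1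
    (fun i => (u i, s0 i, s2 i, x2 i, y2 i))

/-- The test of the receiver. -/
structure Sys.Test3 (σ : Sys S0 S1 S2 U V1 V2 V13 V23 X1 X2 Y1 Y2 Y3) (δ : ℝ) {n : ℕ}
    (u : Fin n → U) (v1 : Fin n → V1) (v2 : Fin n → V2) (v13 : Fin n → V13)
    (v23 : Fin n → V23) (y3 : Fin n → Y3) : Prop where
  nc : Test σ.P (fun (_, _, _, _, _, _, _, v23, _, _, _, _, _) => v23)
    (fun (_, _, _, u, v1, v2, v13, _, _, _, _, _, y3) => (u, v1, v2, v13, y3)) δ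
    v23 (fun i => (u i, v1 i, v2 i, v13 i, y3 i))
  nb : Test σ.P (fun (_, _, _, _, _, v2, _, v23, _, _, _, _, _) => (v2, v23))
    (fun (_, _, _, u, v1, _, v13, _, _, _, _, _, y3) => (u, v1, v13, y3)) δ
    (fun i => (v2 i, v23 i)) (fun i => (u i, v1 i, v13 i, y3 i))
  cn : Test σ.P (fun (_, _, _, _, _, _, v13, _, _, _, _, _, _) => v13)
    (fun (_, _, _, u, v1, v2, _, v23, _, _, _, _, y3) => (u, v1, v2, v23, y3)) δ
    v13 (fun i => (u i, v1 i, v2 i, v23 i, y3 i))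
  bn : Test σ.P (fun (_, _, _, _, v1, _, v13, _, _, _, _, _, _) => (v1, v13))
    (fun (_, _, _, u, _, v2, _, v23, _, _, _, _, y3) => (u, v2, v23, y3)) δ
    (fun i => (v1 i, v13 i)) (fun i => (u i, v2 i, v23 i, y3 i))
  cc : Test σ.P (fun (_, _, _, _, _, _, v13, v23, _, _, _, _, _) => (v13, v23))
    (fun (_, _, _, u, v1, v2, _, _, _, _, _, _, y3) => (u, v1, v2, y3)) δ
    (fun i => (v13 i, v23 i)) (fun i => (u i, v1 i, v2 i, y3 i))
  cb : Test σ.P (fun (_, _, _, _, _, v2, v13, v23, _, _, _, _, _) => ((v13, v2), v23))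
    (fun (_, _, _, u, v1, _, _, _, _, _, _, _, y3) => (u, v1, y3)) δ
    (fun i => ((v13 i, v2 i), v23 i)) (fun i => (u i, v1 i, y3 i))
  bc : Test σ.P (fun (_, _, _, _, v1, _, v13, v23, _, _, _, _, _) => ((v1, v13), v23))
    (fun (_, _, _, u, _, v2, _, _, _, _, _, _, y3) => (u, v2, y3)) δ
    (fun i => ((v1 i, v13 i), v23 i)) (fun i => (u i, v2 i, y3 i))
  bb : Test σ.P (fun (_, _, _, _, v1, v2, v13, v23, _, _, _, _, _) => (((v1, v13), v2), v23))
    (fun (_, _, _, u, _, _, _, _, _, _, _, _, y3) => (u, y3)) δ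
    (fun i => (((v1 i, v13 i), v2 i), v23 i)) (fun i => (u i, y3 i))
  all : Test σ.P
    (fun (_, _, _, u, v1, v2, v13, v23, _, _, _, _, _) => ((((u, v1), v2), v13), v23))
    (fun (_, _, _, _, _, _, _, _, _, _, _, _, y3) => y3) δ
    (fun i => ((((u i, v1 i), v2 i), v13 i), v23 i)) y3

lemma good_of_typ (σ : Sys S0 S1 S2 U V1 V2 V13 V23 X1 X2 Y1 Y2 Y3) {δ : ℝ} {n : ℕ}
    {z : Fin n → S0 × S1 × S2 × U × V1 × V2 × V13 × V23 × X1 × X2 × Y1 × Y2 × Y3}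
    (hz : Typ σ.P σ.logs δ z) :
    Good (σ.pow n) (fun j => 2 ^ (-(n * (σ.kent j - δ)))) (σ.test1 δ) (σ.test2 δ) (σ.Test3 δ)
      (unzip S0 S1 S2 U V1 V2 V13 V23 X1 X2 Y1 Y2 Y3 n z) := by
  have hk : ∀ j, ∏ i, σ.kern j (z i) ≤ 2 ^ (-(n * (σ.kent j - δ))) := fun j =>
    prod_le_of_le (fun i => σ.kern_pos j (hz.1 i)) (hz.2 (.inl j))
  have ht := fun j : Fin 11 => hz.2 (.inr j)
  refine ⟨⟨hk 0, hk 1, hk 2, hk 3, hk 4⟩, ?_, ?_, ?_⟩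
  · exact test_of_le σ.P_nonneg _ _ hz.1 (ht 0)
  · exact test_of_le σ.P_nonneg _ _ hz.1 (ht 1)
  · exact
    { nc := test_of_le σ.P_nonneg _ _ hz.1 (ht 2)
      nb := test_of_le σ.P_nonneg _ _ hz.1 (ht 3)
      cn := test_of_le σ.P_nonneg _ _ hz.1 (ht 4)
      bn := test_of_le σ.P_nonneg _ _ hz.1 (ht 5)
      cc := test_of_le σ.P_nonneg _ _ hz.1 (ht 6)
      cb := test_of_le σ.P_nonneg _ _ hz.1 (ht 7)
      bc := test_of_le σ.P_nonneg _ _ hz.1 (ht 8)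
      bb := test_of_le σ.P_nonneg _ _ hz.1 (ht 9)
      all := test_of_le σ.P_nonneg _ _ hz.1 (ht 10) }

lemma mul_le_two_rpow {a b x y : ℝ} (hb : 0 ≤ b) (ha : a ≤ 2 ^ x) (hb' : b ≤ 2 ^ y) :
    a * b ≤ 2 ^ (x + y) := by
  rw [Real.rpow_add two_pos]
  exact mul_le_mul ha hb' hb (by positivity)

lemma mul_le_two_rpow_of_left {a b x y : ℝ} (ha0 : 0 ≤ a) (ha : a ≤ 2 ^ x) (hb : b ≤ 2 ^ y) :
    a * b ≤ 2 ^ (x + y) := by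
  rw [Real.rpow_add two_pos]
  exact (mul_le_mul_of_nonneg_left hb ha0).trans
    (mul_le_mul_of_nonneg_right ha (by positivity))

lemma Rates.exists_slack {σ : Sys S0 S1 S2 U V1 V2 V13 V23 X1 X2 Y1 Y2 Y3}
    {R12 R13 R21 R23 : ℝ} (h : Rates σ R12 R13 R21 R23) :
    ∃ δ > 0, Rates σ (R12 + δ) (R13 + δ) (R21 + δ) (R23 + δ) := by
  have key : ∀ {a b : ℝ}, a < b → ∀ᶠ δ in nhdsWithin (0 : ℝ) (Set.Ioi 0), a + 4 * δ < b := by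
    intro a b hab
    have : Filter.Tendsto (fun δ : ℝ => a + 4 * δ) (nhds 0) (nhds (a + 4 * 0)) :=
      (Continuous.tendsto (by fun_prop) 0)
    rw [mul_zero, add_zero] at this
    exact (this.mono_left nhdsWithin_le_nhds).eventually (eventually_lt_nhds hab)
  obtain ⟨δ, ⟨h1, h2, h3, h4, h5, h6, h7, h8, h9, h10, h11⟩, hδ⟩ :=
    ((((key h.enc1).and ((key h.enc2).and ((key h.nc).and ((key h.nb).and ((key h.cn).and
      ((key h.bn).and ((key h.cc).and ((key h.cb).and ((key h.bc).and ((key h.bb).and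
      (key h.all))))))))))).and self_mem_nhdsWithin).exists)
  have hδ : 0 < δ := hδ
  exact ⟨δ, hδ, by linarith, by linarith, by linarith, by linarith, by linarith, by linarith,
    by linarith, by linarith, by linarith, by linarith, by linarith⟩

lemma two_rpow_bound {n : ℕ} {δ H h r r' k m x : ℝ} (hδ : 0 ≤ δ) (hr : r' + H < h)
    (hr' : r + 12 * δ ≤ r') (hx : x = n * (r + H - h + (m + 1) * δ) + k) (hm : m ≤ 10)
    (hk : k ≤ 4) : (2 : ℝ) ^ x ≤ 2 ^ (4 - n * δ) := by
  refine Real.rpow_le_rpow_of_exponent_le one_le_two ?_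
  have hn : (0 : ℝ) ≤ n := n.cast_nonneg
  have h1 : r + H - h + (m + 1) * δ ≤ -δ := by nlinarith
  have := mul_le_mul_of_nonneg_left h1 hn
  rw [hx]
  linarith

end LongBlock

section LongBlock

variable {S0 S1 S2 U V1 V2 V13 V23 X1 X2 Y1 Y2 Y3 : Type*}
  [Fintype S0] [Fintype S1] [Fintype S2] [Fintype U] [Fintype V1] [Fintype V2]
  [Fintype V13] [Fintype V23] [Fintype X1] [Fintype X2]
  [Fintype Y1] [Fintype Y2] [Fintype Y3]

lemma sum_ind_le_of_imp {T A B : Type*} [Fintype T] [Fintype A] [Fintype B] {p : T → ℝ}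
    (hp : ∀ t, 0 ≤ p t) {f : T → A} {g : T → B} {δ : ℝ} {n : ℕ} {b : Fin n → B}
    {Q : (Fin n → A) → Prop} (h : ∀ a, Q a → Test p f g δ a b) :
    ∑ a, ind (Q a) ≤ 2 ^ (n * (condEnt p f g + δ)) :=
  (sum_le_sum fun a _ => ind_mono (h a)).trans (sum_ind_test_le hp f g δ b)

lemma Sys.Test3.count_all (σ : Sys S0 S1 S2 U V1 V2 V13 V23 X1 X2 Y1 Y2 Y3) (δ : ℝ) {n : ℕ}
    (y3 : Fin n → Y3) :
    ∑ u, ∑ v1, ∑ v2, ∑ v13, ∑ v23, ind (σ.Test3 δ u v1 v2 v13 v23 y3) ≤ 2 ^ (n * (condEnt σ.P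
      (fun (_, _, _, u, v1, v2, v13, v23, _, _, _, _, _) => ((((u, v1), v2), v13), v23))
      (fun (_, _, _, _, _, _, _, _, _, _, _, _, y3) => y3) + δ)) := by
  rw [sum_zip, sum_zip, sum_zip, sum_zip]
  exact sum_ind_le_of_imp (b := y3) σ.P_nonneg fun _ h => h.all

lemma Sys.Test3.count_nc (σ : Sys S0 S1 S2 U V1 V2 V13 V23 X1 X2 Y1 Y2 Y3) (δ : ℝ) {n : ℕ}
    (u : Fin n → U) (v1 : Fin n → V1) (v2 : Fin n → V2) (v13 : Fin n → V13) (y3 : Fin n → Y3) :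
    ∑ v23, ind (σ.Test3 δ u v1 v2 v13 v23 y3) ≤ 2 ^ (n * (condEnt σ.P
      (fun (_, _, _, _, _, _, _, v23, _, _, _, _, _) => v23)
      (fun (_, _, _, u, v1, v2, v13, _, _, _, _, _, y3) => (u, v1, v2, v13, y3)) + δ)) := by
  exact sum_ind_le_of_imp (b := fun i => (u i, v1 i, v2 i, v13 i, y3 i)) σ.P_nonneg fun _ h => h.nc

lemma Sys.Test3.count_nb (σ : Sys S0 S1 S2 U V1 V2 V13 V23 X1 X2 Y1 Y2 Y3) (δ : ℝ) {n : ℕ}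
    (u : Fin n → U) (v1 : Fin n → V1) (v13 : Fin n → V13) (y3 : Fin n → Y3) :
    ∑ v2, ∑ v23, ind (σ.Test3 δ u v1 v2 v13 v23 y3) ≤ 2 ^ (n * (condEnt σ.P
      (fun (_, _, _, _, _, v2, _, v23, _, _, _, _, _) => (v2, v23))
      (fun (_, _, _, u, v1, _, v13, _, _, _, _, _, y3) => (u, v1, v13, y3)) + δ)) := by
  rw [sum_zip]
  exact sum_ind_le_of_imp (b := fun i => (u i, v1 i, v13 i, y3 i)) σ.P_nonneg fun _ h => h.nb

lemma Sys.Test3.count_cn (σ : Sys S0 S1 S2 U V1 V2 V13 V23 X1 X2 Y1 Y2 Y3) (δ : ℝ) {n : ℕ}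
    (u : Fin n → U) (v1 : Fin n → V1) (v2 : Fin n → V2) (v23 : Fin n → V23) (y3 : Fin n → Y3) :
    ∑ v13, ind (σ.Test3 δ u v1 v2 v13 v23 y3) ≤ 2 ^ (n * (condEnt σ.P
      (fun (_, _, _, _, _, _, v13, _, _, _, _, _, _) => v13)
      (fun (_, _, _, u, v1, v2, _, v23, _, _, _, _, y3) => (u, v1, v2, v23, y3)) + δ)) := by
  exact sum_ind_le_of_imp (b := fun i => (u i, v1 i, v2 i, v23 i, y3 i)) σ.P_nonneg fun _ h => h.cn

lemma Sys.Test3.count_bn (σ : Sys S0 S1 S2 U V1 V2 V13 V23 X1 X2 Y1 Y2 Y3) (δ : ℝ) {n : ℕ}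
    (u : Fin n → U) (v2 : Fin n → V2) (v23 : Fin n → V23) (y3 : Fin n → Y3) :
    ∑ v1, ∑ v13, ind (σ.Test3 δ u v1 v2 v13 v23 y3) ≤ 2 ^ (n * (condEnt σ.P
      (fun (_, _, _, _, v1, _, v13, _, _, _, _, _, _) => (v1, v13))
      (fun (_, _, _, u, _, v2, _, v23, _, _, _, _, y3) => (u, v2, v23, y3)) + δ)) := by
  rw [sum_zip]
  exact sum_ind_le_of_imp (b := fun i => (u i, v2 i, v23 i, y3 i)) σ.P_nonneg fun _ h => h.bn

lemma Sys.Test3.count_cc (σ : Sys S0 S1 S2 U V1 V2 V13 V23 X1 X2 Y1 Y2 Y3) (δ : ℝ) {n : ℕ}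
    (u : Fin n → U) (v1 : Fin n → V1) (v2 : Fin n → V2) (y3 : Fin n → Y3) :
    ∑ v13, ∑ v23, ind (σ.Test3 δ u v1 v2 v13 v23 y3) ≤ 2 ^ (n * (condEnt σ.P
      (fun (_, _, _, _, _, _, v13, v23, _, _, _, _, _) => (v13, v23))
      (fun (_, _, _, u, v1, v2, _, _, _, _, _, _, y3) => (u, v1, v2, y3)) + δ)) := by
  rw [sum_zip]
  exact sum_ind_le_of_imp (b := fun i => (u i, v1 i, v2 i, y3 i)) σ.P_nonneg fun _ h => h.cc

lemma Sys.Test3.count_cb (σ : Sys S0 S1 S2 U V1 V2 V13 V23 X1 X2 Y1 Y2 Y3) (δ : ℝ) {n : ℕ}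
    (u : Fin n → U) (v1 : Fin n → V1) (y3 : Fin n → Y3) :
    ∑ v13, ∑ v2, ∑ v23, ind (σ.Test3 δ u v1 v2 v13 v23 y3) ≤ 2 ^ (n * (condEnt σ.P
      (fun (_, _, _, _, _, v2, v13, v23, _, _, _, _, _) => ((v13, v2), v23))
      (fun (_, _, _, u, v1, _, _, _, _, _, _, _, y3) => (u, v1, y3)) + δ)) := by
  rw [sum_zip, sum_zip]
  exact sum_ind_le_of_imp (b := fun i => (u i, v1 i, y3 i)) σ.P_nonneg fun _ h => h.cb

lemma Sys.Test3.count_bc (σ : Sys S0 S1 S2 U V1 V2 V13 V23 X1 X2 Y1 Y2 Y3) (δ : ℝ) {n : ℕ}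
    (u : Fin n → U) (v2 : Fin n → V2) (y3 : Fin n → Y3) :
    ∑ v1, ∑ v13, ∑ v23, ind (σ.Test3 δ u v1 v2 v13 v23 y3) ≤ 2 ^ (n * (condEnt σ.P
      (fun (_, _, _, _, v1, _, v13, v23, _, _, _, _, _) => ((v1, v13), v23))
      (fun (_, _, _, u, _, v2, _, _, _, _, _, _, y3) => (u, v2, y3)) + δ)) := by
  rw [sum_zip, sum_zip]
  exact sum_ind_le_of_imp (b := fun i => (u i, v2 i, y3 i)) σ.P_nonneg fun _ h => h.bc

lemma Sys.Test3.count_bb (σ : Sys S0 S1 S2 U V1 V2 V13 V23 X1 X2 Y1 Y2 Y3) (δ : ℝ) {n : ℕ}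
    (u : Fin n → U) (y3 : Fin n → Y3) :
    ∑ v1, ∑ v13, ∑ v2, ∑ v23, ind (σ.Test3 δ u v1 v2 v13 v23 y3) ≤ 2 ^ (n * (condEnt σ.P
      (fun (_, _, _, _, v1, v2, v13, v23, _, _, _, _, _) => (((v1, v13), v2), v23))
      (fun (_, _, _, u, _, _, _, _, _, _, _, _, y3) => (u, y3)) + δ)) := by
  rw [sum_zip, sum_zip, sum_zip]
  exact sum_ind_le_of_imp (b := fun i => (u i, y3 i)) σ.P_nonneg fun _ h => h.bb

lemma Rates.sparse3 {σ : Sys S0 S1 S2 U V1 V2 V13 V23 X1 X2 Y1 Y2 Y3}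
    {R12 R13 R21 R23 δ : ℝ} (hδ : 0 < δ)
    (h : Rates σ (R12 + 12 * δ) (R13 + 12 * δ) (R21 + 12 * δ) (R23 + 12 * δ)) {n : ℕ}
    {θ : Fin 5 → ℝ} (hθ0 : ∀ j, 0 < θ j) (hθ : ∀ j, θ j ≤ 2 ^ (-(n * (σ.kent j - 2 * δ))))
    {cM cD1 cD2 : ℝ} (hM : 0 ≤ cM) (hD1 : 0 ≤ cD1) (hD2 : 0 ≤ cD2)
    (hM' : cM ≤ 2 ^ (n * (R12 + R21) + 2)) (hD1' : cD1 ≤ 2 ^ (n * R13 + 1))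
    (hD2' : cD2 ≤ 2 ^ (n * R23 + 1)) :
    Sparse3 θ cM cD1 cD2 (2 ^ (4 - n * δ)) (σ.Test3 δ (n := n)) := by
  have hθ' := fun j => (hθ0 j).le
  have h0 := hθ' 0
  have h1 := hθ' 1
  have h2 := hθ' 2
  have h3 := hθ' 3
  have h4 := hθ' 4
  constructor
  · intro y3
    refine (mul_le_two_rpow_of_left (by positivity) (mul_le_two_rpow (by positivity)
      (mul_le_two_rpow hD2 (mul_le_two_rpow hD1 hM' hD1') hD2')
      (mul_le_two_rpow (hθ' 4) (mul_le_two_rpow (hθ' 3) (mul_le_two_rpow (hθ' 2)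
        (mul_le_two_rpow (hθ' 1) (hθ 0) (hθ 1)) (hθ 2)) (hθ 3)) (hθ 4)))
      (Sys.Test3.count_all σ δ y3)).trans
      (two_rpow_bound (r := R12 + R21 + R13 + R23) (k := 4) (m := 10) hδ.le h.all (by linarith)
        (by ring)
        (by norm_num) (by norm_num))
  · intro u v1 v2 v13 y3
    refine (mul_le_two_rpow_of_left (by positivity) (mul_le_two_rpow (hθ' 4) hD2' (hθ 4)) 
      (Sys.Test3.count_nc σ δ u v1 v2 v13 y3)).trans
      (two_rpow_bound (r := R23) (k := 1) (m := 2) hδ.le h.nc (by linarith) (by ring)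
        (by norm_num) (by norm_num))
  · intro u v1 v13 y3
    refine (mul_le_two_rpow_of_left (by positivity) (mul_le_two_rpow (by positivity) hD2'
      (mul_le_two_rpow (hθ' 4) (hθ 2) (hθ 4)))
      (Sys.Test3.count_nb σ δ u v1 v13 y3)).trans
      (two_rpow_bound (r := R23) (k := 1) (m := 4) hδ.le h.nb (by linarith) (by ring)
        (by norm_num) (by norm_num))
  · intro u v1 v2 v23 y3
    refine (mul_le_two_rpow_of_left (by positivity) (mul_le_two_rpow (hθ' 3) hD1' (hθ 3)) 
      (Sys.Test3.count_cn σ δ u v1 v2 v23 y3)).trans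
      (two_rpow_bound (r := R13) (k := 1) (m := 2) hδ.le h.cn (by linarith) (by ring)
        (by norm_num) (by norm_num))
  · intro u v2 v23 y3
    refine (mul_le_two_rpow_of_left (by positivity) (mul_le_two_rpow (by positivity) hD1'
      (mul_le_two_rpow (hθ' 3) (hθ 1) (hθ 3)))
      (Sys.Test3.count_bn σ δ u v2 v23 y3)).trans
      (two_rpow_bound (r := R13) (k := 1) (m := 4) hδ.le h.bn (by linarith) (by ring)
        (by norm_num) (by norm_num))
  · intro u v1 v2 y3
    refine (mul_le_two_rpow_of_left (by positivity) (mul_le_two_rpow (by positivity)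
      (mul_le_two_rpow hD2 hD1' hD2') (mul_le_two_rpow (hθ' 4) (hθ 3) (hθ 4)))
      (Sys.Test3.count_cc σ δ u v1 v2 y3)).trans
      (two_rpow_bound (r := R13 + R23) (k := 2) (m := 4) hδ.le h.cc (by linarith) (by ring)
        (by norm_num) (by norm_num))
  · intro u v1 y3
    refine (mul_le_two_rpow_of_left (by positivity) (mul_le_two_rpow (by positivity)
      (mul_le_two_rpow hD2 hD1' hD2') (mul_le_two_rpow (by positivity) (hθ 3)
        (mul_le_two_rpow (hθ' 4) (hθ 2) (hθ 4))))
      (Sys.Test3.count_cb σ δ u v1 y3)).trans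
      (two_rpow_bound (r := R13 + R23) (k := 2) (m := 6) hδ.le h.cb (by linarith) (by ring)
        (by norm_num) (by norm_num))
  · intro u v2 y3
    refine (mul_le_two_rpow_of_left (by positivity) (mul_le_two_rpow (by positivity)
      (mul_le_two_rpow hD2 hD1' hD2') (mul_le_two_rpow (hθ' 4)
        (mul_le_two_rpow (hθ' 3) (hθ 1) (hθ 3)) (hθ 4)))
      (Sys.Test3.count_bc σ δ u v2 y3)).trans
      (two_rpow_bound (r := R13 + R23) (k := 2) (m := 6) hδ.le h.bc (by linarith) (by ring)
        (by norm_num) (by norm_num))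
  · intro u y3
    refine (mul_le_two_rpow_of_left (by positivity) (mul_le_two_rpow (by positivity)
      (mul_le_two_rpow hD2 hD1' hD2') (mul_le_two_rpow (by positivity)
        (mul_le_two_rpow (hθ' 3) (hθ 1) (hθ 3)) (mul_le_two_rpow (hθ' 4) (hθ 2) (hθ 4))))
      (Sys.Test3.count_bb σ δ u y3)).trans
      (two_rpow_bound (r := R13 + R23) (k := 2) (m := 8) hδ.le h.bb (by linarith) (by ring)
        (by norm_num) (by norm_num))

lemma tendsto_two_rpow_neg {δ : ℝ} (hδ : 0 < δ) :
    Filter.Tendsto (fun n : ℕ => (2 : ℝ) ^ (-(n * δ))) Filter.atTop (nhds 0) := by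
  have : (fun n : ℕ => (2 : ℝ) ^ (-(n * δ))) = fun n : ℕ => ((2 : ℝ) ^ (-δ)) ^ n := by
    funext n
    rw [← Real.rpow_natCast, ← Real.rpow_mul zero_le_two]
    ring_nf
  rw [this]
  exact tendsto_pow_atTop_nhds_zero_of_lt_one (by positivity)
    (Real.rpow_lt_one_of_one_lt_of_neg one_lt_two (by linarith))

/-- Existence of a code for a single long block. -/
lemma exists_longBlockCode [Nonempty U] [Nonempty V1] [Nonempty V2] [Nonempty V13]
    [Nonempty V23] [Nonempty X1] [Nonempty X2]
    (σ : Sys S0 S1 S2 U V1 V2 V13 V23 X1 X2 Y1 Y2 Y3) {R12 R13 R21 R23 : ℝ}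
    (hR : Rates σ R12 R13 R21 R23) {ε : ℝ} (hε : 0 < ε) (hε1 : ε ≤ 1) :
    ∃ N : ℕ, ∀ n, N ≤ n → ∀ (A1 A2 D1 D2 : Type) [Fintype A1] [Fintype A2] [Fintype D1]
      [Fintype D2] [Nonempty A1] [Nonempty A2] [Nonempty D1] [Nonempty D2],
      (Fintype.card A1 : ℝ) ≤ 2 ^ (n * R12 + 1) → (Fintype.card A2 : ℝ) ≤ 2 ^ (n * R21 + 1) →
      (Fintype.card D1 : ℝ) ≤ 2 ^ (n * R13 + 1) → (Fintype.card D2 : ℝ) ≤ 2 ^ (n * R23 + 1) →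
      ∃ (f1 : A1 × A2 → A1 → D1 → (Fin n → S0) → (Fin n → S1) → Fin n → X1)
        (f2 : A1 × A2 → A2 → D2 → (Fin n → S0) → (Fin n → S2) → Fin n → X2)
        (g1 : A1 × A2 → A1 → D1 → (Fin n → S0) → (Fin n → S1) → (Fin n → Y1) → A2)
        (g2 : A1 × A2 → A2 → D2 → (Fin n → S0) → (Fin n → S2) → (Fin n → Y2) → A1)
        (h : A1 → A2 → (Fin n → Y3) → (A1 × A2) × D1 × D2),
        Fintype.card ((A1 × A2) × A1 × A2 × D1 × D2) * (1 - ε) ≤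
          ∑ c : (A1 × A2) × A1 × A2 × D1 × D2, ∑ s : (Fin n → S0) × (Fin n → S1) × (Fin n → S2),
            ∑ y : (Fin n → Y1) × (Fin n → Y2) × (Fin n → Y3),
            (σ.pow n).q0 s.1 * (σ.pow n).q1 s.2.1 s.1 * (σ.pow n).q2 s.2.2 s.1 *
            (σ.pow n).W y (f1 c.1 c.2.1 c.2.2.2.1 s.1 s.2.1,
              f2 c.1 c.2.2.1 c.2.2.2.2 s.1 s.2.2, s) *
            ind (g1 c.1 c.2.1 c.2.2.2.1 s.1 s.2.1 y.1 = c.2.2.1 ∧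
              g2 c.1 c.2.2.1 c.2.2.2.2 s.1 s.2.2 y.2.1 = c.2.1 ∧
              h c.2.1 c.2.2.1 y.2.2 = (c.1, c.2.2.2)) := by
  obtain ⟨δ', hδ', hR'⟩ := hR.exists_slack
  set δ := δ' / 12 with hδdef
  have hδ : 0 < δ := by positivity
  have hδ12 : δ' = 12 * δ := by rw [hδdef]; ring
  rw [hδ12] at hR'
  obtain ⟨N1, hN1⟩ := exists_forall_le_sum_typ σ.P_nonneg σ.sum_P σ.logs hδ (half_pos hε)
  have hlim : Filter.Tendsto (fun n : ℕ => 5 * ((2 : ℝ) ^ (-(n * δ)) + √((2 : ℝ) ^ (-(n * δ)))) +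
      11 * (2 ^ (4 - n * δ))) Filter.atTop (nhds (5 * (0 + √0) + 11 * (2 ^ (4 : ℝ) * 0))) := by
    have h0 := tendsto_two_rpow_neg hδ
    have h1 := (Real.continuous_sqrt.tendsto 0).comp h0
    have h2 : (fun n : ℕ => (2 : ℝ) ^ (4 - n * δ)) =
        fun n : ℕ => (2 : ℝ) ^ (4 : ℝ) * 2 ^ (-(n * δ)) := by
      funext n
      rw [← Real.rpow_add two_pos]; ring_nf
    have h3 := h0.const_mul ((2 : ℝ) ^ (4 : ℝ))
    rw [← h2] at h3
    exact ((h0.add h1).const_mul 5).add (h3.const_mul 11)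
  simp only [Real.sqrt_zero, add_zero, mul_zero] at hlim
  obtain ⟨N2, hN2⟩ := Filter.eventually_atTop.1
    (hlim.eventually (eventually_lt_nhds (half_pos hε)))
  refine ⟨max N1 N2, fun n hn A1 A2 D1 D2 _ _ _ _ _ _ _ _ hA1 hA2 hD1 hD2 => ?_⟩
  have hT := hN1 n (le_of_max_le_left hn)
  have herr := hN2 n (le_of_max_le_right hn)
  set θ : Fin 5 → ℝ := fun j => min 1 (2 ^ (-(n * (σ.kent j - 2 * δ)))) with hθdef
  have hθ0 : ∀ j, 0 < θ j := fun j => lt_min one_pos (by positivity)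
  have hθ2 : ∀ j, θ j ≤ 2 ^ (-(n * (σ.kent j - 2 * δ))) := fun j => min_le_right _ _
  obtain ⟨f1, f2, g1, g2, h, hh⟩ := exists_blockCode (σ.pow n) (M := A1 × A2) (A1 := A1)
    (A2 := A2) (D1 := D1) (D2 := D2) (θ := θ)
    (μ := fun j => 2 ^ (-(n * (σ.kent j - δ)))) (η := 2 ^ (-(n * δ))) (ε := 2 ^ (4 - n * δ))
    (t1 := σ.test1 δ) (t2 := σ.test2 δ) (t3 := σ.Test3 δ) hθ0 (fun j => min_le_left _ _)
    (fun j => by positivity)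
    (fun j => by
      rcases le_total (1 : ℝ) (2 ^ (-(n * (σ.kent j - 2 * δ)))) with h1 | h1
      · rw [hθdef]
        simp only [min_eq_left h1, inv_one, sub_self, zero_mul]
        positivity
      · rw [hθdef]
        simp only [min_eq_right h1]
        rw [← Real.rpow_neg zero_le_two, neg_neg]
        calc _ ≤ (2 : ℝ) ^ (n * (σ.kent j - 2 * δ)) * 2 ^ (-(n * (σ.kent j - δ))) :=
              mul_le_mul_of_nonneg_right (by linarith) (by positivity)
          _ = 2 ^ (-(n * δ)) := by rw [← Real.rpow_add two_pos]; ring_nf)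
    (fun u s0 s1 x1 y1 =>
      (mul_le_two_rpow_of_left (by positivity) (mul_le_two_rpow (hθ0 2).le hA2 (hθ2 2))
        (sum_ind_test_le σ.P_nonneg _ _ _ _)).trans
      (two_rpow_bound (r := R21) (k := 1) (m := 2) hδ.le hR'.enc1 (by linarith) (by ring)
        (by norm_num) (by norm_num)))
    (fun u s0 s1 x1 y1 =>
      (mul_le_two_rpow_of_left (by positivity) (mul_le_two_rpow (hθ0 1).le hA1 (hθ2 1))
        (sum_ind_test_le σ.P_nonneg _ _ _ _)).trans
      (two_rpow_bound (r := R12) (k := 1) (m := 2) hδ.le hR'.enc2 (by linarith) (by ring)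
        (by norm_num) (by norm_num)))
    (hR'.sparse3 hδ hθ0 hθ2 (Nat.cast_nonneg _) (Nat.cast_nonneg _) (Nat.cast_nonneg _) (by
      rw [Fintype.card_prod, Nat.cast_mul]
      exact (mul_le_two_rpow (Nat.cast_nonneg _) hA1 hA2).trans_eq (by ring_nf)) hD1 hD2)
  refine ⟨f1, f2, g1, g2, h, le_trans (mul_le_mul_of_nonneg_left ?_ (Nat.cast_nonneg _)) hh⟩
  have hG : 1 - ε / 2 ≤ ∑ z, (σ.pow n).P z * ind (Good (σ.pow n)
      (fun j => 2 ^ (-(n * (σ.kent j - δ)))) (σ.test1 δ) (σ.test2 δ) (σ.Test3 δ) z) := by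
    rw [← (unzip S0 S1 S2 U V1 V2 V13 V23 X1 X2 Y1 Y2 Y3 n).sum_comp]
    refine hT.trans (sum_le_sum fun z _ => ?_)
    rw [σ.pow_P]
    exact mul_le_mul_of_nonneg_left (ind_mono (good_of_typ σ))
      (prod_nonneg fun i _ => σ.P_nonneg _)
  nlinarith

end LongBlock

/-! ### From the rate region to the conditions of the long block -/

section CondEnt

variable {T A B C D : Type*} [Fintype T] [Fintype A] [Fintype B] [Fintype C] [Fintype D]

lemma cmi_eq (p : T → ℝ) (f : T → A) (g : T → B) (h : T → C) :
    cmi p f g h = condEnt p f h - condEnt p f (fun t => (g t, h t)) := by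
  simp only [cmi, condEnt]
  ring

lemma condEnt_congr (p : T → ℝ) (f : T → A) {g : T → B} {g' : T → C}
    (h : ∀ t t', g t = g t' ↔ g' t = g' t') : condEnt p f g = condEnt p f g' := by
  rw [condEnt, condEnt, entOf_congr p h, entOf_congr p (f := fun t => (f t, g t))
    (g := fun t => (f t, g' t)) fun t t' => by simp only [Prod.mk.injEq, h t t']]

/-- The chain rule. -/
lemma condEnt_chain (p : T → ℝ) {E : Type*} [Fintype E] {F : T → E} (a : T → A) (b : T → B)
    {g : T → C} {h : T → D} (hF : ∀ t t', F t = F t' ↔ a t = a t' ∧ b t = b t')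
    (hh : ∀ t t', h t = h t' ↔ b t = b t' ∧ g t = g t') :
    condEnt p F g = condEnt p b g + condEnt p a h := by
  rw [condEnt, condEnt, condEnt, entOf_congr p (f := fun t => (F t, g t))
    (g := fun t => (a t, h t)) fun t t' => by simp only [Prod.mk.injEq, hF, hh, and_assoc],
    entOf_congr p (f := h) (g := fun t => (b t, g t)) fun t t' => by
      simp only [Prod.mk.injEq, hh]]
  ring

/-- Conditioning reduces entropy. -/
lemma condEnt_mono {p : T → ℝ} (hp : ∀ t, 0 ≤ p t) (hp1 : ∑ t, p t = 1) (f : T → A)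
    {g : T → B} {g' : T → C} (h : ∀ t t', g' t = g' t' → g t = g t') :
    condEnt p f g' ≤ condEnt p f g := by
  have hT : Nonempty T := by
    by_contra hT
    rw [not_nonempty_iff] at hT
    simp at hp1
  have hB : Nonempty B := hT.map g
  have hφ : ∀ t, Function.extend g' g (fun _ => hB.some) (g' t) = g t := fun t =>
    Function.FactorsThrough.extend_apply (fun t t' ht => h t t' ht) _ _
  set φ := Function.extend g' g (fun _ => hB.some)
  set F := marg p fun t => (f t, g t) with hF
  refine (condEnt_le hp hp1 f g' (k := fun a c => F (a, φ c) / marg p g (φ c))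
    (fun a c => div_nonneg (marg_nonneg hp _ _) (marg_nonneg hp _ _)) (fun c => ?_)
    (fun t ht => ?_)).trans_eq ?_
  · rw [← sum_div, hF, sum_marg_pair]
    exact div_self_le_one _
  · rw [hφ]
    exact div_pos (ht.trans_le (le_marg hp (fun t => (f t, g t)) t)) (ht.trans_le (le_marg hp g t))
  · rw [← neg_neg (condEnt p f g), ← sum_mul_condLog]
    refine congrArg _ (sum_congr rfl fun t _ => ?_)
    rcases (hp t).eq_or_lt with h0 | h0
    · simp [← h0]
    · have h1 := h0.trans_le (le_marg hp (fun t => (f t, g t)) t)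
      have h2 := h0.trans_le (le_marg hp g t)
      simp only [hφ, condLog]
      rw [Real.logb_div h1.ne' h2.ne']

end CondEnt

section Region

variable {S0 S1 S2 U V1 V2 V13 V23 X1 X2 Y1 Y2 Y3 : Type*}
  [Fintype S0] [Fintype S1] [Fintype S2] [Fintype U] [Fintype V1] [Fintype V2]
  [Fintype V13] [Fintype V23] [Fintype X1] [Fintype X2]
  [Fintype Y1] [Fintype Y2] [Fintype Y3]

lemma enc_bound {T : Type*} [Fintype T] {p : T → ℝ} (hp : ∀ t, 0 ≤ p t) (hp1 : ∑ t, p t = 1)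
    {s0 : T → S0} {s1 : T → S1} {s2 : T → S2} {u : T → U} {v1 : T → V1} {x2 : T → X2}
    {y2 : T → Y2} {R h1 : ℝ} (hh1 : condEnt p v1 (fun t => (s0 t, s1 t, u t)) ≤ h1)
    (hR : R < cmi p v1 y2 (fun t => (s0 t, s2 t, u t, x2 t)) -
      cmi p v1 s1 (fun t => (s0 t, u t))) :
    R + condEnt p v1 (fun t => (u t, s0 t, s2 t, x2 t, y2 t)) < h1 := by
  rw [cmi_eq, cmi_eq] at hR
  have e1 := condEnt_congr p v1 (g := fun t => (u t, s0 t, s2 t, x2 t, y2 t))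
    (g' := fun t => (y2 t, s0 t, s2 t, u t, x2 t)) fun t t' => by
      simp only [Prod.mk.injEq]; tauto
  have e2 := condEnt_congr p v1 (g := fun t => (s0 t, s1 t, u t))
    (g' := fun t => (s1 t, s0 t, u t)) fun t t' => by
      simp only [Prod.mk.injEq]; tauto
  have e3 := condEnt_mono hp hp1 v1 (g := fun t => (s0 t, u t))
    (g' := fun t => (s0 t, s2 t, u t, x2 t)) fun t t' => by
      simp only [Prod.mk.injEq]; tauto
  linarith

lemma single_bound {T : Type*} [Fintype T] {p : T → ℝ} (hp : ∀ t, 0 ≤ p t) (hp1 : ∑ t, p t = 1)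
    {s0 : T → S0} {s1 : T → S1} {u : T → U} {v1 : T → V1} {v2 : T → V2}
    {v13 : T → V13} {v23 : T → V23} {y3 : T → Y3} {R h1 h3 : ℝ}
    {C D : Type*} [Fintype C] [Fintype D] {c : T → C} {d : T → D}
    (hh1 : condEnt p v1 (fun t => (s0 t, s1 t, u t)) ≤ h1)
    (hh3 : condEnt p v13 (fun t => (u t, v1 t, s0 t, s1 t)) ≤ h3)
    (hc : ∀ t t', c t = c t' ↔ u t = u t' ∧ v1 t = v1 t' ∧ v2 t = v2 t' ∧ v23 t = v23 t')
    (hd : ∀ t t', d t = d t' ↔ c t = c t' ∧ y3 t = y3 t')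
    (hR : R < cmi p v13 y3 c -
      cmi p v13 (fun t => (s0 t, s1 t)) c +
      min 0 (cmi p v1 y3 (fun t => (u t, v2 t, v23 t)) -
      cmi p v1 (fun t => (s0 t, s1 t)) (fun t => (u t, v2 t, v23 t)))) :
    R + condEnt p v13 d < h3 ∧
    R + condEnt p (fun t => (v1 t, v13 t)) (fun t => (u t, v2 t, v23 t, y3 t)) < h1 + h3 := by
  simp only [cmi_eq] at hR
  have e1 := condEnt_congr p v13 (g := d)
    (g' := fun t => (y3 t, c t)) fun t t' => by
      simp only [Prod.mk.injEq, hd]; tauto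
  have e2 := condEnt_mono hp hp1 v13 (g := fun t => (u t, v1 t, s0 t, s1 t))
    (g' := fun t => ((s0 t, s1 t), c t)) fun t t' => by
      simp only [Prod.mk.injEq, hc]; tauto
  have e3 := condEnt_mono hp hp1 v1 (g := fun t => (s0 t, s1 t, u t))
    (g' := fun t => ((s0 t, s1 t), u t, v2 t, v23 t)) fun t t' => by
      simp only [Prod.mk.injEq]; tauto
  have e4 := condEnt_chain p v13 v1 (F := fun t => (v1 t, v13 t))
    (g := fun t => (u t, v2 t, v23 t, y3 t)) (h := d)
    (fun t t' => by simp only [Prod.mk.injEq]; tauto)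
    (fun t t' => by simp only [Prod.mk.injEq, hd, hc]; tauto)
  have e5 := condEnt_congr p v1 (g := fun t => (u t, v2 t, v23 t, y3 t))
    (g' := fun t => (y3 t, u t, v2 t, v23 t)) fun t t' => by
      simp only [Prod.mk.injEq]; tauto
  constructor
  · have := hR.trans_le (add_le_add_right (min_le_left _ _) _)
    linarith
  · have := hR.trans_le (add_le_add_right (min_le_right _ _) _)
    linarith

lemma pair_bound {T : Type*} [Fintype T] {p : T → ℝ} (hp : ∀ t, 0 ≤ p t) (hp1 : ∑ t, p t = 1)
    {s0 : T → S0} {s1 : T → S1} {s2 : T → S2} {u : T → U} {v1 : T → V1} {v2 : T → V2}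
    {v13 : T → V13} {v23 : T → V23} {y3 : T → Y3} {R h1 h2 h3 h4 : ℝ}
    (hh1 : condEnt p v1 (fun t => (s0 t, s1 t, u t)) ≤ h1)
    (hh2 : condEnt p v2 (fun t => (s0 t, s2 t, u t)) ≤ h2)
    (hh3 : condEnt p v13 (fun t => (u t, v1 t, s0 t, s1 t)) ≤ h3)
    (hh4 : condEnt p v23 (fun t => (u t, v2 t, s0 t, s2 t)) ≤ h4)
    (hR : R < cmi p (fun t => (v13 t, v23 t)) y3 (fun t => (u t, v1 t, v2 t)) -
      cmi p (fun t => (v13 t, v23 t)) (fun t => (s0 t, s1 t, s2 t))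
        (fun t => (u t, v1 t, v2 t)) +
      min 0 (min (cmi p v1 y3 (fun t => (u t, v2 t)) -
          cmi p v1 (fun t => (s0 t, s1 t)) (fun t => (u t, v2 t)))
        (min (cmi p v2 y3 (fun t => (u t, v1 t)) -
          cmi p v2 (fun t => (s0 t, s2 t)) (fun t => (u t, v1 t)))
        (cmi p (fun t => (v1 t, v2 t)) y3 u -
          cmi p (fun t => (v1 t, v2 t)) (fun t => (s0 t, s1 t, s2 t)) u)))) :
    R + condEnt p (fun t => (v13 t, v23 t)) (fun t => (u t, v1 t, v2 t, y3 t)) < h3 + h4 ∧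
    R + condEnt p (fun t => ((v13 t, v2 t), v23 t)) (fun t => (u t, v1 t, y3 t)) <
      h3 + (h2 + h4) ∧
    R + condEnt p (fun t => ((v1 t, v13 t), v23 t)) (fun t => (u t, v2 t, y3 t)) <
      h1 + h3 + h4 ∧
    R + condEnt p (fun t => (((v1 t, v13 t), v2 t), v23 t)) (fun t => (u t, y3 t)) <
      h1 + h3 + (h2 + h4) := by
  simp only [cmi_eq] at hR
  have e1 := condEnt_congr p (fun t => (v13 t, v23 t)) (g := fun t => (u t, v1 t, v2 t, y3 t))
    (g' := fun t => (y3 t, u t, v1 t, v2 t)) fun t t' => by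
      simp only [Prod.mk.injEq]; tauto
  have e2 := condEnt_chain p v13 v23 (F := fun t => (v13 t, v23 t))
    (g := fun t => ((s0 t, s1 t, s2 t), u t, v1 t, v2 t))
    (h := fun t => (v23 t, (s0 t, s1 t, s2 t), u t, v1 t, v2 t))
    (fun t t' => by simp only [Prod.mk.injEq])
    (fun t t' => by simp only [Prod.mk.injEq])
  have e3 := condEnt_mono hp hp1 v13 (g := fun t => (u t, v1 t, s0 t, s1 t))
    (g' := fun t => (v23 t, (s0 t, s1 t, s2 t), u t, v1 t, v2 t)) fun t t' => by
      simp only [Prod.mk.injEq]; tauto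
  have e4 := condEnt_mono hp hp1 v23 (g := fun t => (u t, v2 t, s0 t, s2 t))
    (g' := fun t => ((s0 t, s1 t, s2 t), u t, v1 t, v2 t)) fun t t' => by
      simp only [Prod.mk.injEq]; tauto
  -- the common message of user 1
  have e5 := condEnt_chain p (fun t => (v13 t, v23 t)) v1 (F := fun t => ((v1 t, v13 t), v23 t))
    (g := fun t => (u t, v2 t, y3 t)) (h := fun t => (u t, v1 t, v2 t, y3 t))
    (fun t t' => by simp only [Prod.mk.injEq]; tauto)
    (fun t t' => by simp only [Prod.mk.injEq]; tauto)
  have e6 := condEnt_congr p v1 (g := fun t => (u t, v2 t, y3 t))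
    (g' := fun t => (y3 t, u t, v2 t)) fun t t' => by
      simp only [Prod.mk.injEq]; tauto
  have e7 := condEnt_mono hp hp1 v1 (g := fun t => (s0 t, s1 t, u t))
    (g' := fun t => ((s0 t, s1 t), u t, v2 t)) fun t t' => by
      simp only [Prod.mk.injEq]; tauto
  -- the common message of user 2
  have e8 := condEnt_chain p (fun t => (v13 t, v23 t)) v2 (F := fun t => ((v13 t, v2 t), v23 t))
    (g := fun t => (u t, v1 t, y3 t)) (h := fun t => (u t, v1 t, v2 t, y3 t))
    (fun t t' => by simp only [Prod.mk.injEq]; tauto)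
    (fun t t' => by simp only [Prod.mk.injEq]; tauto)
  have e9 := condEnt_congr p v2 (g := fun t => (u t, v1 t, y3 t))
    (g' := fun t => (y3 t, u t, v1 t)) fun t t' => by
      simp only [Prod.mk.injEq]; tauto
  have e10 := condEnt_mono hp hp1 v2 (g := fun t => (s0 t, s2 t, u t))
    (g' := fun t => ((s0 t, s2 t), u t, v1 t)) fun t t' => by
      simp only [Prod.mk.injEq]; tauto
  -- both common messages
  have e11 := condEnt_chain p (fun t => (v13 t, v23 t)) (fun t => (v1 t, v2 t))
    (F := fun t => (((v1 t, v13 t), v2 t), v23 t))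
    (g := fun t => (u t, y3 t)) (h := fun t => (u t, v1 t, v2 t, y3 t))
    (fun t t' => by simp only [Prod.mk.injEq]; tauto)
    (fun t t' => by simp only [Prod.mk.injEq]; tauto)
  have e12 := condEnt_congr p (fun t => (v1 t, v2 t)) (g := fun t => (u t, y3 t))
    (g' := fun t => (y3 t, u t)) fun t t' => by
      simp only [Prod.mk.injEq]; tauto
  have e13 := condEnt_chain p v1 v2 (F := fun t => (v1 t, v2 t))
    (g := fun t => ((s0 t, s1 t, s2 t), u t)) (h := fun t => (v2 t, (s0 t, s1 t, s2 t), u t))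
    (fun t t' => by simp only [Prod.mk.injEq])
    (fun t t' => by simp only [Prod.mk.injEq])
  have e14 := condEnt_mono hp hp1 v1 (g := fun t => (s0 t, s1 t, u t))
    (g' := fun t => (v2 t, (s0 t, s1 t, s2 t), u t)) fun t t' => by
      simp only [Prod.mk.injEq]; tauto
  have e15 := condEnt_mono hp hp1 v2 (g := fun t => (s0 t, s2 t, u t))
    (g' := fun t => ((s0 t, s1 t, s2 t), u t)) fun t t' => by
      simp only [Prod.mk.injEq]; tauto
  refine ⟨?_, ?_, ?_, ?_⟩
  · have := hR.trans_le (add_le_add_right (min_le_left _ _) _)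
    linarith
  · have := hR.trans_le (add_le_add_right
      ((min_le_right _ _).trans ((min_le_right _ _).trans (min_le_left _ _))) _)
    linarith
  · have := hR.trans_le (add_le_add_right ((min_le_right _ _).trans (min_le_left _ _)) _)
    linarith
  · have := hR.trans_le (add_le_add_right
      ((min_le_right _ _).trans ((min_le_right _ _).trans (min_le_right _ _))) _)
    linarith

lemma sum_bound {T : Type*} [Fintype T] {p : T → ℝ} (hp : ∀ t, 0 ≤ p t) (hp1 : ∑ t, p t = 1)
    {s0 : T → S0} {s1 : T → S1} {s2 : T → S2} {u : T → U} {v1 : T → V1} {v2 : T → V2}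
    {v13 : T → V13} {v23 : T → V23} {y3 : T → Y3} {R h0 h1 h2 h3 h4 : ℝ}
    (hh0 : condEnt p u s0 ≤ h0)
    (hh1 : condEnt p v1 (fun t => (s0 t, s1 t, u t)) ≤ h1)
    (hh2 : condEnt p v2 (fun t => (s0 t, s2 t, u t)) ≤ h2)
    (hh3 : condEnt p v13 (fun t => (u t, v1 t, s0 t, s1 t)) ≤ h3)
    (hh4 : condEnt p v23 (fun t => (u t, v2 t, s0 t, s2 t)) ≤ h4)
    (hR : R < mi p (fun t => (u t, v1 t, v2 t, v13 t, v23 t)) y3 -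
      mi p (fun t => (u t, v1 t, v2 t, v13 t, v23 t)) (fun t => (s0 t, s1 t, s2 t))) :
    R + condEnt p (fun t => ((((u t, v1 t), v2 t), v13 t), v23 t)) y3 <
      h0 + h1 + h2 + h3 + h4 := by
  have e0 : condEnt p (fun t => ((((u t, v1 t), v2 t), v13 t), v23 t)) y3 =
      condEnt p (fun t => (u t, v1 t, v2 t, v13 t, v23 t)) y3 := by
    rw [condEnt, condEnt, entOf_congr p
      (f := fun t => (((((u t, v1 t), v2 t), v13 t), v23 t), y3 t))
      (g := fun t => ((u t, v1 t, v2 t, v13 t, v23 t), y3 t)) fun t t' => by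
        simp only [Prod.mk.injEq]; tauto]
  have hR' : R < condEnt p (fun t => (u t, v1 t, v2 t, v13 t, v23 t))
      (fun t => (s0 t, s1 t, s2 t)) - condEnt p (fun t => (u t, v1 t, v2 t, v13 t, v23 t)) y3 := by
    simp only [mi] at hR
    simp only [condEnt]
    linarith
  have e1 := condEnt_chain p (fun t => (v1 t, v2 t, v13 t, v23 t)) u
    (F := fun t => (u t, v1 t, v2 t, v13 t, v23 t)) (g := fun t => (s0 t, s1 t, s2 t))
    (h := fun t => (u t, s0 t, s1 t, s2 t))
    (fun t t' => by simp only [Prod.mk.injEq]; tauto)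
    (fun t t' => by simp only [Prod.mk.injEq])
  have e2 := condEnt_chain p (fun t => (v2 t, v13 t, v23 t)) v1
    (F := fun t => (v1 t, v2 t, v13 t, v23 t)) (g := fun t => (u t, s0 t, s1 t, s2 t))
    (h := fun t => (v1 t, u t, s0 t, s1 t, s2 t))
    (fun t t' => by simp only [Prod.mk.injEq]; tauto)
    (fun t t' => by simp only [Prod.mk.injEq])
  have e3 := condEnt_chain p (fun t => (v13 t, v23 t)) v2
    (F := fun t => (v2 t, v13 t, v23 t)) (g := fun t => (v1 t, u t, s0 t, s1 t, s2 t))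
    (h := fun t => (v2 t, v1 t, u t, s0 t, s1 t, s2 t))
    (fun t t' => by simp only [Prod.mk.injEq]; tauto)
    (fun t t' => by simp only [Prod.mk.injEq])
  have e4 := condEnt_chain p v23 v13
    (F := fun t => (v13 t, v23 t)) (g := fun t => (v2 t, v1 t, u t, s0 t, s1 t, s2 t))
    (h := fun t => (v13 t, v2 t, v1 t, u t, s0 t, s1 t, s2 t))
    (fun t t' => by simp only [Prod.mk.injEq]; tauto)
    (fun t t' => by simp only [Prod.mk.injEq])
  have f0 := condEnt_mono hp hp1 u (g := s0) (g' := fun t => (s0 t, s1 t, s2 t)) fun t t' => by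
      simp only [Prod.mk.injEq]; tauto
  have f1 := condEnt_mono hp hp1 v1 (g := fun t => (s0 t, s1 t, u t))
    (g' := fun t => (u t, s0 t, s1 t, s2 t)) fun t t' => by
      simp only [Prod.mk.injEq]; tauto
  have f2 := condEnt_mono hp hp1 v2 (g := fun t => (s0 t, s2 t, u t))
    (g' := fun t => (v1 t, u t, s0 t, s1 t, s2 t)) fun t t' => by
      simp only [Prod.mk.injEq]; tauto
  have f3 := condEnt_mono hp hp1 v13 (g := fun t => (u t, v1 t, s0 t, s1 t))
    (g' := fun t => (v2 t, v1 t, u t, s0 t, s1 t, s2 t)) fun t t' => by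
      simp only [Prod.mk.injEq]; tauto
  have f4 := condEnt_mono hp hp1 v23 (g := fun t => (u t, v2 t, s0 t, s2 t))
    (g' := fun t => (v13 t, v2 t, v1 t, u t, s0 t, s1 t, s2 t)) fun t t' => by
      simp only [Prod.mk.injEq]; tauto
  linarith

lemma Sys.condEnt_le_kent (σ : Sys S0 S1 S2 U V1 V2 V13 V23 X1 X2 Y1 Y2 Y3) {A B : Type*}
    [Fintype A] [Fintype B] {k : A → B → ℝ} (hk : IsCondPMF k) (j : Fin 5)
    (f : S0 × S1 × S2 × U × V1 × V2 × V13 × V23 × X1 × X2 × Y1 × Y2 × Y3 → A)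
    (g : S0 × S1 × S2 × U × V1 × V2 × V13 × V23 × X1 × X2 × Y1 × Y2 × Y3 → B)
    (h : ∀ z, σ.kern j z = k (f z) (g z)) : condEnt σ.P f g ≤ σ.kent j := by
  refine (condEnt_le σ.P_nonneg σ.sum_P f g hk.1 (fun b => (hk.2 b).le)
    (fun z hz => h z ▸ σ.kern_pos j hz)).trans_eq ?_
  rw [Sys.kent, ← sum_neg_distrib]
  exact sum_congr rfl fun z _ => by rw [h z, mul_neg]

lemma exists_rates_of_mem_region [Nonempty S0] [Nonempty S1] [Nonempty S2] [Nonempty X1]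
    [Nonempty X2] [Nonempty Y1] [Nonempty Y2] [Nonempty Y3]
    (σ : Sys S0 S1 S2 U V1 V2 V13 V23 X1 X2 Y1 Y2 Y3) {R : ℝ × ℝ} (hR : R ∈ region σ.P) :
    ∃ R12 R13 R21 R23, R.1 = R12 + R13 ∧ R.2 = R21 + R23 ∧ 0 ≤ R12 ∧ 0 ≤ R13 ∧ 0 ≤ R21 ∧
      0 ≤ R23 ∧ Rates σ R12 R13 R21 R23 := by
  obtain ⟨R12, R13, R21, R23, hR1, hR2, h12, hR12, h21, hR21, h13, hR13, h23, hR23, hpair,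
    hsum⟩ := hR
  refine ⟨R12, R13, R21, R23, hR1, hR2, h12, h13, h21, h23, ?_⟩
  have k0 := σ.condEnt_le_kent σ.hk0 0 (fun z => z.2.2.2.1) (fun z => z.1) fun z => rfl
  have k1 := σ.condEnt_le_kent σ.hk1 1 (fun z => z.2.2.2.2.1)
    (fun z => (z.1, z.2.1, z.2.2.2.1)) fun z => rfl
  have k2 := σ.condEnt_le_kent σ.hk2 2 (fun z => z.2.2.2.2.2.1)
    (fun z => (z.1, z.2.2.1, z.2.2.2.1)) fun z => rfl
  have k3 := σ.condEnt_le_kent σ.hk13 3 (fun z => z.2.2.2.2.2.2.1)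
    (fun z => (z.2.2.2.1, z.2.2.2.2.1, z.1, z.2.1)) fun z => rfl
  have k4 := σ.condEnt_le_kent σ.hk23 4 (fun z => z.2.2.2.2.2.2.2.1)
    (fun z => (z.2.2.2.1, z.2.2.2.2.2.1, z.1, z.2.2.1)) fun z => rfl
  have e1 := enc_bound σ.P_nonneg σ.sum_P k2 hR21
  have e2 := enc_bound σ.P_nonneg σ.sum_P k1 hR12
  have b1 := single_bound σ.P_nonneg σ.sum_P k1 k3 (v2 := fun z => z.2.2.2.2.2.1)
    (v23 := fun z => z.2.2.2.2.2.2.2.1) (c := fun z => (z.2.2.2.1, z.2.2.2.2.1, z.2.2.2.2.2.1,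
      z.2.2.2.2.2.2.2.1)) (d := fun z => (z.2.2.2.1, z.2.2.2.2.1, z.2.2.2.2.2.1,
      z.2.2.2.2.2.2.2.1, z.2.2.2.2.2.2.2.2.2.2.2.2)) (fun t t' => by simp only [Prod.mk.injEq])
    (fun t t' => by simp only [Prod.mk.injEq, and_assoc]) hR13
  have b2 := single_bound σ.P_nonneg σ.sum_P k2 k4 (v2 := fun z => z.2.2.2.2.1)
    (v23 := fun z => z.2.2.2.2.2.2.1) (c := fun z => (z.2.2.2.1, z.2.2.2.2.1, z.2.2.2.2.2.1,
      z.2.2.2.2.2.2.1)) (d := fun z => (z.2.2.2.1, z.2.2.2.2.1, z.2.2.2.2.2.1,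
      z.2.2.2.2.2.2.1, z.2.2.2.2.2.2.2.2.2.2.2.2))
    (fun t t' => by simp only [Prod.mk.injEq, and_left_comm])
    (fun t t' => by simp only [Prod.mk.injEq, and_assoc]) hR23
  obtain ⟨b3, b4, b5, b6⟩ := pair_bound σ.P_nonneg σ.sum_P k1 k2 k3 k4 hpair
  exact ⟨e1, e2, b2.1, b2.2, b1.1, b1.2, b3, b4, b5, b6,
    sum_bound σ.P_nonneg σ.sum_P k0 k1 k2 k3 k4 hsum⟩

end Region

/-! ### Chaining of blocks -/

section Chain

lemma trunc_snoc {Y : Type*} [Nonempty Y] {n : ℕ} (y : Fin n → Y) (a b : Y) (t : Fin n) :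
    trunc (Fin.snoc (α := fun _ => Y) y a) t.castSucc =
      trunc (Fin.snoc (α := fun _ => Y) y b) t.castSucc := by
  funext j
  unfold trunc
  by_cases hj : (j : ℕ) < t.castSucc
  · rw [if_pos hj, if_pos hj]
    have hjn : (j : ℕ) < n := hj.trans t.2
    have : j = Fin.castSucc ⟨j, hjn⟩ := rfl
    rw [this, Fin.snoc_castSucc, Fin.snoc_castSucc]
  · rw [if_neg hj, if_neg hj]

/-- A product of strictly causal kernels is normalized. -/
lemma sum_causal {Y : Type*} [Fintype Y] [Nonempty Y] {n : ℕ}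
    (κ : Fin n → (Fin n → Y) → Y → ℝ) (hκ : ∀ t y, ∑ a, κ t y a = 1) :
    ∑ y : Fin n → Y, ∏ t, κ t (trunc y t) (y t) = 1 := by
  induction n with
  | zero => simp
  | succ n ih =>
    rw [← (Fin.snocEquiv fun _ : Fin (n + 1) => Y).sum_comp, Fintype.sum_prod_type_right]
    have y0 : Y := Classical.arbitrary Y
    have h1 : ∀ (y : Fin n → Y) (a : Y),
        ∏ t, κ t (trunc (Fin.snoc (α := fun _ => Y) y a) t) (Fin.snoc (α := fun _ => Y) y a t) =
        (∏ t : Fin n, κ t.castSucc (trunc (Fin.snoc (α := fun _ => Y) y y0) t.castSucc) (y t)) *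
          κ (Fin.last n) (trunc (Fin.snoc (α := fun _ => Y) y a) (Fin.last n)) a := by
      intro y a
      rw [Fin.prod_univ_castSucc, Fin.snoc_last]
      simp only [Fin.snoc_castSucc, trunc_snoc y a y0]
    have h2 : ∀ (y : Fin n → Y) (a : Y),
        trunc (Fin.snoc (α := fun _ => Y) y a) (Fin.last n) =
        trunc (Fin.snoc (α := fun _ => Y) y y0) (Fin.last n) := by
      intro y a
      funext j
      unfold trunc
      by_cases hj : (j : ℕ) < Fin.last n
      · rw [if_pos hj, if_pos hj]
        have : j = Fin.castSucc ⟨j, hj⟩ := rfl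
        rw [this, Fin.snoc_castSucc, Fin.snoc_castSucc]
      · rw [if_neg hj, if_neg hj]
    calc _ = ∑ y : Fin n → Y, ∏ t : Fin n, κ t.castSucc
          (trunc (Fin.snoc (α := fun _ => Y) y y0) t.castSucc) (y t) := by
          refine sum_congr rfl fun y _ => ?_
          refine (sum_congr rfl fun a _ => h1 y a).trans ?_
          simp only [h2 y, ← mul_sum, hκ, mul_one]
      _ = 1 := by
          rw [← ih (fun t y a => κ t.castSucc
            (trunc (Fin.snoc (α := fun _ => Y) y y0) t.castSucc) a) fun t y => hκ _ _]
          refine sum_congr rfl fun y _ => prod_congr rfl fun t _ => ?_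
          congr 1
          funext j
          simp only [trunc]
          split_ifs with hj
          · have hjn : (j : ℕ) < n := (show (j : ℕ) < t from hj).trans t.2
            have : j = Fin.castSucc ⟨j, hjn⟩ := rfl
            rw [this, Fin.snoc_castSucc, Fin.snoc_castSucc]
            simp only [trunc]
            rw [if_pos]
            exact hj
          · rfl

lemma sum_update {ι A : Type*} [Fintype ι] [DecidableEq ι] [Fintype A] (i : ι)
    (G : (ι → A) → ℝ) :
    ∑ α, ∑ x, G (Function.update α i x) = Fintype.card A * ∑ α, G α := by
  have h : ∑ c : (ι → A) × A, G (Function.update c.1 i c.2) = ∑ c : (ι → A) × A, G c.1 := by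
    refine Fintype.sum_bijective (fun c => (Function.update c.1 i c.2, c.1 i))
      (Function.Involutive.bijective fun c => ?_) _ _ fun c => rfl
    simp
  rw [Fintype.sum_prod_type] at h
  rw [h, Fintype.sum_prod_type, mul_sum]
  simp

lemma induction_eq {A : Type*} {n : ℕ} (step : Fin n → A → A) (α : Fin (n + 1) → A)
    (i : Fin (n + 1)) (h : ∀ j : Fin n, j.castSucc < i → step j (α j.castSucc) = α j.succ) :
    Fin.induction (motive := fun _ => A) (α 0) step i = α i := by
  induction i using Fin.induction with
  | zero => rfl
  | succ i ih =>
    rw [Fin.induction_succ, ih fun j hj => h j (hj.trans i.castSucc_lt_succ),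
      h i i.castSucc_lt_succ]

lemma reverseInduction_eq {A : Type*} {n : ℕ} (step : Fin n → A → A) (α : Fin (n + 1) → A)
    (i : Fin (n + 1)) (h : ∀ j : Fin n, step j (α j.succ) = α j.castSucc) :
    Fin.reverseInduction (motive := fun _ => A) (α (Fin.last n)) step i = α i := by
  induction i using Fin.reverseInduction with
  | last => rw [Fin.reverseInduction_last]
  | cast i ih => rw [Fin.reverseInduction_castSucc, ih, h]

lemma one_sub_sum_le_prod {ι : Type*} [Fintype ι] (x : ι → ℝ) (h0 : ∀ i, 0 ≤ x i)
    (h1 : ∀ i, x i ≤ 1) : 1 - ∑ i, (1 - x i) ≤ ∏ i, x i := by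
  have key : ∀ s : Finset ι, (1 - ∑ i ∈ s, (1 - x i) ≤ ∏ i ∈ s, x i) ∧ ∏ i ∈ s, x i ≤ 1 := by
    classical
    intro s
    induction s using Finset.induction_on with
    | empty => simp
    | insert a s ha ih =>
      rw [sum_insert ha, prod_insert ha]
      refine ⟨?_, mul_le_one₀ (h1 a) (prod_nonneg fun i _ => h0 i) ih.2⟩
      nlinarith [h1 a, ih.1, ih.2, h0 a]
  exact (key univ).1

lemma trunc_trunc {Y Z : Type*} [Nonempty Y] [Nonempty Z] {n : ℕ} (f : Y → Z) (y : Fin n → Y)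
    (t : Fin n) : trunc (fun i => f (trunc y t i)) t = trunc (fun i => f (y i)) t := by
  funext j
  simp only [trunc]
  split_ifs <;> rfl

/-- The state and output sequences of a code have total probability one. -/
lemma sum_seqProb {S0 S1 S2 X1 X2 Y1 Y2 Y3 : Type*}
    [Fintype S0] [Fintype S1] [Fintype S2] [Fintype Y1] [Fintype Y2] [Fintype Y3]
    [Nonempty Y1] [Nonempty Y2] [Nonempty Y3]
    {q0 : S0 → ℝ} {q1 : S1 → S0 → ℝ} {q2 : S2 → S0 → ℝ}
    {W : Y1 × Y2 × Y3 → X1 × X2 × S0 × S1 × S2 → ℝ}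
    (hq0 : ∑ s, q0 s = 1) (hq1 : IsCondPMF q1) (hq2 : IsCondPMF q2) (hW : IsCondPMF W)
    {n K1 K2 : ℕ}
    (φ1 : Fin K1 → (Fin n → S0) → (Fin n → S1) → (Fin n → Y1) → Fin n → X1)
    (φ2 : Fin K2 → (Fin n → S0) → (Fin n → S2) → (Fin n → Y2) → Fin n → X2)
    (m1 : Fin K1) (m2 : Fin K2) :
    ∑ s0, ∑ s1, ∑ s2, ∑ y1, ∑ y2, ∑ y3,
      seqProb q0 q1 q2 W φ1 φ2 m1 m2 s0 s1 s2 y1 y2 y3 = 1 := by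
  have hy : ∀ s0 s1 s2, ∑ y1, ∑ y2, ∑ y3,
      seqProb q0 q1 q2 W φ1 φ2 m1 m2 s0 s1 s2 y1 y2 y3 =
        (∏ t, q0 (s0 t)) * (∏ t, q1 (s1 t) (s0 t)) * ∏ t, q2 (s2 t) (s0 t) := by
    intro s0 s1 s2
    have h1 := sum_causal (fun (t : Fin n) (y : Fin n → Y1 × Y2 × Y3) a => W a
      (φ1 m1 s0 s1 (trunc (fun i => (y i).1) t) t, φ2 m2 s0 s2 (trunc (fun i => (y i).2.1) t) t,
        s0 t, s1 t, s2 t)) fun t y => hW.2 _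
    simp only [trunc_trunc (fun a : Y1 × Y2 × Y3 => a.1),
      trunc_trunc (fun a : Y1 × Y2 × Y3 => a.2.1)] at h1
    simp only [seqProb, prod_mul_distrib, ← mul_sum]
    have h2 := sum_zip (n := n) fun (y1 : Fin n → Y1) (y : Fin n → Y2 × Y3) => ∏ t,
      W (y1 t, y t) (φ1 m1 s0 s1 (trunc y1 t) t, φ2 m2 s0 s2 (trunc (fun i => (y i).1) t) t,
        s0 t, s1 t, s2 t)
    rw [← h2] at h1
    have h3 := fun y1 => sum_zip (n := n) fun (y2 : Fin n → Y2) (y3 : Fin n → Y3) => ∏ t,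
      W (y1 t, y2 t, y3 t) (φ1 m1 s0 s1 (trunc y1 t) t, φ2 m2 s0 s2 (trunc y2 t) t,
        s0 t, s1 t, s2 t)
    rw [sum_congr rfl fun y1 _ => h3 y1, h1, mul_one]
  have e1 : ∀ s0 : Fin n → S0, ∑ s : Fin n → S1, ∏ t, q1 (s t) (s0 t) = 1 := fun s0 => by
    rw [sum_prod_pi (fun i a => q1 a (s0 i))]
    exact prod_eq_one fun i _ => hq1.2 _
  have e2 : ∀ s0 : Fin n → S0, ∑ s : Fin n → S2, ∏ t, q2 (s t) (s0 t) = 1 := fun s0 => by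
    rw [sum_prod_pi (fun i a => q2 a (s0 i))]
    exact prod_eq_one fun i _ => hq2.2 _
  have e0 : ∑ s : Fin n → S0, ∏ t, q0 (s t) = 1 := by
    rw [sum_prod_pi (fun _ a => q0 a)]
    exact prod_eq_one fun i _ => hq0
  simp only [hy, ← mul_sum, e2, mul_one, e1, e0]

end Chain

/-! ### The chained code -/

section ChainedCode

lemma sum_prod_pi_six {ι S0 S1 S2 Y1 Y2 Y3 : Type*} [Fintype ι] [DecidableEq ι]
    [Fintype S0] [Fintype S1] [Fintype S2] [Fintype Y1] [Fintype Y2] [Fintype Y3]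
    (F : ι → S0 → S1 → S2 → Y1 → Y2 → Y3 → ℝ) :
    ∑ s0 : ι → S0, ∑ s1 : ι → S1, ∑ s2 : ι → S2, ∑ y1 : ι → Y1, ∑ y2 : ι → Y2,
      ∑ y3 : ι → Y3, ∏ t, F t (s0 t) (s1 t) (s2 t) (y1 t) (y2 t) (y3 t) =
    ∏ t, ∑ s0, ∑ s1, ∑ s2, ∑ y1, ∑ y2, ∑ y3, F t s0 s1 s2 y1 y2 y3 := by
  rw [← sum_prod_pi fun t s0 => ∑ s1, ∑ s2, ∑ y1, ∑ y2, ∑ y3, F t s0 s1 s2 y1 y2 y3]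
  refine sum_congr rfl fun s0 _ => ?_
  rw [← sum_prod_pi fun t s1 => ∑ s2, ∑ y1, ∑ y2, ∑ y3, F t (s0 t) s1 s2 y1 y2 y3]
  refine sum_congr rfl fun s1 _ => ?_
  rw [← sum_prod_pi fun t s2 => ∑ y1, ∑ y2, ∑ y3, F t (s0 t) (s1 t) s2 y1 y2 y3]
  refine sum_congr rfl fun s2 _ => ?_
  rw [← sum_prod_pi fun t y1 => ∑ y2, ∑ y3, F t (s0 t) (s1 t) (s2 t) y1 y2 y3]
  refine sum_congr rfl fun y1 _ => ?_
  rw [← sum_prod_pi fun t y2 => ∑ y3, F t (s0 t) (s1 t) (s2 t) (y1 t) y2 y3]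
  refine sum_congr rfl fun y2 _ => ?_
  rw [← sum_prod_pi fun t y3 => F t (s0 t) (s1 t) (s2 t) (y1 t) (y2 t) y3]

/-- The maps used in one block of a block-Markov code.  The pair `w` of cooperative messages of
the previous block is known to both encoders; in the block, encoder `k` sends the cooperative
message `a_k` and the private message `d_k`; the encoders decode each other's cooperative message
from the feedback, and the receiver, knowing both cooperative messages of the block, decodes
`w` and the private messages. -/
structure BlockCode (S0 S1 S2 X1 X2 Y1 Y2 Y3 A1 A2 D1 D2 : Type*) where
  /-- input of user 1 -/
  f1 : A1 × A2 → A1 → D1 → S0 → S1 → X1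
  /-- input of user 2 -/
  f2 : A1 × A2 → A2 → D2 → S0 → S2 → X2
  /-- estimate by user 1 of the cooperative message of user 2 -/
  g1 : A1 × A2 → A1 → D1 → S0 → S1 → Y1 → A2
  /-- estimate by user 2 of the cooperative message of user 1 -/
  g2 : A1 × A2 → A2 → D2 → S0 → S2 → Y2 → A1
  /-- estimate by the receiver -/
  h : A1 → A2 → Y3 → (A1 × A2) × D1 × D2

namespace BlockCode

variable {S0 S1 S2 X1 X2 Y1 Y2 Y3 A1 A2 D1 D2 : Type*}
  (c : BlockCode S0 S1 S2 X1 X2 Y1 Y2 Y3 A1 A2 D1 D2)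

/-- All three decoding steps of a block are correct. -/
def Good (w a : A1 × A2) (d1 : D1) (d2 : D2) (s0 : S0) (s1 : S1) (s2 : S2) (y1 : Y1) (y2 : Y2)
    (y3 : Y3) : Prop :=
  c.g1 w a.1 d1 s0 s1 y1 = a.2 ∧ c.g2 w a.2 d2 s0 s2 y2 = a.1 ∧ c.h a.1 a.2 y3 = (w, d1, d2)

/-- The probability that all three decoding steps of a block are correct. -/
def success [Fintype S0] [Fintype S1] [Fintype S2] [Fintype Y1] [Fintype Y2] [Fintype Y3]
    (q0 : S0 → ℝ) (q1 : S1 → S0 → ℝ) (q2 : S2 → S0 → ℝ)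
    (W : Y1 × Y2 × Y3 → X1 × X2 × S0 × S1 × S2 → ℝ)
    (w a : A1 × A2) (d1 : D1) (d2 : D2) : ℝ :=
  ∑ s0, ∑ s1, ∑ s2, ∑ y1, ∑ y2, ∑ y3, q0 s0 * q1 s1 s0 * q2 s2 s0 *
    W (y1, y2, y3) (c.f1 w a.1 d1 s0 s1, c.f2 w a.2 d2 s0 s2, s0, s1, s2) *
    ind (c.Good w a d1 d2 s0 s1 s2 y1 y2 y3)

/-- Encoder 1 of the chained code. -/
def enc1 {L : ℕ} (b : A2) (α : Fin (L + 1) → A1) (d : Fin L → D1) (s0 : Fin L → S0)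
    (s1 : Fin L → S1) (y1 : Fin L → Y1) (t : Fin L) : X1 :=
  c.f1 (α t.castSucc, Fin.induction (motive := fun _ => A2) b (fun i e =>
    c.g1 (α i.castSucc, e) (α i.succ) (d i) (s0 i) (s1 i) (y1 i)) t.castSucc)
    (α t.succ) (d t) (s0 t) (s1 t)

/-- Encoder 2 of the chained code. -/
def enc2 {L : ℕ} (b : A1) (α : Fin (L + 1) → A2) (d : Fin L → D2) (s0 : Fin L → S0)
    (s2 : Fin L → S2) (y2 : Fin L → Y2) (t : Fin L) : X2 :=
  c.f2 (Fin.induction (motive := fun _ => A1) b (fun i e =>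
    c.g2 (e, α i.castSucc) (α i.succ) (d i) (s0 i) (s2 i) (y2 i)) t.castSucc, α t.castSucc)
    (α t.succ) (d t) (s0 t) (s2 t)

/-- Backward decoding of the cooperative messages. -/
def dec {L : ℕ} (wl : A1 × A2) (y3 : Fin L → Y3) : Fin (L + 1) → A1 × A2 :=
  fun i => Fin.reverseInduction (motive := fun _ => A1 × A2) wl
    (fun i e => (c.h e.1 e.2 (y3 i)).1) i

/-- Decoding of the private messages. -/
def decData {L : ℕ} (wl : A1 × A2) (y3 : Fin L → Y3) (t : Fin L) : D1 × D2 :=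
  (c.h (c.dec wl y3 t.succ).1 (c.dec wl y3 t.succ).2 (y3 t)).2

variable {L : ℕ} {α : Fin (L + 1) → A1 × A2} {d1 : Fin L → D1} {d2 : Fin L → D2}
  {s0 : Fin L → S0} {s1 : Fin L → S1} {s2 : Fin L → S2}
  {y1 : Fin L → Y1} {y2 : Fin L → Y2} {y3 : Fin L → Y3}

lemma trunc_apply_of_lt {Y : Type*} [Nonempty Y] {n : ℕ} (y : Fin n → Y) {j t : Fin n}
    (h : j < t) : trunc y t j = y j := if_pos h

lemma enc1_eq [Nonempty Y1]
    (hg : ∀ t, c.Good (α t.castSucc) (α t.succ) (d1 t) (d2 t) (s0 t) (s1 t) (s2 t) (y1 t) (y2 t)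
      (y3 t)) (t : Fin L) :
    c.enc1 (α 0).2 (fun i => (α i).1) d1 s0 s1 (trunc y1 t) t =
      c.f1 (α t.castSucc) (α t.succ).1 (d1 t) (s0 t) (s1 t) := by
  unfold enc1
  rw [induction_eq (fun i e => c.g1 ((α i.castSucc).1, e) (α i.succ).1 (d1 i) (s0 i) (s1 i)
    (trunc y1 t i)) (fun i => (α i).2) t.castSucc fun j hj => ?_]
  rw [trunc_apply_of_lt y1 (Fin.castSucc_lt_castSucc_iff.1 hj)]
  exact (hg j).1

lemma enc2_eq [Nonempty Y2]
    (hg : ∀ t, c.Good (α t.castSucc) (α t.succ) (d1 t) (d2 t) (s0 t) (s1 t) (s2 t) (y1 t) (y2 t)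
      (y3 t)) (t : Fin L) :
    c.enc2 (α 0).1 (fun i => (α i).2) d2 s0 s2 (trunc y2 t) t =
      c.f2 (α t.castSucc) (α t.succ).2 (d2 t) (s0 t) (s2 t) := by
  unfold enc2
  rw [induction_eq (fun i e => c.g2 (e, (α i.castSucc).2) (α i.succ).2 (d2 i) (s0 i) (s2 i)
    (trunc y2 t i)) (fun i => (α i).1) t.castSucc fun j hj => ?_]
  rw [trunc_apply_of_lt y2 (Fin.castSucc_lt_castSucc_iff.1 hj)]
  exact (hg j).2.1

lemma dec_eq
    (hg : ∀ t, c.Good (α t.castSucc) (α t.succ) (d1 t) (d2 t) (s0 t) (s1 t) (s2 t) (y1 t) (y2 t)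
      (y3 t)) : c.dec (α (Fin.last L)) y3 = α := by
  funext i
  refine reverseInduction_eq _ α i fun j => ?_
  rw [(hg j).2.2]

lemma decData_eq
    (hg : ∀ t, c.Good (α t.castSucc) (α t.succ) (d1 t) (d2 t) (s0 t) (s1 t) (s2 t) (y1 t) (y2 t)
      (y3 t)) (t : Fin L) : c.decData (α (Fin.last L)) y3 t = (d1 t, d2 t) := by
  unfold decData
  rw [c.dec_eq hg, (hg t).2.2]

variable [Fintype S0] [Fintype S1] [Fintype S2] [Fintype Y1] [Fintype Y2] [Fintype Y3]
  {q0 : S0 → ℝ} {q1 : S1 → S0 → ℝ} {q2 : S2 → S0 → ℝ}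
  {W : Y1 × Y2 × Y3 → X1 × X2 × S0 × S1 × S2 → ℝ}

lemma success_nonneg (hq0 : (∀ s, 0 ≤ q0 s) ∧ ∑ s, q0 s = 1) (hq1 : IsCondPMF q1)
    (hq2 : IsCondPMF q2) (hW : IsCondPMF W) (w a : A1 × A2) (d1 : D1) (d2 : D2) :
    0 ≤ c.success q0 q1 q2 W w a d1 d2 := by
  unfold success
  refine sum_nonneg fun s0 _ => sum_nonneg fun s1 _ => sum_nonneg fun s2 _ =>
    sum_nonneg fun y1 _ => sum_nonneg fun y2 _ => sum_nonneg fun y3 _ => ?_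
  exact mul_nonneg (mul_nonneg (mul_nonneg (mul_nonneg (hq0.1 _) (hq1.1 _ _)) (hq2.1 _ _))
    (hW.1 _ _)) (ind_nonneg _)

lemma success_le_one (hq0 : (∀ s, 0 ≤ q0 s) ∧ ∑ s, q0 s = 1) (hq1 : IsCondPMF q1)
    (hq2 : IsCondPMF q2) (hW : IsCondPMF W) (w a : A1 × A2) (d1 : D1) (d2 : D2) :
    c.success q0 q1 q2 W w a d1 d2 ≤ 1 := by
  have hy : ∀ x, ∑ y1, ∑ y2, ∑ y3, W (y1, y2, y3) x = 1 := fun x => by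
    rw [← hW.2 x, Fintype.sum_prod_type]
    exact sum_congr rfl fun y1 _ => (Fintype.sum_prod_type fun y => W (y1, y) x).symm
  calc c.success q0 q1 q2 W w a d1 d2
      ≤ ∑ s0, ∑ s1, ∑ s2, ∑ y1, ∑ y2, ∑ y3, q0 s0 * q1 s1 s0 * q2 s2 s0 *
        W (y1, y2, y3) (c.f1 w a.1 d1 s0 s1, c.f2 w a.2 d2 s0 s2, s0, s1, s2) := by
        unfold success
        refine sum_le_sum fun s0 _ => sum_le_sum fun s1 _ => sum_le_sum fun s2 _ =>
          sum_le_sum fun y1 _ => sum_le_sum fun y2 _ => sum_le_sum fun y3 _ => ?_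
        exact mul_le_of_le_one_right (mul_nonneg (mul_nonneg (mul_nonneg (hq0.1 _) (hq1.1 _ _))
          (hq2.1 _ _)) (hW.1 _ _)) (ind_le_one _)
    _ = 1 := by
        simp only [← mul_sum, hy, mul_one, hq2.2, hq1.2, hq0.2]

/-- The error probability of the chained code, for a fixed message pair, is at most the sum of
the error probabilities of the individual blocks. -/
lemma error_le [Nonempty Y1] [Nonempty Y2] [Nonempty Y3]
    (hq0 : (∀ s, 0 ≤ q0 s) ∧ ∑ s, q0 s = 1) (hq1 : IsCondPMF q1)
    (hq2 : IsCondPMF q2) (hW : IsCondPMF W) {K1 K2 : ℕ}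
    (φ1 : Fin K1 → (Fin L → S0) → (Fin L → S1) → (Fin L → Y1) → Fin L → X1)
    (φ2 : Fin K2 → (Fin L → S0) → (Fin L → S2) → (Fin L → Y2) → Fin L → X2)
    (E : (Fin L → Y3) → Prop) [DecidablePred E] (m1 : Fin K1) (m2 : Fin K2)
    (α : Fin (L + 1) → A1 × A2) (d1 : Fin L → D1) (d2 : Fin L → D2)
    (h1 : φ1 m1 = c.enc1 (α 0).2 (fun i => (α i).1) d1)
    (h2 : φ2 m2 = c.enc2 (α 0).1 (fun i => (α i).2) d2)
    (hE : ∀ y3, c.dec (α (Fin.last L)) y3 = α →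
      (∀ t, c.decData (α (Fin.last L)) y3 t = (d1 t, d2 t)) → ¬ E y3) :
    (∑ s0, ∑ s1, ∑ s2, ∑ y1, ∑ y2, ∑ y3,
      if E y3 then seqProb q0 q1 q2 W φ1 φ2 m1 m2 s0 s1 s2 y1 y2 y3 else 0) ≤
      ∑ t : Fin L, (1 - c.success q0 q1 q2 W (α t.castSucc) (α t.succ) (d1 t) (d2 t)) := by
  have key : ∏ t, c.success q0 q1 q2 W (α t.castSucc) (α t.succ) (d1 t) (d2 t) ≤
      ∑ s0, ∑ s1, ∑ s2, ∑ y1, ∑ y2, ∑ y3,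
        (seqProb q0 q1 q2 W φ1 φ2 m1 m2 s0 s1 s2 y1 y2 y3 -
          if E y3 then seqProb q0 q1 q2 W φ1 φ2 m1 m2 s0 s1 s2 y1 y2 y3 else 0) := by
    unfold success
    rw [← sum_prod_pi_six fun t s0 s1 s2 y1 y2 y3 => q0 s0 * q1 s1 s0 * q2 s2 s0 *
      W (y1, y2, y3) (c.f1 (α t.castSucc) (α t.succ).1 (d1 t) s0 s1,
        c.f2 (α t.castSucc) (α t.succ).2 (d2 t) s0 s2, s0, s1, s2) *
      ind (c.Good (α t.castSucc) (α t.succ) (d1 t) (d2 t) s0 s1 s2 y1 y2 y3)]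
    refine sum_le_sum fun s0 _ => sum_le_sum fun s1 _ => sum_le_sum fun s2 _ =>
      sum_le_sum fun y1 _ => sum_le_sum fun y2 _ => sum_le_sum fun y3 _ => ?_
    by_cases hg : ∀ t, c.Good (α t.castSucc) (α t.succ) (d1 t) (d2 t) (s0 t) (s1 t) (s2 t) (y1 t)
        (y2 t) (y3 t)
    · rw [if_neg (hE y3 (c.dec_eq hg) (c.decData_eq hg)), sub_zero]
      unfold seqProb
      refine le_of_eq (prod_congr rfl fun t _ => ?_)
      rw [ind_of_true (hg t), mul_one, h1, h2, c.enc1_eq hg, c.enc2_eq hg]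
    · obtain ⟨t, ht⟩ := not_forall.1 hg
      rw [prod_eq_zero (mem_univ t) (by rw [ind_of_false ht, mul_zero])]
      have : 0 ≤ seqProb q0 q1 q2 W φ1 φ2 m1 m2 s0 s1 s2 y1 y2 y3 :=
        prod_nonneg fun t _ => mul_nonneg (mul_nonneg (mul_nonneg (hq0.1 _) (hq1.1 _ _))
          (hq2.1 _ _)) (hW.1 _ _)
      split_ifs <;> simp [this]
  simp only [sum_sub_distrib] at key
  rw [sum_seqProb hq0.2 hq1 hq2 hW φ1 φ2 m1 m2] at key
  have := one_sub_sum_le_prod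
    (fun t => c.success q0 q1 q2 W (α t.castSucc) (α t.succ) (d1 t) (d2 t))
    (fun t => c.success_nonneg hq0 hq1 hq2 hW _ _ _ _)
    (fun t => c.success_le_one hq0 hq1 hq2 hW _ _ _ _)
  linarith

end BlockCode

end ChainedCode

/-! ### Averaging over the boundary messages -/

section Average

lemma sum_coord {ι A : Type*} [Fintype ι] [DecidableEq ι] [Fintype A] (i : ι) (f : A → ℝ) :
    Fintype.card A * ∑ α : ι → A, f (α i) = Fintype.card (ι → A) * ∑ a, f a := by
  rw [← sum_update i]
  simp

lemma sum_coord_two {ι A : Type*} [Fintype ι] [DecidableEq ι] [Fintype A] {i j : ι}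
    (hij : i ≠ j) (f : A → A → ℝ) :
    Fintype.card A * (Fintype.card A * ∑ α : ι → A, f (α i) (α j)) =
      Fintype.card (ι → A) * ∑ a, ∑ b, f a b := by
  rw [← sum_update i, mul_sum]
  have h : ∀ α : ι → A, ∑ x, f (Function.update α i x i) (Function.update α i x j) =
      ∑ x, f x (α j) := fun α => by
    simp [Function.update_of_ne hij.symm]
  simp only [h]
  rw [← mul_sum, sum_coord j fun b => ∑ a, f a b, sum_comm]

/-- The sequence `w₀, a₁, …, a_L, w_{L+1}`. -/
def path {A : Type*} {L : ℕ} (w0 : A) (a : Fin L → A) (wl : A) : Fin (L + 1 + 1) → A :=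
  Fin.cons (α := fun _ => A) w0 (Fin.snoc (α := fun _ => A) a wl)

lemma path_last {A : Type*} {L : ℕ} (w0 : A) (a : Fin L → A) (wl : A) :
    path w0 a wl (Fin.last (L + 1)) = wl := by
  rw [← Fin.succ_last, path, Fin.cons_succ, Fin.snoc_last]

lemma path_mid {A : Type*} {L : ℕ} (w0 : A) (a : Fin L → A) (wl : A) (i : Fin L) :
    path w0 a wl i.castSucc.succ = a i := by
  rw [path, Fin.cons_succ, Fin.snoc_castSucc]

lemma map_path {A B : Type*} {L : ℕ} (f : A → B) (w0 : A) (a : Fin L → A) (wl : A) :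
    (fun i => f (path w0 a wl i)) = path (f w0) (fun i => f (a i)) (f wl) := by
  funext i
  refine Fin.cases rfl (fun i => ?_) i
  refine Fin.lastCases ?_ (fun i => ?_) i
  · rw [Fin.succ_last, path_last, path_last]
  · rw [path_mid, path_mid]

lemma sum_path {A : Type*} [Fintype A] {L : ℕ} (F : (Fin (L + 1 + 1) → A) → ℝ) :
    ∑ w : A × A, ∑ a : Fin L → A, F (path w.1 a w.2) = ∑ α, F α := by
  rw [← (Fin.consEquiv fun _ : Fin (L + 1 + 1) => A).sum_comp, Fintype.sum_prod_type,
    Fintype.sum_prod_type]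
  refine sum_congr rfl fun w0 _ => ?_
  rw [← (Fin.snocEquiv fun _ : Fin (L + 1) => A).sum_comp, Fintype.sum_prod_type]
  rfl

namespace BlockCode

variable {S0 S1 S2 X1 X2 Y1 Y2 Y3 A1 A2 D1 D2 : Type*}
  [Fintype S0] [Fintype S1] [Fintype S2] [Fintype Y1] [Fintype Y2] [Fintype Y3]
  [Nonempty Y1] [Nonempty Y2] [Nonempty Y3]
  [Fintype A1] [Fintype A2] [Fintype D1] [Fintype D2]
  [Nonempty A1] [Nonempty A2] [Nonempty D1] [Nonempty D2]

/-- Averaged over all message sequences, the sum of the block costs is at most the number of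
blocks times the average cost of one block. -/
lemma sum_blocks_le (e : A1 × A2 → A1 × A2 → D1 → D2 → ℝ) {ε : ℝ}
    (he : ∑ w, ∑ a, ∑ d1, ∑ d2, e w a d1 d2 ≤
      Fintype.card (A1 × A2) * (Fintype.card (A1 × A2) *
        (Fintype.card D1 * (Fintype.card D2 * ε)))) (L : ℕ) :
    ∑ α : Fin (L + 1) → A1 × A2, ∑ d1 : Fin L → D1, ∑ d2 : Fin L → D2,
      ∑ t : Fin L, e (α t.castSucc) (α t.succ) (d1 t) (d2 t) ≤
      Fintype.card (Fin (L + 1) → A1 × A2) * (Fintype.card (Fin L → D1) *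
        (Fintype.card (Fin L → D2) * (L * ε))) := by
  have hA : (0 : ℝ) < Fintype.card (A1 × A2) := Nat.cast_pos.2 Fintype.card_pos
  have h1 : (0 : ℝ) < Fintype.card D1 := Nat.cast_pos.2 Fintype.card_pos
  have h2 : (0 : ℝ) < Fintype.card D2 := Nat.cast_pos.2 Fintype.card_pos
  have key : ∀ t : Fin L, ∑ α : Fin (L + 1) → A1 × A2, ∑ d1 : Fin L → D1, ∑ d2 : Fin L → D2,
      e (α t.castSucc) (α t.succ) (d1 t) (d2 t) ≤
      Fintype.card (Fin (L + 1) → A1 × A2) * (Fintype.card (Fin L → D1) *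
        (Fintype.card (Fin L → D2) * ε)) := by
    intro t
    have e1 : ∀ w a, Fintype.card D1 * (Fintype.card D2 * ∑ d1 : Fin L → D1, ∑ d2 : Fin L → D2,
        e w a (d1 t) (d2 t)) = Fintype.card (Fin L → D1) * (Fintype.card (Fin L → D2) *
          ∑ d1, ∑ d2, e w a d1 d2) := by
      intro w a
      rw [mul_sum]
      simp only [sum_coord t]
      rw [← mul_sum, mul_left_comm, sum_coord t fun d => ∑ d2, e w a d d2]
      ring
    have e2 := sum_coord_two (Fin.castSucc_lt_succ (i := t)).ne fun w a =>
      ∑ d1 : Fin L → D1, ∑ d2 : Fin L → D2, e w a (d1 t) (d2 t)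
    have e3 : Fintype.card D1 * (Fintype.card D2 * ∑ w, ∑ a, ∑ d1 : Fin L → D1,
        ∑ d2 : Fin L → D2, e w a (d1 t) (d2 t)) = Fintype.card (Fin L → D1) *
        (Fintype.card (Fin L → D2) * ∑ w, ∑ a, ∑ d1, ∑ d2, e w a d1 d2) := by
      simp only [mul_sum] at e1 ⊢
      exact sum_congr rfl fun w _ => sum_congr rfl fun a _ => e1 w a
    set S := ∑ α : Fin (L + 1) → A1 × A2, ∑ d1 : Fin L → D1, ∑ d2 : Fin L → D2,
      e (α t.castSucc) (α t.succ) (d1 t) (d2 t)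
    set T := ∑ w, ∑ a, ∑ d1 : Fin L → D1, ∑ d2 : Fin L → D2, e w a (d1 t) (d2 t)
    set T' := ∑ w, ∑ a, ∑ d1, ∑ d2, e w a d1 d2
    have hC : (0 : ℝ) ≤ Fintype.card (Fin (L + 1) → A1 × A2) * (Fintype.card (Fin L → D1) *
        Fintype.card (Fin L → D2)) := by positivity
    have hN : (0 : ℝ) < Fintype.card (A1 × A2) * Fintype.card (A1 × A2) *
        (Fintype.card D1 * Fintype.card D2) := by positivity
    refine le_of_mul_le_mul_left ?_ hN
    calc _ = (Fintype.card D1 * Fintype.card D2 : ℝ) * (Fintype.card (A1 × A2) *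
          (Fintype.card (A1 × A2) * S)) := by ring
      _ = Fintype.card (Fin (L + 1) → A1 × A2) * (Fintype.card D1 * (Fintype.card D2 * T)) := by
          rw [e2]; ring
      _ = Fintype.card (Fin (L + 1) → A1 × A2) * (Fintype.card (Fin L → D1) *
        Fintype.card (Fin L → D2)) * T' := by rw [e3]; ring
      _ ≤ _ := mul_le_mul_of_nonneg_left he hC
      _ = _ := by ring
  calc _ = ∑ t : Fin L, ∑ α : Fin (L + 1) → A1 × A2, ∑ d1 : Fin L → D1, ∑ d2 : Fin L → D2,
      e (α t.castSucc) (α t.succ) (d1 t) (d2 t) := by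
        symm
        rw [sum_comm]
        refine sum_congr rfl fun α _ => ?_
        rw [sum_comm]
        refine sum_congr rfl fun d1 _ => ?_
        rw [sum_comm]
    _ ≤ ∑ t : Fin L, (Fintype.card (Fin (L + 1) → A1 × A2) * (Fintype.card (Fin L → D1) *
        (Fintype.card (Fin L → D2) * ε)) : ℝ) := sum_le_sum fun t _ => key t
    _ = _ := by
        rw [sum_const, card_univ, Fintype.card_fin, nsmul_eq_mul]
        ring

/-- Chaining `L + 1` uses of a block code gives a code for the channel. -/
lemma exists_chained (c : BlockCode S0 S1 S2 X1 X2 Y1 Y2 Y3 A1 A2 D1 D2)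
    {q0 : S0 → ℝ} {q1 : S1 → S0 → ℝ} {q2 : S2 → S0 → ℝ}
    {W : Y1 × Y2 × Y3 → X1 × X2 × S0 × S1 × S2 → ℝ}
    (hq0 : (∀ s, 0 ≤ q0 s) ∧ ∑ s, q0 s = 1) (hq1 : IsCondPMF q1)
    (hq2 : IsCondPMF q2) (hW : IsCondPMF W) {ε : ℝ}
    (hc : ∑ w, ∑ a, ∑ d1, ∑ d2, (1 - c.success q0 q1 q2 W w a d1 d2) ≤
      Fintype.card (A1 × A2) * (Fintype.card (A1 × A2) *
        (Fintype.card D1 * (Fintype.card D2 * ε)))) (L : ℕ) :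
    ∃ (K1 K2 : ℕ)
      (φ1 : Fin K1 → (Fin (L + 1) → S0) → (Fin (L + 1) → S1) → (Fin (L + 1) → Y1) →
        Fin (L + 1) → X1)
      (φ2 : Fin K2 → (Fin (L + 1) → S0) → (Fin (L + 1) → S2) → (Fin (L + 1) → Y2) →
        Fin (L + 1) → X2)
      (ψ : (Fin (L + 1) → Y3) → Fin K1 × Fin K2),
      K1 = Fintype.card A1 ^ L * Fintype.card D1 ^ (L + 1) ∧
      K2 = Fintype.card A2 ^ L * Fintype.card D2 ^ (L + 1) ∧
      Pe q0 q1 q2 W φ1 φ2 ψ ≤ (L + 1) * ε := by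
  classical
  set M1 := (Fin L → A1) × (Fin (L + 1) → D1)
  set M2 := (Fin L → A2) × (Fin (L + 1) → D2)
  set T : (Fin (L + 1 + 1) → A1 × A2) → (Fin (L + 1) → D1) → (Fin (L + 1) → D2) → ℝ :=
    fun α d1 d2 => ∑ t : Fin (L + 1), (1 - c.success q0 q1 q2 W (α t.castSucc) (α t.succ)
      (d1 t) (d2 t)) with hT
  have htot := sum_blocks_le _ hc (L + 1)
  obtain ⟨⟨w0, wl⟩, -, hw⟩ := exists_le_of_sum_le (s := (univ : Finset ((A1 × A2) × (A1 × A2))))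
    (f := fun w => ∑ a : Fin L → A1 × A2, ∑ d1 : Fin (L + 1) → D1, ∑ d2 : Fin (L + 1) → D2,
      T (path w.1 a w.2) d1 d2)
    (g := fun _ => (Fintype.card M1 * Fintype.card M2 * ((L + 1) * ε) : ℝ)) univ_nonempty (by
      rw [sum_path fun α => ∑ d1 : Fin (L + 1) → D1, ∑ d2 : Fin (L + 1) → D2, T α d1 d2]
      refine htot.trans (le_of_eq ?_)
      simp only [M1, M2, sum_const, card_univ, nsmul_eq_mul, Fintype.card_prod, Fintype.card_fun,
        Fintype.card_fin]
      push_cast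
      ring)
  have hw' : ∑ m1 : M1, ∑ m2 : M2, T (path w0 (fun i => (m1.1 i, m2.1 i)) wl) m1.2 m2.2 ≤
      Fintype.card M1 * Fintype.card M2 * ((L + 1) * ε) := by
    refine le_trans (le_of_eq ?_) hw
    rw [← sum_zip (fun (a1 : Fin L → A1) (a2 : Fin L → A2) =>
      ∑ d1 : Fin (L + 1) → D1, ∑ d2 : Fin (L + 1) → D2,
      T (path w0 (fun i => (a1 i, a2 i)) wl) d1 d2)]
    simp only [M1, M2, Fintype.sum_prod_type]
    refine sum_congr rfl fun a1 _ => ?_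
    rw [sum_comm]
  let e1 : M1 ≃ Fin (Fintype.card M1) := Fintype.equivFin M1
  let e2 : M2 ≃ Fin (Fintype.card M2) := Fintype.equivFin M2
  let φ1 : Fin (Fintype.card M1) → (Fin (L + 1) → S0) → (Fin (L + 1) → S1) →
      (Fin (L + 1) → Y1) → Fin (L + 1) → X1 := fun m =>
    c.enc1 w0.2 (path w0.1 (e1.symm m).1 wl.1) (e1.symm m).2
  let φ2 : Fin (Fintype.card M2) → (Fin (L + 1) → S0) → (Fin (L + 1) → S2) →
      (Fin (L + 1) → Y2) → Fin (L + 1) → X2 := fun m =>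
    c.enc2 w0.1 (path w0.2 (e2.symm m).1 wl.2) (e2.symm m).2
  let ψ : (Fin (L + 1) → Y3) → Fin (Fintype.card M1) × Fin (Fintype.card M2) := fun y3 =>
    (e1 (fun i => (c.dec wl y3 i.castSucc.succ).1, fun t => (c.decData wl y3 t).1),
      e2 (fun i => (c.dec wl y3 i.castSucc.succ).2, fun t => (c.decData wl y3 t).2))
  refine ⟨Fintype.card M1, Fintype.card M2, φ1, φ2, ψ, ?_, ?_, ?_⟩
  · simp [M1]
  · simp [M2]
  have hM1 : (0 : ℝ) < Fintype.card M1 := Nat.cast_pos.2 Fintype.card_pos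
  have hM2 : (0 : ℝ) < Fintype.card M2 := Nat.cast_pos.2 Fintype.card_pos
  unfold Pe
  rw [inv_mul_le_iff₀ (by positivity)]
  refine le_trans ?_ hw'
  rw [← e1.symm.sum_comp]
  refine sum_le_sum fun m1 _ => ?_
  rw [← e2.symm.sum_comp]
  refine sum_le_sum fun m2 _ => ?_
  have hp1 := map_path (fun a : A1 × A2 => a.1) w0
    (fun i => ((e1.symm m1).1 i, (e2.symm m2).1 i)) wl
  have hp2 := map_path (fun a : A1 × A2 => a.2) w0
    (fun i => ((e1.symm m1).1 i, (e2.symm m2).1 i)) wl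
  refine c.error_le hq0 hq1 hq2 hW φ1 φ2 (fun y3 => ψ y3 ≠ (m1, m2)) m1 m2
    (path w0 (fun i => ((e1.symm m1).1 i, (e2.symm m2).1 i)) wl) (e1.symm m1).2 (e2.symm m2).2
    ?_ ?_ ?_
  · rw [hp1]; rfl
  · rw [hp2]; rfl
  · intro y3 hdec hdata
    rw [path_last] at hdec hdata
    rw [not_not]
    simp only [ψ, hdec, hdata, path_mid]
    rw [Prod.mk.injEq]
    exact ⟨e1.apply_symm_apply m1, e2.apply_symm_apply m2⟩

end BlockCode

end Average

/-! ### Codes for blocks of channel uses -/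

section Flatten

/-- A sequence of length `B * n` cut into `B` blocks of length `n`. -/
def cut {Y : Type*} {B n : ℕ} (y : Fin (B * n) → Y) : Fin B → Fin n → Y :=
  fun b i => y (finProdFinEquiv (b, i))

lemma sum_cut {Y : Type*} [Fintype Y] {B n : ℕ} (F : (Fin B → Fin n → Y) → ℝ) :
    ∑ y : Fin (B * n) → Y, F (cut y) = ∑ z, F z := by
  rw [← ((Equiv.arrowCongr finProdFinEquiv.symm (Equiv.refl Y)).trans
    (Equiv.curry (Fin B) (Fin n) Y)).sum_comp]
  rfl

lemma trunc_cut_trunc {Y : Type*} [Nonempty Y] {B n : ℕ} (y : Fin (B * n) → Y) (b : Fin B)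
    (i : Fin n) :
    trunc (cut (trunc y (finProdFinEquiv (b, i)))) b = trunc (cut y) b := by
  funext b'
  unfold trunc
  split_ifs with hb
  · funext i'
    refine if_pos ?_
    rw [finProdFinEquiv_apply_val, finProdFinEquiv_apply_val]
    have h1 := i'.2
    have h2 : n * (b' + 1) ≤ n * b := Nat.mul_le_mul_left n hb
    simp only
    nlinarith
  · rfl

/-- A code of length `B` for blocks of `n` channel uses is a code of length `B * n` for the
channel. -/
lemma exists_flatten {S0 S1 S2 X1 X2 Y1 Y2 Y3 : Type*}
    [Fintype S0] [Fintype S1] [Fintype S2] [Fintype Y1] [Fintype Y2] [Fintype Y3]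
    [Nonempty Y1] [Nonempty Y2] [Nonempty Y3]
    (q0 : S0 → ℝ) (q1 : S1 → S0 → ℝ) (q2 : S2 → S0 → ℝ)
    (W : Y1 × Y2 × Y3 → X1 × X2 × S0 × S1 × S2 → ℝ) {B n K1 K2 : ℕ}
    (φ1 : Fin K1 → (Fin B → Fin n → S0) → (Fin B → Fin n → S1) → (Fin B → Fin n → Y1) →
      Fin B → Fin n → X1)
    (φ2 : Fin K2 → (Fin B → Fin n → S0) → (Fin B → Fin n → S2) → (Fin B → Fin n → Y2) →
      Fin B → Fin n → X2)
    (ψ : (Fin B → Fin n → Y3) → Fin K1 × Fin K2) :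
    ∃ (φ1' : Fin K1 → (Fin (B * n) → S0) → (Fin (B * n) → S1) → (Fin (B * n) → Y1) →
        Fin (B * n) → X1)
      (φ2' : Fin K2 → (Fin (B * n) → S0) → (Fin (B * n) → S2) → (Fin (B * n) → Y2) →
        Fin (B * n) → X2)
      (ψ' : (Fin (B * n) → Y3) → Fin K1 × Fin K2),
      Pe q0 q1 q2 W φ1' φ2' ψ' =
        Pe (fun s : Fin n → S0 => ∏ i, q0 (s i))
          (fun (s : Fin n → S1) (r : Fin n → S0) => ∏ i, q1 (s i) (r i))
          (fun (s : Fin n → S2) (r : Fin n → S0) => ∏ i, q2 (s i) (r i))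
          (fun (y : (Fin n → Y1) × (Fin n → Y2) × (Fin n → Y3))
            (c : (Fin n → X1) × (Fin n → X2) × (Fin n → S0) × (Fin n → S1) × (Fin n → S2)) =>
            ∏ i, W (y.1 i, y.2.1 i, y.2.2 i)
              (c.1 i, c.2.1 i, c.2.2.1 i, c.2.2.2.1 i, c.2.2.2.2 i)) φ1 φ2 ψ := by
  refine ⟨fun m s0 s1 y t => φ1 m (cut s0) (cut s1)
      (trunc (cut y) (finProdFinEquiv.symm t).1) (finProdFinEquiv.symm t).1
      (finProdFinEquiv.symm t).2,
    fun m s0 s2 y t => φ2 m (cut s0) (cut s2)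
      (trunc (cut y) (finProdFinEquiv.symm t).1) (finProdFinEquiv.symm t).1
      (finProdFinEquiv.symm t).2,
    fun y => ψ (cut y), ?_⟩
  unfold Pe
  congr 1
  refine sum_congr rfl fun m1 _ => sum_congr rfl fun m2 _ => ?_
  rw [← sum_cut]
  refine sum_congr rfl fun s0 _ => ?_
  rw [← sum_cut]
  refine sum_congr rfl fun s1 _ => ?_
  rw [← sum_cut]
  refine sum_congr rfl fun s2 _ => ?_
  rw [← sum_cut]
  refine sum_congr rfl fun y1 _ => ?_
  rw [← sum_cut]
  refine sum_congr rfl fun y2 _ => ?_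
  rw [← sum_cut]
  refine sum_congr rfl fun y3 _ => ?_
  congr 1
  unfold seqProb
  rw [← finProdFinEquiv.prod_comp, Fintype.prod_prod_type]
  refine prod_congr rfl fun b _ => ?_
  simp only [Equiv.symm_apply_apply, trunc_cut_trunc, prod_mul_distrib]
  rfl

end Flatten

/-! ### Achievability for one auxiliary distribution -/

section Achieve

lemma one_le_two_rpow {x : ℝ} (hx : 0 ≤ x) : (1 : ℝ) ≤ 2 ^ x :=
  Real.one_le_rpow (by norm_num) hx

lemma ceil_two_rpow_le {x : ℝ} (hx : 0 ≤ x) : (⌈(2 : ℝ) ^ x⌉₊ : ℝ) ≤ 2 ^ (x + 1) := by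
  have h1 := one_le_two_rpow hx
  have h2 := Nat.ceil_lt_add_one (zero_le_one.trans h1)
  rw [Real.rpow_add_one (by norm_num)]
  linarith

lemma le_logb_ceil (x : ℝ) : x ≤ Real.logb 2 ⌈(2 : ℝ) ^ x⌉₊ := by
  have h : (0 : ℝ) < 2 ^ x := by positivity
  calc x = Real.logb 2 (2 ^ x) := (Real.logb_rpow (by norm_num) (by norm_num)).symm
    _ ≤ _ := Real.logb_le_logb_of_le (by norm_num) h (Nat.le_ceil _)

lemma rate_le {n L : ℕ} (hn : 0 < n) {R R' ε : ℝ} (hε : R ≤ (L + 1) * ε) :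
    R + R' - ε ≤
      Real.logb 2 ((⌈(2 : ℝ) ^ (n * R)⌉₊ ^ L * ⌈(2 : ℝ) ^ (n * R')⌉₊ ^ (L + 1) : ℕ) : ℝ) /
        (((L + 1) * n : ℕ) : ℝ) := by
  have hn' : (0 : ℝ) < n := Nat.cast_pos.2 hn
  have h1 : (0 : ℝ) < ⌈(2 : ℝ) ^ (n * R)⌉₊ := Nat.cast_pos.2 (Nat.ceil_pos.2 (by positivity))
  have h2 : (0 : ℝ) < ⌈(2 : ℝ) ^ (n * R')⌉₊ := Nat.cast_pos.2 (Nat.ceil_pos.2 (by positivity))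
  push_cast
  rw [le_div_iff₀ (by positivity), Real.logb_mul (by positivity) (by positivity),
    Real.logb_pow, Real.logb_pow]
  have e1 := mul_le_mul_of_nonneg_left (le_logb_ceil (n * R)) (Nat.cast_nonneg (α := ℝ) L)
  have e2 := mul_le_mul_of_nonneg_left (le_logb_ceil (n * R'))
    (Nat.cast_nonneg (α := ℝ) (L + 1))
  push_cast at e2 ⊢
  nlinarith

variable {S0 S1 S2 U V1 V2 V13 V23 X1 X2 Y1 Y2 Y3 : Type*}
  [Fintype S0] [Fintype S1] [Fintype S2] [Fintype U] [Fintype V1] [Fintype V2]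
  [Fintype V13] [Fintype V23] [Fintype X1] [Fintype X2]
  [Fintype Y1] [Fintype Y2] [Fintype Y3]

/-- The block code for long blocks, with a bound on its average error probability. -/
lemma exists_long_blockCode [Nonempty U] [Nonempty V1] [Nonempty V2] [Nonempty V13]
    [Nonempty V23] [Nonempty X1] [Nonempty X2]
    (σ : Sys S0 S1 S2 U V1 V2 V13 V23 X1 X2 Y1 Y2 Y3) {R12 R13 R21 R23 : ℝ}
    (hR : Rates σ R12 R13 R21 R23) {ε : ℝ} (hε : 0 < ε) (hε1 : ε ≤ 1) :
    ∃ N : ℕ, ∀ n, N ≤ n → ∀ (A1 A2 D1 D2 : Type) [Fintype A1] [Fintype A2] [Fintype D1]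
      [Fintype D2] [Nonempty A1] [Nonempty A2] [Nonempty D1] [Nonempty D2],
      (Fintype.card A1 : ℝ) ≤ 2 ^ (n * R12 + 1) → (Fintype.card A2 : ℝ) ≤ 2 ^ (n * R21 + 1) →
      (Fintype.card D1 : ℝ) ≤ 2 ^ (n * R13 + 1) → (Fintype.card D2 : ℝ) ≤ 2 ^ (n * R23 + 1) →
      ∃ c : BlockCode (Fin n → S0) (Fin n → S1) (Fin n → S2) (Fin n → X1) (Fin n → X2)
        (Fin n → Y1) (Fin n → Y2) (Fin n → Y3) A1 A2 D1 D2,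
        ∑ w, ∑ a, ∑ d1, ∑ d2,
          (1 - c.success (σ.pow n).q0 (σ.pow n).q1 (σ.pow n).q2 (σ.pow n).W w a d1 d2) ≤
        Fintype.card (A1 × A2) * (Fintype.card (A1 × A2) *
          (Fintype.card D1 * (Fintype.card D2 * ε))) := by
  obtain ⟨N, hN⟩ := exists_longBlockCode σ hR hε hε1
  refine ⟨N, fun n hn A1 A2 D1 D2 _ _ _ _ _ _ _ _ h1 h2 h3 h4 => ?_⟩
  obtain ⟨f1, f2, g1, g2, h, hs⟩ := hN n hn A1 A2 D1 D2 h1 h2 h3 h4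
  let c : BlockCode (Fin n → S0) (Fin n → S1) (Fin n → S2) (Fin n → X1) (Fin n → X2)
    (Fin n → Y1) (Fin n → Y2) (Fin n → Y3) A1 A2 D1 D2 := ⟨f1, f2, g1, g2, h⟩
  refine ⟨c, ?_⟩
  have e1 : ∑ w : A1 × A2, ∑ a : A1 × A2, ∑ d1 : D1, ∑ d2 : D2,
      c.success (σ.pow n).q0 (σ.pow n).q1 (σ.pow n).q2 (σ.pow n).W w a d1 d2 =
      ∑ x : (A1 × A2) × A1 × A2 × D1 × D2,
        c.success (σ.pow n).q0 (σ.pow n).q1 (σ.pow n).q2 (σ.pow n).W x.1 (x.2.1, x.2.2.1)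
          x.2.2.2.1 x.2.2.2.2 := by
    symm
    rw [Fintype.sum_prod_type]
    refine sum_congr rfl fun w _ => ?_
    rw [Fintype.sum_prod_type, Fintype.sum_prod_type]
    refine sum_congr rfl fun a1 _ => ?_
    rw [Fintype.sum_prod_type]
    refine sum_congr rfl fun a2 _ => ?_
    rw [Fintype.sum_prod_type]
  have e2 : ∀ x : (A1 × A2) × A1 × A2 × D1 × D2,
      c.success (σ.pow n).q0 (σ.pow n).q1 (σ.pow n).q2 (σ.pow n).W x.1 (x.2.1, x.2.2.1)
        x.2.2.2.1 x.2.2.2.2 =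
      ∑ s : (Fin n → S0) × (Fin n → S1) × (Fin n → S2),
          ∑ y : (Fin n → Y1) × (Fin n → Y2) × (Fin n → Y3),
          (σ.pow n).q0 s.1 * (σ.pow n).q1 s.2.1 s.1 * (σ.pow n).q2 s.2.2 s.1 *
          (σ.pow n).W y (f1 x.1 x.2.1 x.2.2.2.1 s.1 s.2.1,
            f2 x.1 x.2.2.1 x.2.2.2.2 s.1 s.2.2, s) *
          ind (g1 x.1 x.2.1 x.2.2.2.1 s.1 s.2.1 y.1 = x.2.2.1 ∧
            g2 x.1 x.2.2.1 x.2.2.2.2 s.1 s.2.2 y.2.1 = x.2.1 ∧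
            h x.2.1 x.2.2.1 y.2.2 = (x.1, x.2.2.2)) := by
    intro x
    unfold BlockCode.success
    rw [Fintype.sum_prod_type]
    refine sum_congr rfl fun s0 _ => ?_
    rw [Fintype.sum_prod_type]
    refine sum_congr rfl fun s1 _ => sum_congr rfl fun s2 _ => ?_
    rw [Fintype.sum_prod_type]
    refine sum_congr rfl fun y1 _ => ?_
    rw [Fintype.sum_prod_type]
    rfl
  replace hs := hs.trans_eq ((sum_congr rfl fun x _ => (e2 x).symm).trans e1.symm)
  simp only [sum_sub_distrib, sum_const, card_univ, nsmul_eq_mul, mul_one]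
  simp only [Fintype.card_prod, Nat.cast_mul] at hs ⊢
  linarith

lemma achievable_of_rates [Nonempty U] [Nonempty V1] [Nonempty V2] [Nonempty V13]
    [Nonempty V23] [Nonempty X1] [Nonempty X2] [Nonempty Y1] [Nonempty Y2] [Nonempty Y3]
    (σ : Sys S0 S1 S2 U V1 V2 V13 V23 X1 X2 Y1 Y2 Y3) {R12 R13 R21 R23 : ℝ}
    (h12 : 0 ≤ R12) (h13 : 0 ≤ R13) (h21 : 0 ≤ R21) (h23 : 0 ≤ R23)
    (hR : Rates σ R12 R13 R21 R23) :
    Achievable σ.q0 σ.q1 σ.q2 σ.W (R12 + R13) (R21 + R23) := by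
  intro ε hε
  obtain ⟨L, hL⟩ := exists_nat_ge ((R12 + R21) / ε)
  rw [div_le_iff₀ hε] at hL
  have hL1 : (0 : ℝ) < L + 1 := by positivity
  obtain ⟨N, hN⟩ := exists_long_blockCode σ hR (ε := min 1 (ε / (L + 1)))
    (lt_min one_pos (by positivity)) (min_le_left _ _)
  set ε' := min 1 (ε / (L + 1)) with hε'
  set n := max N 1 with hn
  have hn0 : 0 < n := lt_of_lt_of_le one_pos (le_max_right N 1)
  have hpos : ∀ x : ℝ, 0 < ⌈(2 : ℝ) ^ x⌉₊ := fun x => Nat.ceil_pos.2 (by positivity)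
  have hne : ∀ x : ℝ, Nonempty (Fin ⌈(2 : ℝ) ^ x⌉₊) := fun x => ⟨⟨0, hpos x⟩⟩
  have i1 := hne (n * R12)
  have i2 := hne (n * R21)
  have i3 := hne (n * R13)
  have i4 := hne (n * R23)
  obtain ⟨c, hc⟩ := hN n (le_max_left _ _)
    (Fin ⌈(2 : ℝ) ^ (n * R12)⌉₊) (Fin ⌈(2 : ℝ) ^ (n * R21)⌉₊)
    (Fin ⌈(2 : ℝ) ^ (n * R13)⌉₊) (Fin ⌈(2 : ℝ) ^ (n * R23)⌉₊)
    (by rw [Fintype.card_fin]; exact ceil_two_rpow_le (by positivity))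
    (by rw [Fintype.card_fin]; exact ceil_two_rpow_le (by positivity))
    (by rw [Fintype.card_fin]; exact ceil_two_rpow_le (by positivity))
    (by rw [Fintype.card_fin]; exact ceil_two_rpow_le (by positivity))
  obtain ⟨K1, K2, φ1, φ2, ψ, hK1, hK2, hPe⟩ := c.exists_chained (σ.pow n).hq0 (σ.pow n).hq1
    (σ.pow n).hq2 (σ.pow n).hW hc L
  obtain ⟨φ1', φ2', ψ', hPe'⟩ := exists_flatten σ.q0 σ.q1 σ.q2 σ.W φ1 φ2 ψ
  rw [Fintype.card_fin, Fintype.card_fin] at hK1 hK2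
  refine ⟨(L + 1) * n, by positivity, K1, K2, ?_, ?_, φ1', φ2', ψ', ?_, ?_, ?_⟩
  · rw [hK1]
    exact Nat.mul_pos (Nat.pow_pos (hpos _)) (Nat.pow_pos (hpos _))
  · rw [hK2]
    exact Nat.mul_pos (Nat.pow_pos (hpos _)) (Nat.pow_pos (hpos _))
  · rw [hK1]
    exact rate_le hn0 (by nlinarith)
  · rw [hK2]
    exact rate_le hn0 (by nlinarith)
  · rw [hPe']
    refine hPe.trans ?_
    calc (L + 1 : ℝ) * ε' ≤ (L + 1) * (ε / (L + 1)) :=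
          mul_le_mul_of_nonneg_left (min_le_right _ _) hL1.le
      _ = ε := by field_simp

end Achieve

/-! ### The region and its closed convex hull -/

section Hull

lemma convexComb_lt {a b x y c : ℝ} (ha : 0 ≤ a) (hb : 0 ≤ b) (hab : a + b = 1) (hx : x < c)
    (hy : y < c) : a * x + b * y < c :=
  convex_Iio c hx hy ha hb hab

lemma convex_rates (c1 c2 c3 c4 c5 c6 : ℝ) :
    Convex ℝ {R : ℝ × ℝ | ∃ R12 R13 R21 R23 : ℝ, R.1 = R12 + R13 ∧ R.2 = R21 + R23 ∧
      0 ≤ R12 ∧ R12 < c1 ∧ 0 ≤ R21 ∧ R21 < c2 ∧ 0 ≤ R13 ∧ R13 < c3 ∧ 0 ≤ R23 ∧ R23 < c4 ∧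
      R13 + R23 < c5 ∧ R12 + R13 + R21 + R23 < c6} := by
  rintro ⟨x1, x2⟩ ⟨r1, r2, r3, r4, h1, h2, h3, h4, h5, h6, h7, h8, h9, h10, h11, h12⟩
    ⟨y1, y2⟩ ⟨t1, t2, t3, t4, g1, g2, g3, g4, g5, g6, g7, g8, g9, g10, g11, g12⟩ a b ha hb hab
  simp only at h1 h2 g1 g2
  refine ⟨a * r1 + b * t1, a * r2 + b * t2, a * r3 + b * t3, a * r4 + b * t4, ?_, ?_,
    by positivity, convexComb_lt ha hb hab h4 g4, by positivity, convexComb_lt ha hb hab h6 g6,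
    by positivity, convexComb_lt ha hb hab h8 g8, by positivity, convexComb_lt ha hb hab h10 g10,
    ?_, ?_⟩
  · simp only [Prod.fst_add, Prod.smul_fst, smul_eq_mul, h1, g1]
    ring
  · simp only [Prod.snd_add, Prod.smul_snd, smul_eq_mul, h2, g2]
    ring
  · convert convexComb_lt ha hb hab h11 g11 using 1
    ring
  · convert convexComb_lt ha hb hab h12 g12 using 1
    ring

lemma achievable_of_mem_closure {S0 S1 S2 X1 X2 Y1 Y2 Y3 : Type*}
    [Fintype S0] [Fintype S1] [Fintype S2] [Fintype Y1] [Fintype Y2] [Fintype Y3]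
    [Nonempty Y1] [Nonempty Y2] [Nonempty Y3]
    {q0 : S0 → ℝ} {q1 : S1 → S0 → ℝ} {q2 : S2 → S0 → ℝ}
    {W : Y1 × Y2 × Y3 → X1 × X2 × S0 × S1 × S2 → ℝ} {S : Set (ℝ × ℝ)}
    (hS : ∀ R ∈ S, Achievable q0 q1 q2 W R.1 R.2) {R : ℝ × ℝ} (hR : R ∈ closure S) :
    Achievable q0 q1 q2 W R.1 R.2 := by
  intro ε hε
  obtain ⟨R', hR', hd⟩ := Metric.mem_closure_iff.1 hR (ε / 2) (half_pos hε)
  obtain ⟨n, hn, K1, K2, hK1, hK2, φ1, φ2, ψ, h1, h2, h3⟩ := hS R' hR' (ε / 2) (half_pos hε)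
  rw [Prod.dist_eq, max_lt_iff, Real.dist_eq, Real.dist_eq] at hd
  have e1 := (abs_lt.1 hd.1).2
  have e2 := (abs_lt.1 hd.2).2
  exact ⟨n, hn, K1, K2, hK1, hK2, φ1, φ2, ψ, by linarith, by linarith, by linarith⟩

variable {S0 S1 S2 U V1 V2 V13 V23 X1 X2 Y1 Y2 Y3 : Type*}
  [Fintype S0] [Fintype S1] [Fintype S2] [Fintype U] [Fintype V1] [Fintype V2]
  [Fintype V13] [Fintype V23] [Fintype X1] [Fintype X2]
  [Fintype Y1] [Fintype Y2] [Fintype Y3]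

lemma convex_region
    (p : S0 × S1 × S2 × U × V1 × V2 × V13 × V23 × X1 × X2 × Y1 × Y2 × Y3 → ℝ) :
    Convex ℝ (region p) :=
  convex_rates _ _ _ _ _ _

/-- Disintegration of a conditional pmf on a product. -/
lemma IsCondPMF.exists_split {A X B : Type*} [Fintype A] [Fintype X] [Nonempty X]
    {q : A × X → B → ℝ} (hq : IsCondPMF q) :
    ∃ (k : A → B → ℝ) (k' : X → A × B → ℝ), IsCondPMF k ∧ IsCondPMF k' ∧
      ∀ a x b, q (a, x) b = k a b * k' x (a, b) := by
  classical
  have hX : (Fintype.card X : ℝ) ≠ 0 := Nat.cast_ne_zero.2 Fintype.card_ne_zero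
  have hk : ∀ a b, 0 ≤ ∑ x, q (a, x) b := fun a b => sum_nonneg fun x _ => hq.1 _ _
  refine ⟨fun a b => ∑ x, q (a, x) b,
    fun x c => if ∑ x, q (c.1, x) c.2 = 0 then (Fintype.card X : ℝ)⁻¹
      else q (c.1, x) c.2 / ∑ x, q (c.1, x) c.2, ⟨hk, fun b => ?_⟩, ⟨fun x c => ?_, fun c => ?_⟩,
    fun a x b => ?_⟩
  · rw [← hq.2 b, Fintype.sum_prod_type]
  · dsimp only
    split_ifs
    · positivity
    · exact div_nonneg (hq.1 _ _) (hk _ _)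
  · by_cases h : ∑ x, q (c.1, x) c.2 = 0
    · simp only [if_pos h, sum_const, card_univ, nsmul_eq_mul, mul_inv_cancel₀ hX]
    · simp only [if_neg h]
      rw [← sum_div, div_self h]
  · by_cases h : ∑ x, q (a, x) b = 0
    · have := (sum_eq_zero_iff_of_nonneg fun x _ => hq.1 (a, x) b).1 h x (mem_univ x)
      simp only [h, if_true, this, zero_mul]
    · simp only [if_neg h]
      rw [mul_div_cancel₀ _ h]

lemma IsCondPMF.nonempty {A B : Type*} [Fintype A] {q : A → B → ℝ} (hq : IsCondPMF q) (b : B) :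
    Nonempty A := by
  by_contra h
  rw [not_nonempty_iff] at h
  simpa using hq.2 b

end Hull

/-- **Theorem 1.** For the two-user state-dependent DM GMAC with correlated states,
where `(S₀, S_k)` is noncausally known at encoder `k` and each encoder observes a
strictly causal feedback output, every rate pair in the closure of the convex hull of
the rate region associated with any joint pmf of the form (2) is achievable. -/
theorem theorem1
    (q0 : 𝒮0 → ℝ) (hq0 : (∀ s0, 0 ≤ q0 s0) ∧ ∑ s0, q0 s0 = 1)
    (q1 : 𝒮1 → 𝒮0 → ℝ) (hq1 : IsCondPMF q1)
    (q2 : 𝒮2 → 𝒮0 → ℝ) (hq2 : IsCondPMF q2)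
    (W : 𝒴1 × 𝒴2 × 𝒴3 → 𝒳1 × 𝒳2 × 𝒮0 × 𝒮1 × 𝒮2 → ℝ) (hW : IsCondPMF W)
    {U V1 V2 V13 V23 : Type*}
    [Fintype U] [Fintype V1] [Fintype V2] [Fintype V13] [Fintype V23]
    (pU : U → 𝒮0 → ℝ) (hpU : IsCondPMF pU)
    (pV1 : V1 → 𝒮0 × 𝒮1 × U → ℝ) (hpV1 : IsCondPMF pV1)
    (pV2 : V2 → 𝒮0 × 𝒮2 × U → ℝ) (hpV2 : IsCondPMF pV2)
    (pA : V13 × 𝒳1 → U × V1 × 𝒮0 × 𝒮1 → ℝ) (hpA : IsCondPMF pA)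
    (pB : V23 × 𝒳2 → U × V2 × 𝒮0 × 𝒮2 → ℝ) (hpB : IsCondPMF pB)
    (p : 𝒮0 × 𝒮1 × 𝒮2 × U × V1 × V2 × V13 × V23 × 𝒳1 × 𝒳2 × 𝒴1 × 𝒴2 × 𝒴3 → ℝ)
    (hp : ∀ s0 s1 s2 u v1 v2 v13 v23 x1 x2 y1 y2 y3,
      p (s0, s1, s2, u, v1, v2, v13, v23, x1, x2, y1, y2, y3) =
        q0 s0 * q1 s1 s0 * q2 s2 s0 * pU u s0 * pV1 v1 (s0, s1, u) *
          pV2 v2 (s0, s2, u) * pA (v13, x1) (u, v1, s0, s1) *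
          pB (v23, x2) (u, v2, s0, s2) * W (y1, y2, y3) (x1, x2, s0, s1, s2))
    (R1 R2 : ℝ)
    (hR : (R1, R2) ∈ closure (convexHull ℝ (region p))) :
    Achievable q0 q1 q2 W R1 R2 := by
  obtain ⟨k13, kx1, hk13, hkx1, hA⟩ := hpA.exists_split
  obtain ⟨k23, kx2, hk23, hkx2, hB⟩ := hpB.exists_split
  have s0 : 𝒮0 := Classical.arbitrary 𝒮0
  have s1 : 𝒮1 := Classical.arbitrary 𝒮1
  have s2 : 𝒮2 := Classical.arbitrary 𝒮2
  obtain ⟨u⟩ := hpU.nonempty s0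
  obtain ⟨v1⟩ := hpV1.nonempty (s0, s1, u)
  obtain ⟨v2⟩ := hpV2.nonempty (s0, s2, u)
  obtain ⟨v13⟩ := hk13.nonempty (u, v1, s0, s1)
  obtain ⟨v23⟩ := hk23.nonempty (u, v2, s0, s2)
  have : Nonempty U := ⟨u⟩
  have : Nonempty V1 := ⟨v1⟩
  have : Nonempty V2 := ⟨v2⟩
  have : Nonempty V13 := ⟨v13⟩
  have : Nonempty V23 := ⟨v23⟩
  let σ : Sys 𝒮0 𝒮1 𝒮2 U V1 V2 V13 V23 𝒳1 𝒳2 𝒴1 𝒴2 𝒴3 :=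
    { q0 := q0, q1 := q1, q2 := q2, k0 := pU, k1 := pV1, k2 := pV2, k13 := k13, k23 := k23,
      kx1 := kx1, kx2 := kx2, W := W, hq0 := hq0, hq1 := hq1, hq2 := hq2, hk0 := hpU,
      hk1 := hpV1, hk2 := hpV2, hk13 := hk13, hk23 := hk23, hkx1 := hkx1, hkx2 := hkx2,
      hW := hW }
  have hpσ : p = σ.P := by
    funext ⟨s0, s1, s2, u, v1, v2, v13, v23, x1, x2, y1, y2, y3⟩
    rw [hp, hA, hB]
    rfl
  rw [(convex_region p).convexHull_eq] at hR
  refine achievable_of_mem_closure (fun R h => ?_) hR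
  rw [hpσ] at h
  obtain ⟨R12, R13, R21, R23, e1, e2, h12, h13, h21, h23, hrates⟩ :=
    exists_rates_of_mem_region σ h
  rw [e1, e2]
  exact achievable_of_rates σ h12 h13 h21 h23 hrates

end Stmt0
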